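/- arXiv:1210.0919 — 5 statements merged into one kernel-verified Lean document; each statement's English description precedes it below -/
import Mathlib

section
/- Fix an integer m ≥ 1, a real number τ, and η ≥ 0, and assume that (−1)^m·β(t) ≥ 0 for almost every t ∈ [τ, τ+η]. Then the m-fold exterior power W(τ+η, τ) of the solution operator of (∗) is a positive operator with respect to the cone K_m; that is, W(τ+η, τ) maps K_m into K_m. -/
open MeasureTheory

noncomputable section

abbrev I01 : Set ℝ := Set.Icc (-1 : ℝ) 0

abbrev Cube (m : ℕ) := Fin m → I01

/-- The subspace of antisymmetric continuous functions on the cube `[-1,0]^m`. -/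
def Xwedge (m : ℕ) : Submodule ℝ C(Cube m, ℝ) where
  carrier := {φ | ∀ (σ : Equiv.Perm (Fin m)) (θ : Cube m),
      φ (θ ∘ σ) = ((Equiv.Perm.sign σ : ℤ) : ℝ) * φ θ}
  add_mem' := by
    intro φ ψ hφ hψ σ θ
    simp only [ContinuousMap.add_apply, hφ σ θ, hψ σ θ]
    ring
  zero_mem' := by
    intro σ θ
    simp
  smul_mem' := by
    intro c φ hφ σ θ
    simp only [ContinuousMap.smul_apply, hφ σ θ, smul_eq_mul]
    ring

/-- The fundamental simplex `T_m` of ordered tuples. -/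
def TsetC (m : ℕ) : Set (Cube m) := {θ | Monotone fun i => (θ i : ℝ)}

/-- The cone `K_m`. -/
def Kcone (m : ℕ) : Set (Xwedge m) :=
  {φ | ∀ θ ∈ TsetC m, 0 ≤ (φ : C(Cube m, ℝ)) θ}

/-- A solution of `x'(t) = -α(t) x(t) - β(t) x(t-1)` on `[τ-1, T]`. -/
def IsSolution (a c : ℝ → ℝ) (τ T : ℝ) (x : ℝ → ℝ) : Prop :=
  ContinuousOn x (Set.Icc (τ - 1) T) ∧
  ∀ t ∈ Set.Icc τ T, x t = x τ - ∫ s in τ..t, (a s * x s + c s * x (s - 1))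

/-- `W` is the `m`-fold exterior power of the solution operator from time `τ` to time `t`. -/
def IsWedgePower (a c : ℝ → ℝ) (m : ℕ) (τ t : ℝ) (W : Xwedge m →L[ℝ] Xwedge m) : Prop :=
  ∀ x : Fin m → ℝ → ℝ, (∀ i, IsSolution a c τ t (x i)) →
    ∀ Φ Ψ : Xwedge m,
      (∀ θ : Cube m, (Φ : C(Cube m, ℝ)) θ = (Matrix.of fun i j => x i (τ + (θ j : ℝ))).det) →
      (∀ θ : Cube m, (Ψ : C(Cube m, ℝ)) θ = (Matrix.of fun i j => x i (t + (θ j : ℝ))).det) →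
      W Φ = Ψ

def InDCone {V : Type*} [AddCommGroup V] [Module ℝ V] (S : Set V) (v : V) : Prop :=
  ∀ l : V →ₗ[ℝ] ℝ, (∀ s ∈ S, 0 ≤ l s) → 0 ≤ l v

theorem lemG {V : Type*} [AddCommGroup V] [Module ℝ V] {m : ℕ}
    (D : V [⋀^Fin m]→ₗ[ℝ] ℝ) (Y : Fin m → V) (S : Fin m → Set V)
    (hY : ∀ j, InDCone (S j) (Y j) ∨ ∃ i, i < j ∧ ∃ c : ℝ, InDCone (S j) (Y j - c • Y i))
    (hS : ∀ w : Fin m → V, (∀ j, w j ∈ S j) → 0 ≤ D w) : 0 ≤ D Y := by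
  have key : ∀ p : ℕ, p ≤ m → ∀ w : Fin m → V, (∀ j : Fin m, j.1 < p → w j = Y j) →
      (∀ j : Fin m, p ≤ j.1 → w j ∈ S j) → 0 ≤ D w := by
    intro p
    induction p with
    | zero => intro _ w _ h2; exact hS w (fun j => h2 j (Nat.zero_le _))
    | succ p ih =>
      intro hp w h1 h2
      have hpm : p < m := hp
      let q : Fin m := ⟨p, hpm⟩
      have hwq : w q = Y q := h1 q (Nat.lt_succ_self p)
      have hpos : ∀ v, InDCone (S q) v → 0 ≤ D (Function.update w q v) := by
        intro v hv
        refine hv (D.toMultilinearMap.toLinearMap w q) ?_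
        intro s hs
        change 0 ≤ D (Function.update w q s)
        refine ih hpm.le _ ?_ ?_
        · intro j hj
          have : j ≠ q := by rintro rfl; exact lt_irrefl _ hj
          rw [Function.update_of_ne this]
          exact h1 j (by omega)
        · intro j hj
          by_cases hjq : j = q
          · subst hjq; simpa using hs
          · rw [Function.update_of_ne hjq]
            refine h2 j ?_
            have : j.1 ≠ p := fun h => hjq (Fin.ext h)
            omega
      rcases hY q with h | ⟨i, hi, c, h⟩
      · have := hpos _ h
        rwa [← hwq, Function.update_eq_self] at this
      · have h3 := hpos _ h
        have hiq : i ≠ q := ne_of_lt hi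
        have hwi : w i = Y i := h1 i (by have : i.1 < p := hi; omega)
        have e : D w = D (Function.update w q (Y q - c • Y i)) := by
          rw [sub_eq_add_neg, ← neg_smul, D.map_update_add, D.map_update_smul, ← hwi, 
            D.map_update_self _ hiq.symm, ← hwq, Function.update_eq_self]
          simp
        rw [e]; exact h3
  exact key m le_rfl Y (fun _ _ => rfl) (fun j hj => absurd j.2 (by omega))

theorem lemCyc {V : Type*} [AddCommGroup V] [Module ℝ V] {n : ℕ}
    (D : V [⋀^Fin (n+1)]→ₗ[ℝ] ℝ) (y : ℝ → V) (σ : ℝ)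
    (H : ∀ t : Fin (n+1) → ℝ, Monotone t → (∀ j, σ - 1 ≤ t j ∧ t j ≤ σ) → 0 ≤ D (fun j => y (t j)))
    (z : ℝ → V) (hz1 : ∀ u ≤ σ, z u = y u) 
    (hz2 : ∀ u > σ, z u = ((-1:ℝ)^n) • y (u - 1)) (u : Fin (n+1) → ℝ) (hu : Monotone u)
    (hb : ∀ j, σ - 1 ≤ u j ∧ u j ≤ σ + 1) (hij : ∀ i j, u j ≤ u i + 1) : 
    0 ≤ D (fun j => z (u j)) := by
  have key : ∀ p : ℕ, ∀ u : Fin (n+1) → ℝ, Monotone u → 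
    (∀ j, σ - 1 ≤ u j ∧ u j ≤ σ + 1) → (∀ i j, u j ≤ u i + 1) → 
    (∀ j : Fin (n+1), j.1 + p < n + 1 → u j ≤ σ) → 0 ≤ D (fun j => z (u j)) := by
    intro p
    induction p with
    | zero =>
      intro u hu hb _ h
      have h' : ∀ j, u j ≤ σ := fun j => h j j.2
      have : (fun j => z (u j)) = fun j => y (u j) := funext fun j => hz1 _ (h' j)
      rw [this]
      exact H u hu fun j => ⟨(hb j).1, h' j⟩
    | succ p ih =>
      intro u hu hb hij h
      by_cases hl : u (Fin.last n) ≤ σ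
      · exact ih u hu hb hij (fun j _ => (hu (Fin.le_last j)).trans hl)
      push Not at hl
      have hbl := hb (Fin.last n)
      let u' : Fin (n+1) → ℝ := Fin.cons (u (Fin.last n) - 1) (fun j : Fin n => u j.castSucc)
      have h1 : 0 ≤ D (fun j => z (u' j)) := by
        apply ih u'
        · intro a b
          refine Fin.cases ?_ (fun i => ?_) a <;> refine Fin.cases ?_ (fun j => ?_) b <;> 
            simp only [u', Fin.cons_zero, Fin.cons_succ]
          · intro _; exact le_rfl
          · intro _; have := hij j.castSucc (Fin.last n); linarith
          · intro hh; exact absurd hh (by simp)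
          · intro hh; exact hu (by simpa using hh)
        · intro j
          refine Fin.cases ?_ (fun i => ?_) j
          · simp only [u', Fin.cons_zero]; constructor <;> linarith
          · simp only [u', Fin.cons_succ]; exact hb _
        · intro i j
          refine Fin.cases ?_ (fun i => ?_) i <;> refine Fin.cases ?_ (fun j => ?_) j <;> 
            simp only [u', Fin.cons_zero, Fin.cons_succ]
          · linarith
          · have := hu (Fin.le_last j.castSucc); linarith
          · have := hij i.castSucc (Fin.last n); linarith
          · exact hij _ _
        · intro j
          refine Fin.cases ?_ (fun i => ?_) j <;> 
            simp only [u', Fin.cons_zero, Fin.cons_succ]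
          · intro _; linarith
          · intro hh; exact h _ (by simp at hh ⊢; omega)
      have e : (fun j => z (u j)) = Function.update ((fun j => z (u' j)) ∘ finRotate (n+1)) (Fin.last n)
          (((-1:ℝ)^n) • (((fun j => z (u' j)) ∘ finRotate (n+1)) (Fin.last n))) := by
        funext j
        refine Fin.lastCases ?_ (fun j => ?_) j
        · simp [u']
          rw [hz2 _ hl, hz1 _ (by linarith)]
        · rw [Function.update_of_ne (Fin.castSucc_lt_last j).ne]
          simp [u', Fin.coeSucc_eq_succ]
      rw [e, D.map_update_smul, Function.update_eq_self, D.map_perm, sign_finRotate]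
      simp only [Nat.add_sub_cancel]
      rw [Units.smul_def, Units.val_pow_eq_pow_val, Units.val_neg, Units.val_one, zsmul_eq_mul]
      push_cast
      rw [smul_eq_mul, ← mul_assoc, ← mul_pow]
      simpa using h1
  exact key (n+1) u hu hb hij (fun j hj => absurd hj (by omega))

theorem locII {V : Type*} [NormedAddCommGroup V] {f : ℝ → V} (hf : LocallyIntegrable f)
    (a b : ℝ) : IntervalIntegrable f volume a b :=
  intervalIntegrable_iff.mpr
    ((hf.integrableOn_isCompact isCompact_uIcc).mono_set Set.uIoc_subset_uIcc)

theorem cone_int {V : Type*} [NormedAddCommGroup V] [NormedSpace ℝ V] [FiniteDimensional ℝ V]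
    (n : ℕ) (b : ℝ → ℝ) (y z : ℝ → V) (hb : LocallyIntegrable b) (hy : Continuous y) (σ : ℝ)
    (hz2 : ∀ u > σ, z u = ((-1:ℝ)^n) • y (u - 1)) (s t : ℝ) (hs : σ ≤ s) (hst : s ≤ t)
    (hsign : ∀ᵐ u, u ∈ Set.Ioc s t → 0 ≤ (-1:ℝ)^(n+1) * b u) (S : Set V)
    (hS : ∀ u, s < u → u ≤ t → z u ∈ S) :
    InDCone S (∫ u in s..t, (-(b u)) • y (u - 1)) := by
  intro l hl
  have hint : LocallyIntegrable (fun u => (-(b u)) • y (u - 1)) := 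
    LocallyIntegrable.smul_continuous (hy.comp (continuous_id.sub continuous_const)) hb.neg
  have := (LinearMap.toContinuousLinearMap l).intervalIntegral_comp_comm
    (locII hint s t) 
  change 0 ≤ (LinearMap.toContinuousLinearMap l) _
  rw [← this, intervalIntegral.integral_of_le hst]
  refine setIntegral_nonneg_of_ae_restrict ?_
  rw [Filter.EventuallyLE, ae_restrict_iff' measurableSet_Ioc]
  filter_upwards [hsign] with u hu hmem
  have h1 := hu hmem
  have h2 := hl _ (hS u hmem.1 hmem.2)
  rw [hz2 u (lt_of_le_of_lt hs hmem.1), map_smul, smul_eq_mul] at h2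
  simp only [Pi.zero_apply, LinearMap.coe_toContinuousLinearMap', map_smul, smul_eq_mul]
  have h3 := mul_nonneg h1 h2
  have : (-1:ℝ)^(n+1) * b u * ((-1)^n * l (y (u-1))) = ((-1)^n*(-1:ℝ)^n) * (-(b u) * l (y (u-1))) := by
    ring
  rw [this, ← mul_pow] at h3
  simpa using h3

theorem stepThm {V : Type*} [NormedAddCommGroup V] [NormedSpace ℝ V] [FiniteDimensional ℝ V]
    {n : ℕ} (D : V [⋀^Fin (n+1)]→ₗ[ℝ] ℝ) (b : ℝ → ℝ) (y : ℝ → V) (hb : LocallyIntegrable b)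
    (hy : Continuous y) (σ h : ℝ) (h1 : h ≤ 1) 
    (hdiff : ∀ s t, σ ≤ s → s ≤ t → t ≤ σ + h → y t - y s = ∫ u in s..t, (-(b u)) • y (u - 1))
    (hsign : ∀ᵐ u, u ∈ Set.Ioc σ (σ+h) → 0 ≤ (-1:ℝ)^(n+1) * b u)
    (H : ∀ t : Fin (n+1) → ℝ, Monotone t → (∀ j, σ - 1 ≤ t j ∧ t j ≤ σ) → 0 ≤ D (fun j => y (t j)))
    (h0 : 0 ≤ h)
    (t : Fin (n+1) → ℝ) (ht : Monotone t) (htb : ∀ j, σ + h - 1 ≤ t j ∧ t j ≤ σ + h) :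
    0 ≤ D (fun j => y (t j)) := by
  let z : ℝ → V := fun u => if u ≤ σ then y u else ((-1:ℝ)^n) • y (u - 1)
  have hz1 : ∀ u ≤ σ, z u = y u := fun u hu => by simp [z, hu]
  have hz2 : ∀ u > σ, z u = ((-1:ℝ)^n) • y (u - 1) := fun u hu => by simp [z, not_le.2 hu]
  let S : Fin (n+1) → Set V := fun j => 
    z '' {s | s ≤ t j ∧ (∀ i < j, t i ≤ s) ∧ min σ (t j) ≤ s}
  apply lemG D _ S
  · intro j
    by_cases hj : t j ≤ σ
    · left
      intro l hl
      rw [← hz1 _ hj]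
      exact hl _ ⟨t j, ⟨le_rfl, fun i hi => ht hi.le, min_le_right _ _⟩, rfl⟩
    push Not at hj
    by_cases hp : ∃ i < j, σ < t i
    · right
      obtain ⟨i0, hi0, hi0'⟩ := hp
      have hjp : 0 < j.1 := lt_of_le_of_lt (Nat.zero_le _) hi0
      let i : Fin (n+1) := ⟨j.1 - 1, by omega⟩
      have hij : i < j := by change j.1 - 1 < j.1; omega
      have himax : ∀ k < j, k ≤ i := by
        intro k hk; change k.1 ≤ j.1 - 1; have : k.1 < j.1 := hk; omega
      have hσi : σ ≤ t i := hi0'.le.trans (ht (himax _ hi0))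
      refine ⟨i, hij, 1, ?_⟩
      rw [one_smul, hdiff _ _ hσi (ht hij.le) (htb j).2]
      apply cone_int n b y z hb hy σ hz2 _ _ hσi (ht hij.le)
      · filter_upwards [hsign] with u hu hm
        exact hu ⟨lt_of_le_of_lt hσi hm.1, hm.2.trans (htb j).2⟩
      · intro u hu1 hu2
        exact ⟨u, ⟨hu2, fun k hk => (ht (himax k hk)).trans hu1.le, 
          (min_le_left _ _).trans (hσi.trans hu1.le)⟩, rfl⟩
    · left
      push Not at hp
      have e : y (t j) = y σ + ∫ u in σ..(t j), (-(b u)) • y (u - 1) := by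
        rw [← hdiff σ (t j) le_rfl hj.le (htb j).2]; abel
      have hc := cone_int n b y z hb hy σ hz2 σ (t j) le_rfl hj.le (by
        filter_upwards [hsign] with u hu hm
        exact hu ⟨hm.1, hm.2.trans (htb j).2⟩) (S j) (by
        intro u hu1 hu2
        exact ⟨u, ⟨hu2, fun k hk => (hp k hk).trans hu1.le, (min_le_left _ _).trans hu1.le⟩, rfl⟩)
      intro l hl
      rw [e, map_add]
      refine add_nonneg ?_ (hc l hl)
      rw [← hz1 σ le_rfl]
      exact hl _ ⟨σ, ⟨hj.le, hp, min_le_left _ _⟩, rfl⟩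
  · intro w hw
    choose u hu huw using hw
    have : w = fun j => z (u j) := funext fun j => (huw j).symm
    rw [this]
    have hlow : ∀ j, σ + h - 1 ≤ u j := by
      intro j
      have h3 := (hu j).2.2
      have h4 := (htb j).1
      refine le_trans (le_min ?_ h4) h3
      linarith
    apply lemCyc D y σ H z hz1 hz2
    · intro i j hij
      rcases hij.eq_or_lt with rfl | hij
      · exact le_rfl
      · exact (hu i).1.trans ((hu j).2.1 i hij)
    · intro j
      have := hlow j; have := (hu j).1; have := (htb j).2
      constructor <;> linarith
    · intro i j
      have := hlow i; have := (hu j).1; have := (htb j).2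
      linarith

theorem iterThm {V : Type*} [NormedAddCommGroup V] [NormedSpace ℝ V] [FiniteDimensional ℝ V]
    {n : ℕ} (D : V [⋀^Fin (n+1)]→ₗ[ℝ] ℝ) (b : ℝ → ℝ) (y : ℝ → V) (hb : LocallyIntegrable b)
    (hy : Continuous y) (τ η : ℝ) (hη : 0 ≤ η)
    (hdiff : ∀ s t, τ ≤ s → s ≤ t → t ≤ τ + η → y t - y s = ∫ u in s..t, (-(b u)) • y (u - 1))
    (hsign : ∀ᵐ u, u ∈ Set.Ioc τ (τ+η) → 0 ≤ (-1:ℝ)^(n+1) * b u)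
    (H : ∀ t : Fin (n+1) → ℝ, Monotone t → (∀ j, τ - 1 ≤ t j ∧ t j ≤ τ) → 0 ≤ D (fun j => y (t j)))
    (t : Fin (n+1) → ℝ) (ht : Monotone t) (htb : ∀ j, τ + η - 1 ≤ t j ∧ t j ≤ τ + η) :
    0 ≤ D (fun j => y (t j)) := by
  have key : ∀ N : ℕ, ∀ e : ℝ, 0 ≤ e → e ≤ η → e ≤ N → ∀ t : Fin (n+1) → ℝ, Monotone t → 
      (∀ j, τ + e - 1 ≤ t j ∧ t j ≤ τ + e) → 0 ≤ D (fun j => y (t j)) := by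
    intro N
    induction N with
    | zero =>
      intro e he _ he0 t ht htb
      have : e = 0 := le_antisymm (by simpa using he0) he
      subst this
      exact H t ht (by simpa using htb)
    | succ N ih =>
      intro e he heη heN t ht htb
      push_cast at heN
      have hd : max (e - 1) 0 ≤ e := max_le (by linarith) he
      have hd' : e - 1 ≤ max (e - 1) 0 := le_max_left _ _
      have hd0 : 0 ≤ max (e - 1) 0 := le_max_right _ _
      have hdN : max (e - 1) 0 ≤ N := max_le (by linarith) (Nat.cast_nonneg _)
      generalize max (e-1) 0 = d at hd hd' hd0 hdN
      refine stepThm D b y hb hy (τ + d) (e - d) (by linarith) ?_ ?_ ?_ (by linarith) t ht ?_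
      · intro s t h1 h2 h3
        exact hdiff s t (by linarith) h2 (by linarith)
      · filter_upwards [hsign] with u hu hm
        exact hu ⟨by linarith [hm.1], by linarith [hm.2]⟩
      · exact ih d hd0 (hd.trans heη) hdN
      · intro j
        have := htb j
        constructor <;> linarith
  obtain ⟨N, hN⟩ := exists_nat_ge η
  exact key N η hη le_rfl hN t ht htb

theorem exY {V : Type*} [NormedAddCommGroup V] [NormedSpace ℝ V] [FiniteDimensional ℝ V]
    (b : ℝ → ℝ) (hb : LocallyIntegrable b) (ψ : ℝ → V) (hψ : Continuous ψ) (τ : ℝ) (N : ℕ) :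
    ∃ y : ℝ → V, Continuous y ∧ (∀ t ≤ τ, y t = ψ t) ∧
      ∀ t, τ ≤ t → t ≤ τ + N → y t = ψ τ + ∫ u in τ..t, (-(b u)) • y (u - 1) := by
  induction N with
  | zero =>
    refine ⟨ψ, hψ, fun _ _ => rfl, ?_⟩
    intro t h1 h2
    have : t = τ := le_antisymm (by simpa using h2) h1
    subst this
    simp
  | succ N ih =>
    obtain ⟨y, hy, hy1, hy2⟩ := ih
    have hint : LocallyIntegrable (fun u => (-(b u)) • y (u - 1)) := 
      LocallyIntegrable.smul_continuous (hy.comp (continuous_id.sub continuous_const)) hb.neg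
    let y' : ℝ → V := fun t => ψ (min t τ) + ∫ u in τ..(max t τ), (-(b u)) • y (u - 1)
    have e1 : ∀ t ≤ τ, y' t = ψ t := fun t ht => by simp [y', ht]
    have e2 : ∀ t, τ ≤ t → y' t = ψ τ + ∫ u in τ..t, (-(b u)) • y (u - 1) := 
      fun t ht => by simp [y', ht]
    have e3 : ∀ t ≤ τ + N, y' t = y t := by
      intro t ht
      rcases le_total t τ with h | h
      · rw [e1 t h, hy1 t h]
      · rw [e2 t h, hy2 t h ht]
    refine ⟨y', ?_, e1, ?_⟩
    · have : Continuous (fun t => ∫ u in τ..t, (-(b u)) • y (u - 1)) := 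
        intervalIntegral.continuous_primitive (fun a b => locII hint a b) τ
      exact (hψ.comp (continuous_id.min continuous_const)).add 
        (this.comp (continuous_id.max continuous_const))
    · intro t h1 h2
      rw [e2 t h1]
      congr 1
      apply intervalIntegral.integral_congr
      intro u hu
      rw [Set.uIcc_of_le h1] at hu
      push_cast at h2
      simp only
      rw [e3 (u - 1) (by linarith [hu.2])]

theorem exp_ac (A : ℝ → ℝ) (a b : ℝ) (hA : AbsolutelyContinuousOnInterval A a b) :
    AbsolutelyContinuousOnInterval (fun t => Real.exp (A t)) a b := by
  obtain ⟨C, hC⟩ := hA.exists_bound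
  have hlip : ∀ x ∈ Set.Iic C, ∀ y ∈ Set.Iic C, ‖Real.exp y - Real.exp x‖ ≤ Real.exp C * ‖y - x‖ := by
    intro x hx y hy
    refine (convex_Iic C).norm_image_sub_le_of_norm_deriv_le (f := Real.exp) 
      (fun x _ => Real.differentiableAt_exp) ?_ hx hy
    intro x hx
    rw [Real.deriv_exp, Real.norm_eq_abs, abs_of_pos (Real.exp_pos _)]
    exact Real.exp_le_exp.2 hx
  rw [absolutelyContinuousOnInterval_iff] at hA ⊢
  intro ε hε
  obtain ⟨δ, hδ, h⟩ := hA (ε / Real.exp C) (by positivity)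
  refine ⟨δ, hδ, fun E hE hEδ => ?_⟩
  have h1 := h E hE hEδ
  rw [lt_div_iff₀ (Real.exp_pos _)] at h1
  refine lt_of_le_of_lt ?_ h1
  rw [Finset.sum_mul]
  refine Finset.sum_le_sum fun i hi => ?_
  have := hE.1 i hi
  rw [dist_eq_norm, dist_eq_norm, mul_comm]
  exact hlip _ ((le_abs_self _).trans (hC _ this.2)) _ ((le_abs_self _).trans (hC _ this.1))

theorem isSol (α β : ℝ → ℝ) (hα : LocallyIntegrable α) (hβ : LocallyIntegrable β) (τ T : ℝ)
    (A b y : ℝ → ℝ) (hA : A = fun t => ∫ u in τ..t, α u) 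
    (hb : b = fun u => β u * Real.exp (A u - A (u - 1))) (hy : Continuous y)
    (hyt : ∀ t, τ ≤ t → t ≤ T → y t = y τ + ∫ u in τ..t, (-(b u)) * y (u - 1)) :
    IsSolution α β τ T (fun t => Real.exp (-(A t)) * y t) := by
  have hAc : Continuous A := by
    rw [hA]; exact intervalIntegral.continuous_primitive (fun a b => locII hα a b) τ
  have hbl : LocallyIntegrable b := by
    rw [hb]
    apply LocallyIntegrable.mul_continuous _ hβ
    fun_prop
  have hg : LocallyIntegrable (fun u => (-(b u)) * y (u - 1)) := 
    LocallyIntegrable.mul_continuous (by fun_prop) hbl.neg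
  refine ⟨by fun_prop, ?_⟩
  intro t ht
  let G : ℝ → ℝ := fun s => y τ + ∫ u in τ..s, (-(b u)) * y (u - 1)
  let F : ℝ → ℝ := fun s => Real.exp (-(A s)) * G s
  have hG : AbsolutelyContinuousOnInterval G τ t := by
    have hc : AbsolutelyContinuousOnInterval (fun _ : ℝ => y τ) τ t := 
      (LipschitzWith.const (y τ)).lipschitzOnWith.absolutelyContinuousOnInterval
    exact hc.fun_add 
      ((locII hg τ t).absolutelyContinuousOnInterval_intervalIntegral Set.left_mem_uIcc)
  have hE : AbsolutelyContinuousOnInterval (fun s => Real.exp (-(A s))) τ t := by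
    apply exp_ac
    rw [hA]
    exact ((locII hα τ t).absolutelyContinuousOnInterval_intervalIntegral Set.left_mem_uIcc).fun_neg
  have hF : AbsolutelyContinuousOnInterval F τ t := hE.fun_mul hG
  have hGy : ∀ s, τ ≤ s → s ≤ T → G s = y s := fun s h1 h2 => (hyt s h1 h2).symm
  have hft := hF.integral_deriv_eq_sub
  have hcong : ∫ s in τ..t, deriv F s = ∫ s in τ..t, -(α s * (Real.exp (-(A s)) * y s) + 
      β s * (Real.exp (-(A (s - 1))) * y (s - 1))) := by
    apply intervalIntegral.integral_congr_ae
    filter_upwards [_root_.LocallyIntegrable.ae_hasDerivAt_integral hα,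
      _root_.LocallyIntegrable.ae_hasDerivAt_integral hg] with s h1 h2 hs
    rw [Set.uIoc_of_le ht.1] at hs
    have d1 : HasDerivAt A (α s) s := by rw [hA]; exact h1 τ
    have d2 : HasDerivAt G _ s := (h2 τ).const_add (y τ)
    have d3 := d1.neg.exp.mul d2
    have d4 : deriv F s = _ := d3.deriv
    rw [d4, hGy s hs.1.le (hs.2.trans ht.2)]
    simp only [Pi.neg_apply, hb]
    have : Real.exp (-(A (s-1))) = Real.exp (-(A s)) * Real.exp (A s - A (s-1)) := by
      rw [← Real.exp_add]; ring_nf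
    rw [this]
    ring
  rw [hcong, intervalIntegral.integral_neg] at hft
  simp only [F] at hft
  rw [hGy t ht.1 ht.2, hGy τ le_rfl (ht.1.trans ht.2)] at hft
  simp only
  linarith

def wedgeX {m : ℕ} (f : Fin m → ℝ → ℝ) (hf : ∀ i, Continuous (f i)) : Xwedge m :=
  ⟨⟨fun θ => (Matrix.of fun i j => f i (θ j : ℝ)).det, by
    apply Continuous.matrix_det
    refine continuous_matrix fun i j => ?_
    exact (hf i).comp (continuous_subtype_val.comp (continuous_apply j))⟩, by
    intro σ θ
    exact Matrix.det_permute' σ (Matrix.of fun i j => f i (θ j : ℝ))⟩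

theorem wedgeX_apply {m : ℕ} (f : Fin m → ℝ → ℝ) (hf : ∀ i, Continuous (f i)) (θ : Cube m) :
    (wedgeX f hf : C(Cube m, ℝ)) θ = (Matrix.of fun i j => f i (θ j : ℝ)).det := rfl

def node (N k : ℕ) : I01 := ⟨min ((k : ℝ) / N - 1) 0, by
  have : (0:ℝ) ≤ (k : ℝ) / N := by positivity
  exact ⟨le_min (by linarith) (by norm_num), min_le_right _ _⟩⟩

theorem node_mono (N : ℕ) : Monotone (node N) := by
  intro a b hab
  change min ((a : ℝ) / N - 1) 0 ≤ min ((b : ℝ) / N - 1) 0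
  have : (a:ℝ) ≤ b := by exact_mod_cast hab
  gcongr

def Dform {m : ℕ} (φ : Cube m → ℝ) (N : ℕ) : (Fin (N+2) → ℝ) [⋀^Fin m]→ₗ[ℝ] ℝ :=
  ∑ k : Fin m → Fin (N+2), (φ (fun j => node N (k j)) / (m.factorial : ℝ)) • 
    (Matrix.detRowAlternating.compLinearMap (LinearMap.funLeft ℝ ℝ k))

theorem Dform_apply {m : ℕ} (φ : Cube m → ℝ) (N : ℕ) (v : Fin m → Fin (N+2) → ℝ) :
    Dform φ N v = ∑ k : Fin m → Fin (N+2), (φ (fun j => node N (k j)) / (m.factorial : ℝ)) * 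
      (Matrix.of fun i j => v j (k i)).det := by
  unfold Dform
  have hsum : ∀ (F : Finset (Fin m → Fin (N+2)))
      (g : (Fin m → Fin (N+2)) → (Fin (N+2) → ℝ) [⋀^Fin m]→ₗ[ℝ] ℝ),
      (∑ k ∈ F, g k) v = ∑ k ∈ F, g k v := by
    intro F g
    induction F using Finset.induction_on with
    | empty => simp
    | insert a s ha ih => rw [Finset.sum_insert ha, Finset.sum_insert ha, AlternatingMap.add_apply, ih]
  rw [hsum]
  refine Finset.sum_congr rfl fun k _ => ?_
  rw [AlternatingMap.smul_apply, smul_eq_mul, ← Matrix.det_transpose]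
  rfl

theorem Dform_prod {m : ℕ} (φ : Cube m → ℝ) 
    (hφ : ∀ (σ : Equiv.Perm (Fin m)) (θ : Cube m),
      φ (θ ∘ σ) = ((Equiv.Perm.sign σ : ℤ) : ℝ) * φ θ) 
    (N : ℕ) (v : Fin m → Fin (N+2) → ℝ) :
    Dform φ N v = ∑ k : Fin m → Fin (N+2), φ (fun j => node N (k j)) * ∏ j, v j (k j) := by
  rw [Dform_apply]
  simp_rw [Matrix.det_apply', Finset.mul_sum]
  rw [Finset.sum_comm]
  have : ∀ σ : Equiv.Perm (Fin m), ∑ k : Fin m → Fin (N+2), 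
      φ (fun j => node N (k j)) / (m.factorial : ℝ) * 
      (((Equiv.Perm.sign σ : ℤ) : ℝ) * ∏ i, (Matrix.of fun i j => v j (k i)) (σ i) i) = 
      (∑ k : Fin m → Fin (N+2), φ (fun j => node N (k j)) * ∏ j, v j (k j)) / (m.factorial : ℝ) := by
    intro σ
    rw [Finset.sum_div]
    refine Fintype.sum_equiv (Equiv.arrowCongr σ.symm (Equiv.refl _)) _ _ fun k => ?_
    have h1 := hφ σ (fun j => node N (k j))
    have h2 : (fun j => node N (((Equiv.arrowCongr σ.symm (Equiv.refl _)) k) j)) = 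
      (fun j => node N (k j)) ∘ σ := by funext j; simp [Equiv.arrowCongr]
    rw [h2, h1]
    simp [Equiv.arrowCongr]
    ring
  rw [Finset.sum_congr rfl fun σ _ => this σ]
  rw [Finset.sum_const, Finset.card_univ, Fintype.card_perm, Fintype.card_fin, nsmul_eq_mul]
  have : (m.factorial : ℝ) ≠ 0 := by positivity
  field_simp

theorem Dform_single {m : ℕ} (φ : Cube m → ℝ) 
    (hφ : ∀ (σ : Equiv.Perm (Fin m)) (θ : Cube m),
      φ (θ ∘ σ) = ((Equiv.Perm.sign σ : ℤ) : ℝ) * φ θ) 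
    (N : ℕ) (p : Fin m → Fin (N+2)) :
    Dform φ N (fun j => Pi.single (p j) 1) = φ (fun j => node N (p j)) := by
  rw [Dform_prod φ hφ, Finset.sum_eq_single p]
  · simp
  · intro k _ hk
    obtain ⟨j, hj⟩ := Function.ne_iff.1 hk
    rw [Finset.prod_eq_zero (Finset.mem_univ j), mul_zero]
    simp [hj]
  · simp

def hatE (N : ℕ) (θ : ℝ) : Fin (N+2) → ℝ := fun k => max 0 (1 - |(θ + 1) * N - (k : ℕ)|)

theorem hatE_eq (N : ℕ) (θ : ℝ) (h : θ ∈ Set.Icc (-1:ℝ) 0) (hl : ⌊(θ + 1) * N⌋₊ + 1 < N + 2) :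
    hatE N θ = (1 - ((θ+1)*N - ⌊(θ + 1) * N⌋₊)) • 
        Pi.single (⟨⌊(θ + 1) * N⌋₊, by omega⟩ : Fin (N+2)) (1:ℝ) + 
      ((θ+1)*N - ⌊(θ + 1) * N⌋₊) • Pi.single (⟨⌊(θ + 1) * N⌋₊ + 1, hl⟩ : Fin (N+2)) (1:ℝ) := by
  have h0 : 0 ≤ (θ + 1) * N := mul_nonneg (by linarith [h.1]) (Nat.cast_nonneg _)
  have f1 := Nat.floor_le h0
  have f2 := Nat.lt_floor_add_one ((θ+1)*N)
  funext k
  simp only [hatE, Pi.add_apply, Pi.smul_apply, Pi.single_apply, Fin.ext_iff, smul_eq_mul]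
  generalize (θ+1)*(N:ℝ) = x at *
  generalize ⌊x⌋₊ = l at *
  by_cases h1 : k.1 = l
  · rw [if_pos h1, if_neg (by omega), h1, abs_of_nonneg (by linarith), max_eq_right (by linarith)]
    ring
  by_cases h2 : k.1 = l + 1
  · rw [if_neg h1, if_pos h2, h2]
    push_cast
    rw [abs_of_nonpos (by linarith), max_eq_right (by linarith)]
    ring
  rw [if_neg h1, if_neg h2, max_eq_left]
  · simp
  · rcases lt_or_ge k.1 l with h3 | h3
    · have : (k.1 : ℝ) + 1 ≤ l := by exact_mod_cast h3
      have := le_abs_self (x - (k.1:ℝ))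
      linarith
    · have : (l:ℝ) + 2 ≤ k.1 := by exact_mod_cast (by omega : l + 2 ≤ k.1)
      have := neg_le_abs (x - (k.1:ℝ))
      linarith

theorem floor_lt (N : ℕ) (θ : ℝ) (h : θ ∈ Set.Icc (-1:ℝ) 0) : ⌊(θ + 1) * N⌋₊ + 1 < N + 2 := by
  have : (θ + 1) * N ≤ N := by
    have : (0:ℝ) ≤ N := Nat.cast_nonneg _
    nlinarith [h.2]
  have := Nat.floor_le_of_le this
  omega

theorem hatE_sum (N : ℕ) (θ : ℝ) (h : θ ∈ Set.Icc (-1:ℝ) 0) : ∑ k, hatE N θ k = 1 := by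
  rw [hatE_eq N θ h (floor_lt N θ h)]
  simp [Finset.sum_add_distrib, ← Finset.mul_sum]

theorem hatE_pos {m : ℕ} (φ : Cube m → ℝ) 
    (hφ : ∀ (σ : Equiv.Perm (Fin m)) (θ : Cube m),
      φ (θ ∘ σ) = ((Equiv.Perm.sign σ : ℤ) : ℝ) * φ θ) 
    (hpos : ∀ θ ∈ TsetC m, 0 ≤ φ θ)
    (N : ℕ) (θ : Fin m → ℝ) (hθ : ∀ j, θ j ∈ Set.Icc (-1:ℝ) 0) (hm : Monotone θ) :
    0 ≤ Dform φ N (fun j => hatE N (θ j)) := by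
  let x : Fin m → ℝ := fun j => (θ j + 1) * N
  let l : Fin m → ℕ := fun j => ⌊x j⌋₊
  have hl : ∀ j, l j + 1 < N + 2 := fun j => floor_lt N _ (hθ j)
  have hx0 : ∀ j, 0 ≤ x j := fun j => mul_nonneg (by linarith [(hθ j).1]) (Nat.cast_nonneg _)
  have f1 : ∀ j, (l j : ℝ) ≤ x j := fun j => Nat.floor_le (hx0 j)
  have f2 : ∀ j, x j < l j + 1 := fun j => Nat.lt_floor_add_one (x j)
  have xm : Monotone x := fun i j hij => 
    mul_le_mul_of_nonneg_right (by linarith [hm hij]) (Nat.cast_nonneg _)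
  have lm : Monotone l := fun i j hij => Nat.floor_mono (xm hij)
  have hE : ∀ j, hatE N (θ j) = (1 - (x j - l j)) • Pi.single (⟨l j, by have := hl j; omega⟩ : Fin (N+2)) (1:ℝ)
      + (x j - l j) • Pi.single (⟨l j + 1, hl j⟩ : Fin (N+2)) (1:ℝ) := fun j => hatE_eq N _ (hθ j) _
  let S : Fin m → Set (Fin (N+2) → ℝ) := fun j => 
    (fun p => Pi.single p (1:ℝ)) '' {p : Fin (N+2) | p.1 ≤ l j + 1 ∧ l j ≤ p.1 ∧ ∀ i < j, l i + 1 ≤ p.1}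
  apply lemG _ _ S
  · intro j
    by_cases h : ∃ i < j, l i = l j
    · right
      obtain ⟨i, hij, hi⟩ := h
      have hpi : 0 < 1 - (x i - l i) := by linarith [f2 i]
      refine ⟨i, hij, (1 - (x j - l j)) / (1 - (x i - l i)), ?_⟩
      have e : hatE N (θ j) - ((1 - (x j - l j)) / (1 - (x i - l i))) • hatE N (θ i) = 
          ((x j - x i) / (1 - (x i - l i))) • Pi.single (⟨l j + 1, hl j⟩ : Fin (N+2)) (1:ℝ) := by
        rw [hE i, hE j]
        simp only [hi] at hpi ⊢
        generalize (Pi.single _ _ : Fin (N+2) → ℝ) = P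
        generalize (Pi.single _ _ : Fin (N+2) → ℝ) = Q
        funext k
        simp only [Pi.add_apply, Pi.sub_apply, Pi.smul_apply, smul_eq_mul]
        have := hpi.ne'
        field_simp
        ring
      change InDCone (S j) (hatE N (θ j) - _ • hatE N (θ i))
      rw [e]
      intro f hf
      rw [map_smul]
      refine mul_nonneg (div_nonneg (by linarith [xm hij.le]) hpi.le) (hf _ ⟨_, ⟨?_, ?_, ?_⟩, rfl⟩)
      · exact le_rfl
      · exact Nat.le_succ _
      · intro i hi; exact Nat.succ_le_succ (lm hi.le)
    · left
      push Not at h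
      intro f hf
      have hlt : ∀ i < j, l i + 1 ≤ l j := fun i hi => lt_of_le_of_ne (lm hi.le) (h i hi)
      change 0 ≤ f (hatE N (θ j))
      rw [hE j, map_add, map_smul, map_smul]
      refine add_nonneg (mul_nonneg (by linarith [f2 j]) (hf _ ⟨_, ⟨?_, ?_, ?_⟩, rfl⟩)) 
        (mul_nonneg (by linarith [f1 j]) (hf _ ⟨_, ⟨?_, ?_, ?_⟩, rfl⟩))
      · exact Nat.le_succ _
      · exact le_rfl
      · exact hlt
      · exact le_rfl
      · exact Nat.le_succ _
      · intro i hi; exact (hlt i hi).trans (Nat.le_succ _)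
  · intro w hw
    choose p hp hpw using hw
    have : w = fun j => Pi.single (p j) 1 := funext fun j => (hpw j).symm
    rw [this, Dform_single φ hφ]
    apply hpos
    intro i j hij
    apply node_mono
    rcases hij.eq_or_lt with rfl | hij
    · exact le_rfl
    · exact (hp i).1.trans ((hp j).2.2 i hij)

theorem hatE_approx {m : ℕ} (φ : C(Cube m, ℝ)) (hφ : φ ∈ Xwedge m) (ε : ℝ) (hε : 0 < ε) :
    ∃ N : ℕ, ∀ θ : Cube m, |Dform φ N (fun j => hatE N (θ j)) - φ θ| ≤ ε := by
  obtain ⟨δ, hδ, hu⟩ := Metric.uniformContinuous_iff.1 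
    (CompactSpace.uniformContinuous_of_continuous φ.continuous) ε hε
  obtain ⟨N, hN⟩ := exists_nat_gt (1/δ)
  have hN0 : (0:ℝ) < N := lt_trans (by positivity) hN
  refine ⟨N, fun θ => ?_⟩
  rw [Dform_prod φ hφ]
  have h1 : ∑ k : Fin m → Fin (N+2), ∏ j, hatE N (θ j) (k j) = 1 := by
    have := (Finset.prod_univ_sum (fun _ : Fin m => (Finset.univ : Finset (Fin (N+2)))) 
      (fun j k => hatE N (θ j) k)).symm
    rw [Fintype.piFinset_univ] at this
    rw [this]
    exact Finset.prod_eq_one fun j _ => hatE_sum N _ (θ j).2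
  have h2 : φ θ = ∑ k : Fin m → Fin (N+2), φ θ * ∏ j, hatE N (θ j) (k j) := by
    rw [← Finset.mul_sum, h1, mul_one]
  have hnn : ∀ s k, 0 ≤ hatE N s k := fun s k => le_max_left _ _
  calc _ = |∑ k : Fin m → Fin (N+2), (φ (fun j => node N (k j)) - φ θ) * ∏ j, hatE N (θ j) (k j)| := by
        rw [h2, ← Finset.sum_sub_distrib]
        simp_rw [← h2, sub_mul]
    _ ≤ ∑ k : Fin m → Fin (N+2), |(φ (fun j => node N (k j)) - φ θ) * ∏ j, hatE N (θ j) (k j)| := 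
        Finset.abs_sum_le_sum_abs _ _
    _ ≤ ∑ k : Fin m → Fin (N+2), ε * ∏ j, hatE N (θ j) (k j) := by
        refine Finset.sum_le_sum fun k _ => ?_
        have hp : 0 ≤ ∏ j, hatE N (θ j) (k j) := Finset.prod_nonneg fun j _ => hnn _ _
        rw [abs_mul, abs_of_nonneg hp]
        by_cases hz : ∏ j, hatE N (θ j) (k j) = 0
        · rw [hz]; simp
        refine mul_le_mul_of_nonneg_right ?_ hp
        refine (hu ?_).le
        rw [dist_pi_lt_iff hδ]
        intro j
        have hj : hatE N (θ j) (k j) ≠ 0 := (Finset.prod_ne_zero_iff.1 hz) j (Finset.mem_univ j)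
        have hj' : |((θ j : ℝ) + 1) * N - ((k j : ℕ) : ℝ)| < 1 := by
          by_contra hc
          push Not at hc
          exact hj (max_eq_left (by linarith))
        have hθ := (θ j).2.2
        rw [Subtype.dist_eq, Real.dist_eq]
        change |min (((k j : ℕ) : ℝ) / N - 1) 0 - (θ j : ℝ)| < δ
        have e : ((θ j : ℝ) + 1) * N - ((k j : ℕ) : ℝ) = -((((k j : ℕ) : ℝ) / N - 1 - θ j) * N) := by
          field_simp; ring
        rw [e, abs_neg, abs_mul, abs_of_pos hN0] at hj'
        have h3 : |((k j : ℕ) : ℝ) / N - 1 - θ j| < δ := by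
          have : 1 < δ * N := by rwa [div_lt_iff₀ hδ, mul_comm] at hN
          by_contra hc
          push Not at hc
          nlinarith
        rw [abs_lt] at h3 ⊢
        constructor
        · have : (θ j : ℝ) - δ < min (((k j : ℕ) : ℝ) / N - 1) 0 := lt_min (by linarith) (by linarith)
          linarith
        · have := min_le_left (((k j : ℕ) : ℝ) / N - 1) 0
          linarith
    _ = ε := by rw [← Finset.mul_sum, h1, mul_one]

theorem statement0 (α β : ℝ → ℝ)
    (hα : LocallyIntegrable α volume) (hβ : LocallyIntegrable β volume)
    (m : ℕ) (hm : 1 ≤ m) (τ η : ℝ) (hη : 0 ≤ η)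
    (hsign : ∀ᵐ t ∂(volume.restrict (Set.Icc τ (τ + η))), 0 ≤ (-1 : ℝ) ^ m * β t)
    (W : Xwedge m →L[ℝ] Xwedge m)
    (hW : IsWedgePower α β m τ (τ + η) W) :
    ∀ φ ∈ Kcone m, W φ ∈ Kcone m := by
  obtain ⟨n, rfl⟩ : ∃ n, m = n + 1 := ⟨m - 1, by omega⟩
  intro φ hφK θ hθ
  have hφX : (φ : C(Cube (n+1), ℝ)) ∈ Xwedge (n+1) := φ.2
  -- the transformed coefficients
  obtain ⟨A, hA⟩ : ∃ A : ℝ → ℝ, A = fun t => ∫ u in τ..t, α u := ⟨_, rfl⟩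
  have hAc : Continuous A := by
    rw [hA]; exact intervalIntegral.continuous_primitive (fun a b => locII hα a b) τ
  obtain ⟨b, hb⟩ : ∃ b : ℝ → ℝ, b = fun u => β u * Real.exp (A u - A (u - 1)) := ⟨_, rfl⟩
  have hbl : LocallyIntegrable b := by
    rw [hb]
    apply LocallyIntegrable.mul_continuous _ hβ
    fun_prop
  have hbsign : ∀ᵐ u, u ∈ Set.Ioc τ (τ+η) → 0 ≤ (-1:ℝ)^(n+1) * b u := by
    rw [ae_restrict_iff' measurableSet_Icc] at hsign
    filter_upwards [hsign] with u hu hm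
    rw [hb]
    simp only
    rw [← mul_assoc]
    exact mul_nonneg (hu ⟨hm.1.le, hm.2⟩) (Real.exp_pos _).le
  obtain ⟨M, hM⟩ := exists_nat_ge η
  have main : ∀ ε > 0, ∃ P : Xwedge (n+1), dist (P : C(Cube (n+1), ℝ)) (φ : C(Cube (n+1), ℝ)) ≤ ε ∧
      0 ≤ (W P : C(Cube (n+1), ℝ)) θ := by
    intro ε hε
    obtain ⟨N, hN⟩ := hatE_approx (φ : C(Cube (n+1), ℝ)) hφX ε hε
    have hψ : Continuous (fun t : ℝ => Real.exp (A t) • hatE N (t - τ)) := by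
      refine (Real.continuous_exp.comp hAc).smul ?_
      refine continuous_pi fun k => ?_
      unfold hatE
      fun_prop
    obtain ⟨y, hyc, hy1, hy2⟩ := exY b hbl _ hψ τ M
    have hint : LocallyIntegrable (fun u => (-(b u)) • y (u - 1)) := 
      LocallyIntegrable.smul_continuous (hyc.comp (continuous_id.sub continuous_const)) hbl.neg
    -- the solutions
    let X : Fin (N+2) → ℝ → ℝ := fun k t => Real.exp (-(A t)) * y t k
    have hyk : ∀ k, Continuous (fun t => y t k) := fun k => (continuous_apply k).comp hyc
    have hXc : ∀ k, Continuous (X k) := fun k => by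
      have := hyk k
      fun_prop
    have hXsol : ∀ k, IsSolution α β τ (τ + η) (X k) := by
      intro k
      refine isSol α β hα hβ τ (τ+η) A b (fun t => y t k) hA hb (hyk k) ?_
      intro t h1 h2
      have := hy2 t h1 (by linarith)
      rw [← hy1 τ le_rfl] at this
      have h3 := congrArg (ContinuousLinearMap.proj (R := ℝ) (φ := fun _ : Fin (N+2) => ℝ) k) this
      rw [map_add, ← ContinuousLinearMap.intervalIntegral_comp_comm _ (locII hint τ t)] at h3
      exact h3
    have hXhat : ∀ s : I01, (fun k => X k (τ + s)) = hatE N s := by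
      intro s
      funext k
      simp only [X]
      rw [hy1 _ (by linarith [s.2.2])]
      simp only [Pi.smul_apply, smul_eq_mul, ← mul_assoc, ← Real.exp_add]
      simp
    -- wedge products
    let f0 : (Fin (n+1) → Fin (N+2)) → Fin (n+1) → ℝ → ℝ := fun k i s => X (k i) (τ + s)
    let f1 : (Fin (n+1) → Fin (N+2)) → Fin (n+1) → ℝ → ℝ := fun k i s => X (k i) (τ + η + s)
    have hf0 : ∀ k i, Continuous (f0 k i) := fun k i => (hXc _).comp (by fun_prop)
    have hf1 : ∀ k i, Continuous (f1 k i) := fun k i => (hXc _).comp (by fun_prop)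
    let c : (Fin (n+1) → Fin (N+2)) → ℝ := fun k => 
      (φ : C(Cube (n+1), ℝ)) (fun j => node N (k j)) / ((n+1).factorial : ℝ)
    let P : Xwedge (n+1) := ∑ k, c k • wedgeX (f0 k) (hf0 k)
    let Q : Xwedge (n+1) := ∑ k, c k • wedgeX (f1 k) (hf1 k)
    have hWP : W P = Q := by
      simp only [P, Q, map_sum, map_smul]
      refine Finset.sum_congr rfl fun k _ => ?_
      congr 1
      exact hW (fun i => X (k i)) (fun i => hXsol (k i)) _ _ (fun _ => rfl) (fun _ => rfl)
    have hP : ∀ θ : Cube (n+1), (P : C(Cube (n+1), ℝ)) θ = 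
        Dform (φ : C(Cube (n+1), ℝ)) N (fun j => hatE N (θ j)) := by
      intro θ
      rw [Dform_apply]
      simp only [P, Submodule.coe_sum, Submodule.coe_smul, ContinuousMap.coe_sum, Finset.sum_apply,
        ContinuousMap.coe_smul, Pi.smul_apply, smul_eq_mul, wedgeX_apply]
      refine Finset.sum_congr rfl fun k _ => ?_
      simp_rw [← hXhat]
      rfl
    have hQ : (Q : C(Cube (n+1), ℝ)) θ = 
        Dform (φ : C(Cube (n+1), ℝ)) N (fun j k => X k (τ + η + θ j)) := by
      rw [Dform_apply]
      simp only [Q, Submodule.coe_sum, Submodule.coe_smul, ContinuousMap.coe_sum, Finset.sum_apply,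
        ContinuousMap.coe_smul, Pi.smul_apply, smul_eq_mul, wedgeX_apply]
      rfl
    have hQpos : 0 ≤ (Q : C(Cube (n+1), ℝ)) θ := by
      rw [hQ]
      have e : (fun (j : Fin (n+1)) (k : Fin (N+2)) => X k (τ + η + θ j)) = 
          fun j => Real.exp (-(A (τ + η + θ j))) • y (τ + η + θ j) := rfl
      rw [e]
      have := (Dform (φ : C(Cube (n+1), ℝ)) N).toMultilinearMap.map_smul_univ 
        (fun j => Real.exp (-(A (τ + η + θ j)))) (fun j => y (τ + η + θ j))
      refine le_of_le_of_eq ?_ this.symm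
      refine mul_nonneg (Finset.prod_nonneg fun j _ => (Real.exp_pos _).le) ?_
      refine iterThm (Dform (φ : C(Cube (n+1), ℝ)) N) b y hbl hyc τ η hη ?_ hbsign ?_ 
        (fun j => τ + η + θ j) ?_ ?_
      · intro s t h1 h2 h3
        rw [hy2 t (h1.trans h2) (by linarith), hy2 s h1 (by linarith), add_sub_add_left_eq_sub,
          intervalIntegral.integral_interval_sub_left (locII hint _ _) (locII hint _ _)]
      · intro t ht htb
        have e2 : (fun j => y (t j)) = fun j => Real.exp (A (t j)) • hatE N (t j - τ) := 
          funext fun j => hy1 _ (htb j).2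
        rw [e2]
        have := (Dform (φ : C(Cube (n+1), ℝ)) N).toMultilinearMap.map_smul_univ 
          (fun j => Real.exp (A (t j))) (fun j => hatE N (t j - τ))
        refine le_of_le_of_eq ?_ this.symm
        refine mul_nonneg (Finset.prod_nonneg fun j _ => (Real.exp_pos _).le) ?_
        refine hatE_pos _ hφX hφK N _ ?_ ?_
        · intro j
          have := htb j
          constructor <;> linarith
        · intro i j hij
          have := ht hij
          simp only
          linarith
      · intro i j hij
        have : (θ i : ℝ) ≤ θ j := hθ hij
        simp only
        linarith
      · intro j
        have h1 := (θ j).2.1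
        have h2 := (θ j).2.2
        constructor <;> linarith
    refine ⟨P, ?_, by rw [hWP]; exact hQpos⟩
    rw [ContinuousMap.dist_le hε.le]
    intro θ
    rw [hP θ]
    exact hN θ
  by_contra hneg
  push Not at hneg
  have hcont : Continuous (fun ψ : Xwedge (n+1) => (W ψ : C(Cube (n+1), ℝ)) θ) := 
    (continuous_eval_const (F := C(Cube (n+1), ℝ)) θ).comp (continuous_subtype_val.comp W.continuous)
  have hopen := isOpen_lt hcont (continuous_const (y := (0:ℝ)))
  obtain ⟨U, hU, hUe⟩ := isOpen_induced_iff.1 hopen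
  have hmem : ∀ ψ : Xwedge (n+1), (ψ : C(Cube (n+1), ℝ)) ∈ U ↔ (W ψ : C(Cube (n+1), ℝ)) θ < 0 := by
    intro ψ
    exact Set.ext_iff.1 hUe ψ
  obtain ⟨ε, hε, hball⟩ := Metric.isOpen_iff.1 hU _ ((hmem φ).2 hneg)
  obtain ⟨P, hP1, hP2⟩ := main (ε / 2) (by linarith)
  have := (hmem P).1 (hball (by rw [Metric.mem_ball]; linarith))
  linarith
end
end

section
/- Fix m ≥ 1, τ ∈ ℝ and 0 < η ≤ 1. Let φ ∈ C([−1,0]^m, ℝ) be antisymmetric, fix θ = (θ_1,…,θ_m) ∈ T_m, and let a be an integer with 0 ≤ a ≤ m satisfying θ_a ≤ −η ≤ θ_{a+1} (a = 0 being allowed if −η ≤ θ_1, and a = m if θ_m ≤ −η). Set Ψ = (Z_1 − B_1)(Z_2 − B_2)⋯(Z_m − B_m)φ. If 0 ≤ a ≤ m−2 then Ψ(θ) = (−1)^{am}·∫_{η+θ_{a+1}−1}^{η+θ_{a+2}−1}⋯∫_{η+θ_{m−1}−1}^{η+θ_m−1} b(τ+1+t_1)⋯b(τ+1+t_{m−a−1})·φ(t_1,…,t_{m−a−1},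 η+θ_1,…,η+θ_a, 0) dt_{m−a−1}⋯dt_1 + (−1)^{(a+1)m}·∫_{−1}^{η+θ_{a+1}−1}∫_{η+θ_{a+1}−1}^{η+θ_{a+2}−1}⋯∫_{η+θ_{m−1}−1}^{η+θ_m−1} b(τ+1+t_1)⋯b(τ+1+t_{m−a})·φ(t_1,…,t_{m−a}, η+θ_1,…,η+θ_a) dt_{m−a}⋯dt_1, where the arguments η+θ_j of φ are absent when a = 0. If a = m−1 then Ψ(θ) = φ(η+θ_1,…,η+θ_{m−1}, 0) + (−1)^m·∫_{−1}^{η+θ_m−1} b(τ+1+t_1)·φ(t_1, η+θ_1,…,η+θ_{m−1}) dt_1. If a = m then Ψ(θ) = φ(η+θ_1,…,η+θ_m). -/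
open MeasureTheory

noncomputable section

/-- The cube `[-1,0]^m`. -/
def CubeR (m : ℕ) : Set (Fin m → ℝ) := {θ | ∀ i, θ i ∈ Set.Icc (-1 : ℝ) 0}

/-- The fundamental simplex `T_m` of ordered tuples in `[-1,0]^m`. -/
def TsetR (m : ℕ) : Set (Fin m → ℝ) :=
  {θ | (∀ i, θ i ∈ Set.Icc (-1 : ℝ) 0) ∧ Monotone θ}

/-- The operator `Z_k - B_k`, where
`(Z_k ψ)(θ) = ψ(θ₁,…,ω(θ_k),…,θ_m)` with `ω(s) = min (η+s) 0`, and
`(B_k ψ)(θ) = ∫_{-1}^{Ω(θ_k)} b(τ+1+s) ψ(θ₁,…,s,…,θ_m) ds` with `Ω(s) = max (η+s) 0 - 1`. -/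
def ZBop (m : ℕ) (b : ℝ → ℝ) (τ η : ℝ) (k : Fin m)
    (ψ : (Fin m → ℝ) → ℝ) : (Fin m → ℝ) → ℝ :=
  fun ϑ => ψ (Function.update ϑ k (min (η + ϑ k) 0)) -
    ∫ s in (-1 : ℝ)..(max (η + ϑ k) 0 - 1), b (τ + 1 + s) * ψ (Function.update ϑ k s)

/-- The composition `(Z₁ - B₁)(Z₂ - B₂) ⋯ (Z_m - B_m) φ`. -/
def Psi (m : ℕ) (b : ℝ → ℝ) (τ η : ℝ) (φ : (Fin m → ℝ) → ℝ) : (Fin m → ℝ) → ℝ :=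
  (List.finRange m).foldr (fun k acc => ZBop m b τ η k acc) φ

/-- Iterated interval integral: `iterInt n bds f` is
`∫_{(bds 0).1}^{(bds 0).2} ⋯ ∫_{(bds (n-1)).1}^{(bds (n-1)).2} f(t₁,…,t_n) dt_n ⋯ dt_1`,
with the first variable in the outermost integral. -/
def iterInt : (n : ℕ) → (Fin n → ℝ × ℝ) → ((Fin n → ℝ) → ℝ) → ℝ
  | 0, _, f => f (fun i => i.elim0)
  | n + 1, bds, f =>
      ∫ t in (bds 0).1..(bds 0).2,
        iterInt n (fun i => bds i.succ) (fun v => f (Fin.cons t v))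


def muM : Measure ℝ := Measure.dirac 0 + volume

instance : SigmaFinite muM := by unfold muM; infer_instance

/-- multilinear integral -/
def JJ (n : ℕ) (w : Fin n → ℝ → ℝ) (f : (Fin n → ℝ) → ℝ) : ℝ :=
  ∫ t, (∏ i, w i (t i)) * f t ∂(Measure.pi fun _ : Fin n => muM)

def Nice {n : ℕ} (f : (Fin n → ℝ) → ℝ) : Prop := Continuous f ∧ ∃ C, ∀ t, ‖f t‖ ≤ C

lemma Nice.cons {n : ℕ} {f : (Fin (n+1) → ℝ) → ℝ} (hf : Nice f) (x : ℝ) :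
    Nice (fun v => f (Fin.cons x v)) := by
  obtain ⟨h1, C, hC⟩ := hf
  refine ⟨h1.comp ?_, C, fun t => hC _⟩
  refine continuous_pi fun i => ?_
  refine Fin.cases ?_ (fun j => ?_) i
  · simp only [Fin.cons_zero]; fun_prop
  · simp only [Fin.cons_succ]; fun_prop

lemma JJ_integrable {n : ℕ} {w : Fin n → ℝ → ℝ} {f : (Fin n → ℝ) → ℝ}
    (hw : ∀ i, Integrable (w i) muM) (hf : Nice f) :
    Integrable (fun t => (∏ i, w i (t i)) * f t) (Measure.pi fun _ : Fin n => muM) := by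
  obtain ⟨h1, C, hC⟩ := hf
  exact (Integrable.fintype_prod (f := w) hw).mul_bdd (c := C)
    h1.aestronglyMeasurable (Filter.Eventually.of_forall hC)

lemma JJ_zero (w : Fin 0 → ℝ → ℝ) (f : (Fin 0 → ℝ) → ℝ) : JJ 0 w f = f (fun i => i.elim0) := by
  unfold JJ
  rw [Measure.pi_of_empty (x := fun i => i.elim0)]
  simp

lemma JJ_succ {n : ℕ} {w : Fin (n+1) → ℝ → ℝ} {f : (Fin (n+1) → ℝ) → ℝ}
    (hw : ∀ i, Integrable (w i) muM) (hf : Nice f) :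
    JJ (n+1) w f = ∫ x, w 0 x * JJ n (fun i => w i.succ) (fun v => f (Fin.cons x v)) ∂muM := by
  have hmp := (measurePreserving_piFinSuccAbove (fun _ : Fin (n+1) => muM) 0).symm
  have hint := JJ_integrable hw hf
  rw [← hmp.integrable_comp_emb (MeasurableEquiv.measurableEmbedding _)] at hint
  unfold JJ
  rw [← hmp.integral_comp']
  refine (integral_prod _ hint).trans ?_
  congr 1; ext x
  rw [← integral_const_mul]
  congr 1; ext v
  simp only [Function.comp, MeasurableEquiv.piFinSuccAbove_symm_apply, Fin.insertNthEquiv_zero]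
  rw [Fin.prod_univ_succ, mul_assoc]
  rfl

lemma JJ_update_add {n : ℕ} {w : Fin n → ℝ → ℝ} {f : (Fin n → ℝ) → ℝ}
    (hw : ∀ i, Integrable (w i) muM) (hf : Nice f) (k : Fin n) {g h : ℝ → ℝ}
    (hg : Integrable g muM) (hh : Integrable h muM) :
    JJ n (Function.update w k (g + h)) f =
      JJ n (Function.update w k g) f + JJ n (Function.update w k h) f := by
  have key : ∀ (g : ℝ → ℝ) (t : Fin n → ℝ), (∏ i, Function.update w k g i (t i)) =
      g (t k) * ∏ i ∈ Finset.univ \ {k}, w i (t i) := by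
    intro g t
    rw [← Finset.prod_update_of_mem (Finset.mem_univ k) (fun i => w i (t i)) (g (t k))]
    refine Finset.prod_congr rfl fun i _ => ?_
    by_cases h : i = k
    · subst h; simp
    · simp [h]
  have hi : ∀ g : ℝ → ℝ, Integrable g muM → ∀ i, Integrable (Function.update w k g i) muM := by
    intro g hg i
    by_cases h : i = k
    · subst h; simpa
    · simpa [h] using hw i
  unfold JJ
  rw [← integral_add (JJ_integrable (hi g hg) hf) (JJ_integrable (hi h hh) hf)]
  congr 1; ext t
  simp only [key, Pi.add_apply]; ring

def SwapAnti {n : ℕ} (f : (Fin n → ℝ) → ℝ) : Prop :=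
  ∀ i j : Fin n, i ≠ j → ∀ t, f (t ∘ Equiv.swap i j) = - f t

lemma JJ_alt {n : ℕ} {w : Fin n → ℝ → ℝ} {f : (Fin n → ℝ) → ℝ} (hf : SwapAnti f)
    {i j : Fin n} (hij : i ≠ j) (hw : w i = w j) : JJ n w f = 0 := by
  have hmp := measurePreserving_arrowCongr' (fun _ : Fin n => muM) (fun _ : Fin n => muM)
    (Equiv.swap i j) (MeasurableEquiv.refl ℝ) (fun _ => MeasurePreserving.id _)
  have : JJ n w f = - JJ n w f := by
    conv_lhs => unfold JJ
    rw [← hmp.integral_comp']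
    unfold JJ
    rw [← integral_neg]
    congr 1; ext t
    have e : (MeasurableEquiv.arrowCongr' (Equiv.swap i j) (MeasurableEquiv.refl ℝ)) t
      = t ∘ Equiv.swap i j := by
      ext k; simp [MeasurableEquiv.arrowCongr', Equiv.arrowCongr']
    rw [e, hf i j hij, mul_neg, neg_inj]
    congr 1
    rw [← Equiv.prod_comp (Equiv.swap i j)]
    refine Finset.prod_congr rfl fun k _ => ?_
    have : w (Equiv.swap i j k) = w k := by
      rcases eq_or_ne k i with rfl | h1
      · simp [hw]
      rcases eq_or_ne k j with rfl | h2
      · simp [hw]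
      rw [Equiv.swap_apply_of_ne_of_ne h1 h2]
    simp [this]
  linarith

lemma JJ_sub {n : ℕ} {w : Fin n → ℝ → ℝ} {f : (Fin n → ℝ) → ℝ}
    (hw : ∀ i, Integrable (w i) muM) (hf : Nice f) (hs : SwapAnti f) {j k : Fin n} (hjk : j ≠ k) :
    JJ n (Function.update w k (w k - w j)) f = JJ n w f := by
  have h := JJ_update_add hw hf k ((hw k).sub (hw j)) (hw j)
  have h2 : JJ n (Function.update w k (w j)) f = 0 :=
    JJ_alt hs hjk (by simp [hjk])
  rw [h2, sub_add_cancel, Function.update_eq_self] at h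
  linarith

lemma JJ_tele {n : ℕ} {w : ℕ → ℝ → ℝ} {f : (Fin n → ℝ) → ℝ}
    (hw : ∀ i, i < n → Integrable (w i) muM) (hf : Nice f) (hs : SwapAnti f) (r : ℕ) (hr : r ≤ n) :
    JJ n (fun i => if n - r ≤ (i : ℕ) ∧ 1 ≤ (i : ℕ) then w i - w (i - 1) else w i) f =
      JJ n (fun i => w i) f := by
  induction r with
  | zero =>
    congr 1; ext i; rw [if_neg]; have := i.isLt; omega
  | succ r ih =>
    rw [← ih (by omega)]
    by_cases h0 : n - (r+1) = 0
    · congr 1; ext i : 1; congr 1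
      rw [eq_iff_iff]; constructor <;> intro h <;> omega
    · have hw' : ∀ i : Fin n, Integrable ((fun i : Fin n => if n - r ≤ (i : ℕ) ∧ 1 ≤ (i : ℕ) then w i - w (i - 1) else w i) i) muM := by
        intro i
        have := i.isLt
        dsimp only
        split_ifs
        · exact (hw _ this).sub (hw _ (by omega))
        · exact hw _ this
      rw [← JJ_sub hw' hf hs (j := ⟨n - (r+1) - 1, by omega⟩) (k := ⟨n - (r+1), by omega⟩)
        (by simp [Fin.ext_iff]; omega)]
      congr 1; ext i : 1
      by_cases hi : i = ⟨n - (r+1), by omega⟩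
      · subst hi
        rw [Function.update_self]
        rw [if_pos (by simp; omega), if_neg (by simp; omega), if_neg (by simp; omega)]
      · rw [Function.update_of_ne hi]
        congr 1
        simp only [Fin.ext_iff] at hi
        rw [eq_iff_iff]; constructor <;> intro h <;> omega

def EE (β : ℝ → ℝ) (u v : ℝ) : ℝ → ℝ := Set.indicator (Set.Ico u v) β
def DD : ℝ → ℝ := Set.indicator {0} (fun _ => 1)

lemma muM_restrict {u v : ℝ} (hv : v ≤ 0) :
    muM.restrict (Set.Ico u v) = volume.restrict (Set.Ico u v) := by
  unfold muM
  have : (Measure.dirac (0:ℝ)).restrict (Set.Ico u v) = 0 := by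
    rw [Measure.restrict_eq_zero, Measure.dirac_apply' _ measurableSet_Ico]
    rw [Set.indicator_of_notMem]
    simp only [Set.mem_Ico]; intro h; linarith [h.2]
  rw [Measure.restrict_add, this, zero_add]

lemma int_EE (β g : ℝ → ℝ) {u v : ℝ} (huv : u ≤ v) (hv : v ≤ 0) :
    ∫ x, EE β u v x * g x ∂muM = ∫ x in u..v, β x * g x := by
  have : (fun x => EE β u v x * g x) = Set.indicator (Set.Ico u v) (fun x => β x * g x) := by
    ext x; unfold EE; rw [Set.indicator_mul_left]
  rw [this, integral_indicator measurableSet_Ico, muM_restrict hv, integral_Ico_eq_integral_Ioc,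
    intervalIntegral.integral_of_le huv]

lemma muM_zero : muM {0} = 1 := by
  unfold muM; simp

lemma int_DD (g : ℝ → ℝ) : ∫ x, DD x * g x ∂muM = g 0 := by
  have : (fun x => DD x * g x) = Set.indicator {0} g := by
    ext x; unfold DD; rw [← Set.indicator_mul_left]; simp
  rw [this, integral_indicator (measurableSet_singleton 0), integral_singleton]
  simp [Measure.real, muM_zero]

lemma integrable_DD : Integrable DD muM := by
  unfold DD
  rw [integrable_indicator_iff (measurableSet_singleton 0)]
  exact integrableOn_const (by simp [muM_zero])

lemma integrable_EE {β : ℝ → ℝ} (hβ : LocallyIntegrable β volume) {u v : ℝ} (hv : v ≤ 0) :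
    Integrable (EE β u v) muM := by
  unfold EE
  rw [integrable_indicator_iff measurableSet_Ico]
  unfold IntegrableOn
  rw [muM_restrict hv]
  exact (hβ.integrableOn_isCompact (isCompact_Icc (a := u) (b := v))).mono_set Set.Ico_subset_Icc_self

lemma EE_sub (β : ℝ → ℝ) {c d : ℝ} (hc : -1 ≤ c) (hd : c ≤ d) :
    (DD + EE β (-1) d) - (DD + EE β (-1) c) = EE β c d := by
  ext x
  simp only [EE, Pi.sub_apply, Pi.add_apply, Set.indicator_apply, Set.mem_Ico]
  split_ifs <;> first | (exfalso; grind) | ring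

lemma iterInt_const_mul (c : ℝ) : ∀ (n : ℕ) (bds : Fin n → ℝ × ℝ) (F : (Fin n → ℝ) → ℝ),
    iterInt n bds (fun t => c * F t) = c * iterInt n bds F := by
  intro n
  induction n with
  | zero => intros; rfl
  | succ n ih =>
    intro bds F
    simp only [iterInt]
    simp_rw [ih]
    rw [intervalIntegral.integral_const_mul]

lemma JJ_EE {β : ℝ → ℝ} (hβ : LocallyIntegrable β volume) : ∀ (n : ℕ) (bds : Fin n → ℝ × ℝ)
    (_ : ∀ i, (bds i).1 ≤ (bds i).2 ∧ (bds i).2 ≤ 0) (f : (Fin n → ℝ) → ℝ) (_ : Nice f),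
    JJ n (fun i => EE β (bds i).1 (bds i).2) f =
      iterInt n bds (fun t => (∏ i, β (t i)) * f t) := by
  intro n
  induction n with
  | zero => intro bds _ f _; rw [JJ_zero]; simp [iterInt]
  | succ n ih =>
    intro bds hbds f hf
    rw [JJ_succ (fun i => integrable_EE hβ (hbds i).2) hf, int_EE _ _ (hbds 0).1 (hbds 0).2]
    simp only [iterInt]
    congr 1; ext x
    rw [ih (fun i => bds i.succ) (fun i => hbds i.succ) _ (hf.cons x), ← iterInt_const_mul]
    congr 1; ext t
    simp [Fin.prod_univ_succ, mul_assoc]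

lemma ZBop_apply (m : ℕ) (b : ℝ → ℝ) (τ η : ℝ) (k : Fin m)
    (ψ : (Fin m → ℝ) → ℝ) (ϑ : Fin m → ℝ) : ZBop m b τ η k ψ ϑ =
  ψ (Function.update ϑ k (min (η + ϑ k) 0)) -
    ∫ s in (-1 : ℝ)..(max (η + ϑ k) 0 - 1), b (τ + 1 + s) * ψ (Function.update ϑ k s) := rfl

lemma fold_succ {n : ℕ} (b : ℝ → ℝ) (τ η : ℝ) (f : (Fin (n+1) → ℝ) → ℝ) :
    ∀ (l : List (Fin n)) (x : Fin (n+1) → ℝ),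
    l.foldr (fun k acc => ZBop (n+1) b τ η k.succ acc) f x =
    l.foldr (fun k acc => ZBop n b τ η k acc) (fun v => f (Fin.cons (x 0) v)) (Fin.tail x) := by
  intro l
  induction l with
  | nil => intro x; simp
  | cons k l ih =>
    intro x
    simp only [List.foldr_cons]
    rw [ZBop_apply, ZBop_apply]
    simp only [ih, Fin.tail_update_succ]
    have h0 : ∀ s, Function.update x k.succ s 0 = x 0 := fun s => by
      rw [Function.update_of_ne]; exact (Fin.succ_ne_zero k).symm
    simp only [h0]
    rfl

lemma Psi_succ {n : ℕ} (b : ℝ → ℝ) (τ η : ℝ) (f : (Fin (n+1) → ℝ) → ℝ) (θ : Fin (n+1) → ℝ) :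
    Psi (n+1) b τ η f θ =
      Psi n b τ η (fun v => f (Fin.cons (min (η + θ 0) 0) v)) (Fin.tail θ) -
      ∫ s in (-1 : ℝ)..(max (η + θ 0) 0 - 1), b (τ + 1 + s) *
        Psi n b τ η (fun v => f (Fin.cons s v)) (Fin.tail θ) := by
  unfold Psi
  rw [List.finRange_succ, List.foldr_cons, List.foldr_map]
  rw [ZBop_apply]
  simp only [fold_succ, Fin.tail_update_zero, Function.update_self]

lemma Psi_JJ {b : ℝ → ℝ} {τ η : ℝ}
    (hβ : LocallyIntegrable (fun s => - b (τ + 1 + s)) volume) : ∀ (n : ℕ)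
    (f : (Fin n → ℝ) → ℝ) (_ : Nice f) (θ : Fin n → ℝ) (_ : ∀ i, 0 ≤ η + θ i ∧ η + θ i ≤ 1),
    Psi n b τ η f θ =
      JJ n (fun i => DD + EE (fun s => - b (τ + 1 + s)) (-1) (η + θ i - 1)) f := by
  intro n
  induction n with
  | zero =>
    intro f _ θ _
    rw [JJ_zero]; simp [Psi]; congr 1; ext i; exact i.elim0
  | succ n ih =>
    intro f hf θ hθ
    rw [Psi_succ, min_eq_right (hθ 0).1, max_eq_left (hθ 0).1]
    set w : Fin (n+1) → ℝ → ℝ :=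
      fun i => DD + EE (fun s => - b (τ + 1 + s)) (-1) (η + θ i - 1) with hw
    have hE : ∀ i, Integrable (EE (fun s => - b (τ + 1 + s)) (-1) (η + θ i - 1)) muM :=
      fun i => integrable_EE hβ (by linarith [(hθ i).2])
    have hwi : ∀ i, Integrable (w i) muM := fun i => integrable_DD.add (hE i)
    have h := JJ_update_add hwi hf 0 integrable_DD (hE 0)
    have e : Function.update w 0 (DD + EE (fun s => - b (τ + 1 + s)) (-1) (η + θ 0 - 1)) = w :=
      Function.update_eq_self 0 w
    rw [e] at h
    have hi : ∀ g : ℝ → ℝ, Integrable g muM → ∀ i, Integrable (Function.update w 0 g i) muM := by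
      intro g hg i
      by_cases h : i = 0
      · subst h; simpa
      · simpa [h] using hwi i
    rw [h, JJ_succ (hi _ integrable_DD) hf, JJ_succ (hi _ (hE 0)) hf]
    simp only [Function.update_self]
    rw [int_DD, int_EE _ _ (by linarith [(hθ 0).1]) (by linarith [(hθ 0).2])]
    have e2 : ∀ g, (fun i : Fin n => Function.update w 0 g i.succ) = fun i => DD + EE (fun s => - b (τ + 1 + s)) (-1) (η + (Fin.tail θ) i - 1) := by
      intro g; ext i : 1
      rw [Function.update_of_ne (Fin.succ_ne_zero i)]; rfl
    simp only [e2]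
    rw [← ih _ (hf.cons 0) (Fin.tail θ) (fun i => hθ i.succ), sub_eq_add_neg,
      ← intervalIntegral.integral_neg]
    congr 2; ext s
    rw [← ih _ (hf.cons s) (Fin.tail θ) (fun i => hθ i.succ)]
    ring

/-- Core formula after removing the first `a` variables. -/
lemma Psi_core {b : ℝ → ℝ} {τ η : ℝ}
    (hβ : LocallyIntegrable (fun s => - b (τ + 1 + s)) volume) (n : ℕ)
    (f : (Fin (n+1) → ℝ) → ℝ) (hf : Nice f) (hs : SwapAnti f) (θ : Fin (n+1) → ℝ)
    (hθ : ∀ i, 0 ≤ η + θ i ∧ η + θ i ≤ 1) (hmono : Monotone θ) :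
    Psi (n+1) b τ η f θ =
      (-1) ^ n * iterInt n (fun i => (η + θ i.castSucc - 1, η + θ i.succ - 1))
        (fun t => (∏ i, b (τ + 1 + t i)) * f (Fin.cons 0 t)) +
      (-1) ^ (n + 1) * iterInt (n+1)
        (fun i => (if h : (i : ℕ) = 0 then -1 else η + θ ⟨i - 1, by omega⟩ - 1, η + θ i - 1))
        (fun t => (∏ i, b (τ + 1 + t i)) * f t) := by
  rw [Psi_JJ hβ _ f hf θ hθ]
  set β : ℝ → ℝ := fun s => - b (τ + 1 + s) with hβd
  let w : ℕ → ℝ → ℝ := fun i => if h : i < n + 1 then DD + EE β (-1) (η + θ ⟨i, h⟩ - 1) else 0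
  have hE : ∀ i, Integrable (EE β (-1) (η + θ i - 1)) muM :=
      fun i => integrable_EE hβ (by linarith [(hθ i).2])
  have h1 := JJ_tele (w := w) (f := f) (fun i hi => by
    simp only [w, hi, dif_pos]; exact integrable_DD.add (hE _)) hf hs (n+1) le_rfl
  have e1 : (fun i : Fin (n+1) => w i) = fun i => DD + EE β (-1) (η + θ i - 1) := by
    ext i : 1; simp only [w, i.isLt, dif_pos]
  rw [← e1, ← h1]
  clear h1 e1
  set W : Fin (n+1) → ℝ → ℝ := fun i => EE β (if h : (i : ℕ) = 0 then -1 else η + θ ⟨i - 1, by omega⟩ - 1) (η + θ i - 1) with hW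
  have hWi : ∀ i, Integrable (W i) muM := fun i => integrable_EE hβ (by linarith [(hθ i).2])
  have e2 : (fun i : Fin (n+1) => if n + 1 - (n+1) ≤ (i : ℕ) ∧ 1 ≤ (i : ℕ) then w i - w (i - 1) else w i)
      = Function.update W 0 (DD + W 0) := by
    ext i : 1
    by_cases h0 : i = 0
    · subst h0; simp [w, W]
    · have h0' : (i : ℕ) ≠ 0 := fun h => h0 (Fin.ext h)
      rw [Function.update_of_ne h0, if_pos (by omega)]
      have h2 := i.isLt
      simp only [w, W, h2, dif_pos, h0', dif_neg, not_false_eq_true, show (i : ℕ) - 1 < n + 1 by omega]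
      refine EE_sub β (by linarith [(hθ ⟨i - 1, by omega⟩).1]) ?_
      have := hmono (a := ⟨i - 1, by omega⟩) (b := i) (by rw [Fin.le_def]; simp)
      linarith
  rw [e2, JJ_update_add hWi hf 0 integrable_DD (hWi 0), Function.update_eq_self]
  have hi : ∀ i, Integrable (Function.update W 0 DD i) muM := by
    intro i
    by_cases h : i = 0
    · subst h; simpa using integrable_DD
    · simpa [h] using hWi i
  have hprod : ∀ k (t : Fin k → ℝ), ∏ i, β (t i) = (-1) ^ k * ∏ i, b (τ + 1 + t i) := by
    intro k t
    simp only [hβd, Finset.prod_neg, Finset.card_univ, Fintype.card_fin]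
  congr 1
  · rw [JJ_succ hi hf]
    simp only [Function.update_self]
    rw [int_DD]
    have := JJ_EE hβ n (fun i => (η + θ i.castSucc - 1, η + θ i.succ - 1)) (fun i =>
      ⟨by have := hmono (Fin.castSucc_le_succ i); simp only; linarith,
       by simp only; linarith [(hθ i.succ).2]⟩) _ (hf.cons 0)
    rw [← iterInt_const_mul]
    simp only [hprod, mul_assoc] at this
    rw [← this]
    congr 1
  · have := JJ_EE hβ (n+1) (fun i => (if h : (i : ℕ) = 0 then -1 else η + θ ⟨i - 1, by omega⟩ - 1, η + θ i - 1)) (fun i => by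
      refine ⟨?_, by simp only; linarith [(hθ i).2]⟩
      dsimp only
      split_ifs with h
      · linarith [(hθ i).1]
      · have := hmono (a := ⟨i - 1, by omega⟩) (b := i) (by rw [Fin.le_def]; simp)
        linarith) _ hf
    rw [← iterInt_const_mul]
    simp only [hprod, mul_assoc] at this
    rw [← this]

lemma fold_natAdd {a n : ℕ} (b : ℝ → ℝ) (τ η : ℝ) (f : (Fin (a+n) → ℝ) → ℝ) :
    ∀ (l : List (Fin n)) (x : Fin (a+n) → ℝ),
    l.foldr (fun k acc => ZBop (a+n) b τ η (Fin.natAdd a k) acc) f x =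
    l.foldr (fun k acc => ZBop n b τ η k acc)
      (fun v => f (Fin.append (fun i => x (Fin.castAdd n i)) v)) (fun i => x (Fin.natAdd a i)) := by
  intro l
  induction l with
  | nil => intro x; simp only [List.foldr_nil]; rw [Fin.append_castAdd_natAdd]
  | cons k l ih =>
    intro x
    simp only [List.foldr_cons]
    rw [ZBop_apply, ZBop_apply]
    have h0 : ∀ s, (fun i => Function.update x (Fin.natAdd a k) s (Fin.castAdd n i)) =
        fun i => x (Fin.castAdd n i) := fun s => by
      ext i
      rw [Function.update_of_ne]; simp [Fin.ext_iff]; omega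
    have h1 : ∀ s, (fun i => Function.update x (Fin.natAdd a k) s (Fin.natAdd a i)) =
        Function.update (fun i => x (Fin.natAdd a i)) k s := fun s => by
      ext i
      by_cases h : i = k
      · subst h; simp
      · rw [Function.update_of_ne h, Function.update_of_ne]; simpa [Fin.ext_iff] using h
    simp only [ih, h0, h1]

lemma fold_first {m : ℕ} (b : ℝ → ℝ) (τ η : ℝ) (G : (Fin m → ℝ) → ℝ) :
    ∀ (l : List (Fin m)) (_ : l.Nodup) (x : Fin m → ℝ) (_ : ∀ k ∈ l, x k ≤ -η),
    l.foldr (fun k acc => ZBop m b τ η k acc) G x = G (fun j => if j ∈ l then η + x j else x j) := by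
  intro l
  induction l with
  | nil => intro _ x _; simp
  | cons k l ih =>
    intro hl x hx
    have hk := hx k (by simp)
    rw [List.nodup_cons] at hl
    rw [List.foldr_cons, ZBop_apply, min_eq_left (by linarith), max_eq_right (by linarith), zero_sub,
      intervalIntegral.integral_same, sub_zero, ih hl.2]
    · congr 1; ext j
      by_cases h : j = k
      · subst h; simp [hl.1]
      · simp [h]
    · intro j hj
      have : j ≠ k := fun h => hl.1 (h ▸ hj)
      rw [Function.update_of_ne this]; exact hx j (by simp [hj])

lemma Psi_split {a n : ℕ} (b : ℝ → ℝ) (τ η : ℝ) (f : (Fin (a+n) → ℝ) → ℝ) (θ : Fin (a+n) → ℝ)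
    (h : ∀ i : Fin a, θ (Fin.castAdd n i) ≤ -η) :
    Psi (a+n) b τ η f θ =
      Psi n b τ η (fun v => f (Fin.append (fun i => η + θ (Fin.castAdd n i)) v))
        (fun i => θ (Fin.natAdd a i)) := by
  have e : List.finRange (a+n) = (List.finRange a).map (Fin.castAdd n) ++
      (List.finRange n).map (Fin.natAdd a) := by
    rw [← List.ofFn_id, List.ofFn_add, ← List.ofFn_id, ← List.ofFn_id, List.map_ofFn, List.map_ofFn]
    rfl
  have hmem : ∀ i : Fin (a+n), i ∈ (List.finRange a).map (Fin.castAdd n) ↔ (i : ℕ) < a := by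
    intro i
    simp only [List.mem_map, List.mem_finRange, true_and]
    constructor
    · rintro ⟨j, rfl⟩; simp
    · intro h; exact ⟨⟨i, h⟩, rfl⟩
  unfold Psi
  rw [e, List.foldr_append, fold_first, List.foldr_map, fold_natAdd]
  · simp only [hmem]
    congr 1
    · simp
  · exact (List.nodup_finRange a).map (Fin.castAdd_injective a n)
  · intro k hk
    obtain ⟨j, _, rfl⟩ := List.mem_map.1 hk
    exact h j

lemma fold_congr {m : ℕ} (b : ℝ → ℝ) {τ η : ℝ} (hη0 : 0 < η) (hη1 : η ≤ 1)
    {f g : (Fin m → ℝ) → ℝ} (hfg : ∀ x ∈ CubeR m, f x = g x) :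
    ∀ (l : List (Fin m)) (x : Fin m → ℝ) (_ : x ∈ CubeR m),
    l.foldr (fun k acc => ZBop m b τ η k acc) f x = l.foldr (fun k acc => ZBop m b τ η k acc) g x := by
  have upd : ∀ x ∈ CubeR m, ∀ k s, s ∈ Set.Icc (-1:ℝ) 0 → Function.update x k s ∈ CubeR m := by
    intro x hx k s hs i
    by_cases h : i = k
    · subst h; simpa using hs
    · simpa [h] using hx i
  intro l
  induction l with
  | nil => intro x hx; exact hfg x hx
  | cons k l ih =>
    intro x hx
    have hk := hx k
    rw [List.foldr_cons, List.foldr_cons, ZBop_apply, ZBop_apply, ih _ (upd x hx k _ _)]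
    · congr 1
      apply intervalIntegral.integral_congr
      intro s hs
      have h1 : (-1:ℝ) ≤ max (η + x k) 0 - 1 := by linarith [le_max_right (η + x k) 0]
      have h2 : max (η + x k) 0 ≤ 1 := max_le (by linarith [hk.2]) (by norm_num)
      rw [Set.uIcc_of_le h1] at hs
      simp only
      rw [ih _ (upd x hx k s ⟨hs.1, by linarith [hs.2]⟩)]
    · exact ⟨le_min (by linarith [hk.1]) (by norm_num), min_le_right _ _⟩

lemma iterInt_congr {n n' : ℕ} (h : n = n') : ∀ (bds : Fin n → ℝ × ℝ) (bds' : Fin n' → ℝ × ℝ)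
    (_ : ∀ i, bds i = bds' (Fin.cast h i)) (f : (Fin n → ℝ) → ℝ) (f' : (Fin n' → ℝ) → ℝ)
    (_ : ∀ t, (∀ i, t i ∈ Set.uIcc (bds i).1 (bds i).2) → f t = f' (fun i => t (Fin.cast h.symm i))),
    iterInt n bds f = iterInt n' bds' f' := by
  subst h
  simp only [Fin.cast_refl, id]
  induction n with
  | zero => intro _ _ _ f f' h; exact h _ (fun i => i.elim0)
  | succ n ih =>
    intro bds bds' hb f f' hf
    obtain rfl : bds = bds' := funext hb
    simp only [iterInt]
    apply intervalIntegral.integral_congr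
    intro s hs
    refine ih _ _ (fun _ => rfl) _ _ (fun t ht => hf _ (fun i => ?_))
    refine Fin.cases ?_ (fun j => ?_) i
    · simpa using hs
    · simpa using ht j

def clp {m : ℕ} (t : Fin m → ℝ) : Fin m → ℝ := fun i => max (-1) (min (t i) 0)

lemma clp_mem {m : ℕ} (t : Fin m → ℝ) : clp t ∈ CubeR m := fun i =>
  ⟨le_max_left _ _, max_le (by norm_num) (min_le_right _ _)⟩

lemma clp_eq {m : ℕ} {t : Fin m → ℝ} (ht : t ∈ CubeR m) : clp t = t := by
  ext i
  unfold clp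
  rw [min_eq_left (ht i).2, max_eq_right (ht i).1]

lemma nice_clp {m : ℕ} {φ : (Fin m → ℝ) → ℝ} (hφc : ContinuousOn φ (CubeR m)) :
    Nice (fun t => φ (clp t)) := by
  have hc : IsCompact (CubeR m) := by
    have : CubeR m = Set.pi Set.univ (fun _ => Set.Icc (-1:ℝ) 0) := by
      ext x; simp only [CubeR, Set.mem_pi, Set.mem_univ, true_imp_iff, Set.mem_ofPred_eq]
    rw [this]
    exact isCompact_univ_pi fun _ => isCompact_Icc
  obtain ⟨C, hC⟩ := hc.exists_bound_of_continuousOn hφc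
  refine ⟨hφc.comp_continuous ?_ clp_mem, C, fun t => hC _ (clp_mem t)⟩
  unfold clp; fun_prop

lemma rot_val (N k : ℕ) (i : Fin (N+1)) :
    (((finRotate (N+1)) ^ k) i : ℕ) = (i + k) % (N+1) := by
  induction k generalizing i with
  | zero => simp [Nat.mod_eq_of_lt i.isLt]
  | succ k ih =>
    rw [pow_succ, Equiv.Perm.mul_apply, ih, finRotate_apply, Fin.val_add, Fin.val_one',
      Nat.add_mod_mod, Nat.mod_add_mod, add_assoc, add_comm 1 k]

lemma app_eq {a n : ℕ} (u : Fin a → ℝ) (v : Fin n → ℝ) (j : Fin (a+n)) :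
    Fin.append u v j = if h : (j : ℕ) < a then u ⟨j, h⟩ else v ⟨j - a, by omega⟩ := by
  refine Fin.addCases (fun l => ?_) (fun l => ?_) j
  · simp
  · simp

lemma cons_eq {n : ℕ} (c : ℝ) (v : Fin n → ℝ) (j : Fin (n+1)) :
    (Fin.cons c v : Fin (n+1) → ℝ) j = if h : (j : ℕ) = 0 then c else v ⟨j - 1, by omega⟩ := by
  refine Fin.cases ?_ (fun l => ?_) j
  · simp
  · simp

lemma sign1 (a n : ℕ) (P X : ℝ) : (-1) ^ n * (P * ((-1) ^ ((a + n) * (a + 1)) * X)) =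
    (-1) ^ (a * (a + (n + 1))) * (P * X) := by
  have : (-1 : ℝ) ^ n * (-1) ^ ((a + n) * (a + 1)) = (-1) ^ (a * (a + (n + 1))) := by
    rw [← pow_add, show n + (a + n) * (a + 1) = a * (a + (n + 1)) + 2 * n by ring, pow_add, pow_mul _ 2 n]
    simp
  rw [← this]; ring

lemma sign2 (a n : ℕ) (P X : ℝ) : (-1) ^ (n + 1) * (P * ((-1) ^ ((a + n) * a) * X)) =
    (-1) ^ ((a + 1) * (a + (n + 1))) * (P * X) := by
  have : (-1) ^ ((a + 1) * (a + (n + 1))) = (-1 : ℝ) ^ (n+1) * (-1) ^ ((a + n) * a) := by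
    rw [← pow_add, show (a + 1) * (a + (n + 1)) = (n + 1 + (a + n) * a) + 2 * a by ring, pow_add _ _ (2 * a), pow_mul _ 2 a]
    simp
  rw [this]; ring

lemma f_rot {M N : ℕ} (hM : M = N + 1) {f : (Fin M → ℝ) → ℝ}
    (hf : ∀ (σ : Equiv.Perm (Fin M)) t, f (t ∘ σ) = ((Equiv.Perm.sign σ : ℤ) : ℝ) * f t)
    (k : ℕ) (x y : Fin M → ℝ)
    (hxy : ∀ i j : Fin M, (j : ℕ) = (i + k) % (N+1) → y i = x j) :
    f x = (-1) ^ (N * k) * f y := by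
  subst hM
  have : y = x ∘ ((finRotate (N+1)) ^ k : Equiv.Perm _) := by
    ext i; exact hxy _ _ (rot_val N k i)
  rw [this, hf, map_pow, sign_finRotate]
  simp only [Nat.add_sub_cancel]
  push_cast
  rw [← pow_mul, ← mul_assoc, ← mul_pow]; simp

lemma main_formula (b : ℝ → ℝ) (hb : LocallyIntegrable b volume)
    (a n : ℕ) (τ η : ℝ) (hη0 : 0 < η) (hη1 : η ≤ 1)
    (φ : (Fin (a+(n+1)) → ℝ) → ℝ) (hφc : ContinuousOn φ (CubeR (a+(n+1))))
    (hanti : ∀ (σ : Equiv.Perm (Fin (a+(n+1)))), ∀ θ ∈ CubeR (a+(n+1)),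
        φ (θ ∘ σ) = ((Equiv.Perm.sign σ : ℤ) : ℝ) * φ θ)
    (θ : Fin (a+(n+1)) → ℝ) (hθ : θ ∈ TsetR (a+(n+1)))
    (ha1 : ∀ i : Fin (a+(n+1)), (i : ℕ) < a → θ i ≤ -η)
    (ha2 : ∀ i : Fin (a+(n+1)), a ≤ (i : ℕ) → -η ≤ θ i) :
      Psi (a+(n+1)) b τ η φ θ =
        (-1 : ℝ) ^ (a * (a+(n+1))) *
          iterInt n
            (fun i => (η + θ ⟨a + (i : ℕ), by have := i.isLt; omega⟩ - 1,
                       η + θ ⟨a + (i : ℕ) + 1, by have := i.isLt; omega⟩ - 1))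
            (fun t => (∏ i, b (τ + 1 + t i)) *
              φ (fun j => if h : (j : ℕ) < n then t ⟨(j : ℕ), h⟩
                  else if (j : ℕ) < a + n then
                    η + θ ⟨(j : ℕ) - n, by have := j.isLt; omega⟩
                  else 0)) +
        (-1 : ℝ) ^ ((a + 1) * (a+(n+1))) *
          iterInt (n + 1)
            (fun i => ((if (i : ℕ) = 0 then (-1 : ℝ)
                        else η + θ ⟨a + (i : ℕ) - 1, by have := i.isLt; omega⟩ - 1),
                       η + θ ⟨a + (i : ℕ), by have := i.isLt; omega⟩ - 1))
            (fun t => (∏ i, b (τ + 1 + t i)) *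
              φ (fun j => if h : (j : ℕ) < n + 1 then t ⟨(j : ℕ), h⟩
                  else η + θ ⟨(j : ℕ) - (n + 1), by have := j.isLt; omega⟩)) := by
  obtain ⟨hcube, hmono⟩ := hθ
  have hβ : LocallyIntegrable (fun s => - b (τ + 1 + s)) volume := by
    refine LocallyIntegrable.neg ?_
    rw [locallyIntegrable_iff]
    intro K hK
    have hK' : IsCompact ((fun s => τ + 1 + s) '' K) := hK.image (by fun_prop)
    have := (measurePreserving_add_left volume (τ+1)).integrableOn_comp_preimage
      (measurableEmbedding_addLeft (τ+1)) (f := b) (s := (fun s => τ + 1 + s) '' K)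
    exact (this.2 (hb.integrableOn_isCompact hK')).mono_set (Set.subset_preimage_image _ _)
  set f : (Fin (a+(n+1)) → ℝ) → ℝ := fun t => φ (clp t) with hf
  have hfφ : ∀ x ∈ CubeR (a+(n+1)), f x = φ x := fun x hx => by simp only [hf, clp_eq hx]
  have hfanti : ∀ (σ : Equiv.Perm (Fin (a+(n+1)))) t,
      f (t ∘ σ) = ((Equiv.Perm.sign σ : ℤ) : ℝ) * f t := fun σ t => hanti σ _ (clp_mem t)
  have hfn : Nice f := nice_clp hφc
  have h1 : Psi (a+(n+1)) b τ η φ θ = Psi (a+(n+1)) b τ η f θ :=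
    (fold_congr b hη0 hη1 hfφ _ θ hcube).symm
  rw [h1, Psi_split b τ η f θ (fun i => ha1 _ (by simp))]
  set u : Fin a → ℝ := fun i => η + θ (Fin.castAdd (n+1) i) with hu
  rw [Psi_core hβ n]
  rotate_left
  · obtain ⟨h1, C, hC⟩ := hfn
    refine ⟨h1.comp (continuous_pi fun i => ?_), C, fun t => hC _⟩
    refine Fin.addCases (fun j => ?_) (fun j => ?_) i
    · simp only [Fin.append_left]; fun_prop
    · simp only [Fin.append_right]; fun_prop
  · intro i j hij t
    have hne : Fin.natAdd a i ≠ Fin.natAdd a j := by simpa [Fin.ext_iff] using hij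
    have : Fin.append u (t ∘ Equiv.swap i j) =
        Fin.append u t ∘ Equiv.swap (Fin.natAdd a i) (Fin.natAdd a j) := by
      ext k
      refine Fin.addCases (fun l => ?_) (fun l => ?_) k
      · rw [Function.comp, Equiv.swap_apply_of_ne_of_ne] 
        · simp
        · simp [Fin.ext_iff]; omega
        · simp [Fin.ext_iff]; omega
      · simp only [Function.comp, Fin.append_right]
        rcases eq_or_ne l i with rfl | h1
        · simp
        rcases eq_or_ne l j with rfl | h2
        · simp
        rw [Equiv.swap_apply_of_ne_of_ne h1 h2, Equiv.swap_apply_of_ne_of_ne]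
        · simp
        · simpa [Fin.ext_iff] using h1
        · simpa [Fin.ext_iff] using h2
    simp only
    rw [this, hfanti, Equiv.Perm.sign_swap hne]; simp
  · intro i
    have h2 := ha2 (Fin.natAdd a i) (by simp)
    have h3 := (hcube (Fin.natAdd a i)).2
    exact ⟨by linarith, by linarith⟩
  · intro i j hij
    exact hmono (by simpa using hij)
  have hη : ∀ i : Fin (a+(n+1)), η + θ i - 1 ≤ 0 := fun i => by linarith [(hcube i).2]
  have hη' : ∀ i : Fin (a+(n+1)), a ≤ (i:ℕ) → -1 ≤ η + θ i - 1 := fun i hi => by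
    linarith [ha2 i hi]
  have hu1 : ∀ i : Fin (a+(n+1)), (i:ℕ) < a → η + θ i ∈ Set.Icc (-1:ℝ) 0 := fun i hi =>
    ⟨by linarith [(hcube i).1], by linarith [ha1 i hi]⟩
  congr 1
  · rw [← iterInt_const_mul, ← iterInt_const_mul]
    refine iterInt_congr rfl _ _ (fun i => ?_) _ _ (fun t ht => ?_)
    · rfl
    · simp only [Fin.cast_refl, id]
      rw [← hfφ]
      · rw [f_rot (M := a + (n + 1)) (N := a + n) rfl hfanti (a+1) (Fin.append u (Fin.cons 0 t))
          (fun j => if h : (j : ℕ) < n then t ⟨(j : ℕ), h⟩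
                  else if (j : ℕ) < a + n then
                    η + θ ⟨(j : ℕ) - n, by have := j.isLt; omega⟩
                  else 0)]
        · exact sign1 _ _ _ _
        · intro i j hj
          have hi := i.isLt
          rw [app_eq]
          by_cases h1 : (i : ℕ) < n
          · rw [Nat.mod_eq_of_lt (by omega)] at hj
            rw [dif_pos h1, dif_neg (by omega), cons_eq, dif_neg (by simp only; omega)]
            congr 2; simp only; omega
          · rw [dif_neg h1]
            have hj' : (j : ℕ) = i - n := by
              rw [hj, show (i : ℕ) + (a + 1) = (i - n) + (a + n + 1) by omega, Nat.add_mod_right,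
                Nat.mod_eq_of_lt (by omega)]
            by_cases h2 : (i : ℕ) < a + n
            · rw [if_pos h2, dif_pos (by omega)]
              simp only [hu]
              congr 2; ext; simp [hj']
            · rw [if_neg h2, dif_neg (by omega), cons_eq, dif_pos (by simp only; omega)]
      · intro j
        have hj := j.isLt
        simp only
        split_ifs with h1 h2
        · have h3 := ht ⟨j, h1⟩
          have h4 : η + θ (Fin.natAdd a (Fin.castSucc ⟨j, h1⟩)) - 1 ≤ η + θ (Fin.natAdd a (Fin.succ ⟨j, h1⟩)) - 1 := by
            have := hmono (a := Fin.natAdd a (Fin.castSucc ⟨j, h1⟩)) (b := Fin.natAdd a (Fin.succ ⟨j, h1⟩))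
              (by rw [Fin.le_def]; simp)
            linarith
          rw [Set.uIcc_of_le h4] at h3
          exact ⟨(hη' _ (by simp)).trans h3.1, h3.2.trans (hη _)⟩
        · exact hu1 _ (by simp only; omega)
        · exact ⟨by norm_num, le_rfl⟩
  · rw [← iterInt_const_mul, ← iterInt_const_mul]
    refine iterInt_congr rfl _ _ (fun i => ?_) _ _ (fun t ht => ?_)
    · simp only [Fin.cast_refl, id]
      congr 1
      by_cases h : (i : ℕ) = 0
      · simp [h]
      · rw [dif_neg h, if_neg h]
        congr 3; ext; simp; omega
    · simp only [Fin.cast_refl, id]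
      rw [← hfφ]
      · rw [f_rot (M := a + (n + 1)) (N := a + n) rfl hfanti a (Fin.append u t)
          (fun j => if h : (j : ℕ) < n + 1 then t ⟨(j : ℕ), h⟩
                  else η + θ ⟨(j : ℕ) - (n + 1), by have := j.isLt; omega⟩)]
        · exact sign2 _ _ _ _
        · intro i j hj
          have hi := i.isLt
          rw [app_eq]
          by_cases h1 : (i : ℕ) < n + 1
          · rw [Nat.mod_eq_of_lt (by omega)] at hj
            rw [dif_pos h1, dif_neg (by omega)]
            congr 2; omega
          · rw [dif_neg h1]
            have hj' : (j : ℕ) = i - (n + 1) := by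
              rw [hj, show (i : ℕ) + a = (i - (n + 1)) + (a + n + 1) by omega, Nat.add_mod_right,
                Nat.mod_eq_of_lt (by omega)]
            rw [dif_pos (by omega)]
            simp only [hu]
            congr 2; ext; simp [hj']
      · intro j
        have hj := j.isLt
        simp only
        split_ifs with h1
        · have h3 := ht ⟨j, h1⟩
          simp only at h3
          have h5 := hη' (Fin.natAdd a ⟨j, h1⟩) (by simp)
          split_ifs at h3 with h0
          · rw [Set.uIcc_of_le h5] at h3
            exact ⟨h3.1, h3.2.trans (hη _)⟩
          · have := hmono (a := Fin.natAdd a ⟨j - 1, by omega⟩) (b := Fin.natAdd a ⟨j, h1⟩)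
              (by rw [Fin.le_def]; simp)
            rw [Set.uIcc_of_le (by linarith)] at h3
            exact ⟨(hη' _ (by simp)).trans h3.1, h3.2.trans (hη _)⟩
        · exact hu1 _ (by simp only; omega)

theorem statement1 (b : ℝ → ℝ) (hb : LocallyIntegrable b volume)
    (m : ℕ) (hm : 1 ≤ m) (τ η : ℝ) (hη0 : 0 < η) (hη1 : η ≤ 1)
    (φ : (Fin m → ℝ) → ℝ) (hφc : ContinuousOn φ (CubeR m))
    (hanti : ∀ (σ : Equiv.Perm (Fin m)), ∀ θ ∈ CubeR m,
        φ (θ ∘ σ) = ((Equiv.Perm.sign σ : ℤ) : ℝ) * φ θ)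
    (θ : Fin m → ℝ) (hθ : θ ∈ TsetR m)
    (a : ℕ) (ham : a ≤ m)
    (ha1 : ∀ i : Fin m, (i : ℕ) < a → θ i ≤ -η)
    (ha2 : ∀ i : Fin m, a ≤ (i : ℕ) → -η ≤ θ i) :
    (a + 2 ≤ m →
      Psi m b τ η φ θ =
        (-1 : ℝ) ^ (a * m) *
          iterInt (m - a - 1)
            (fun i => (η + θ ⟨a + (i : ℕ), by have := i.isLt; omega⟩ - 1,
                       η + θ ⟨a + (i : ℕ) + 1, by have := i.isLt; omega⟩ - 1))
            (fun t => (∏ i, b (τ + 1 + t i)) *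
              φ (fun j => if h : (j : ℕ) < m - a - 1 then t ⟨(j : ℕ), h⟩
                  else if (j : ℕ) < m - 1 then
                    η + θ ⟨(j : ℕ) - (m - a - 1), by have := j.isLt; omega⟩
                  else 0)) +
        (-1 : ℝ) ^ ((a + 1) * m) *
          iterInt (m - a)
            (fun i => ((if (i : ℕ) = 0 then (-1 : ℝ)
                        else η + θ ⟨a + (i : ℕ) - 1, by have := i.isLt; omega⟩ - 1),
                       η + θ ⟨a + (i : ℕ), by have := i.isLt; omega⟩ - 1))
            (fun t => (∏ i, b (τ + 1 + t i)) *
              φ (fun j => if h : (j : ℕ) < m - a then t ⟨(j : ℕ), h⟩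
                  else η + θ ⟨(j : ℕ) - (m - a), by have := j.isLt; omega⟩))) ∧
    (a + 1 = m →
      Psi m b τ η φ θ =
        φ (fun j => if (j : ℕ) + 1 < m then η + θ j else 0) +
        (-1 : ℝ) ^ m *
          ∫ s in (-1 : ℝ)..(η + θ ⟨m - 1, by omega⟩ - 1),
            b (τ + 1 + s) *
              φ (fun j => if (j : ℕ) = 0 then s
                  else η + θ ⟨(j : ℕ) - 1, by have := j.isLt; omega⟩)) ∧
    (a = m → Psi m b τ η φ θ = φ (fun j => η + θ j)) := by
  refine ⟨?_, ?_, ?_⟩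
  · intro h
    obtain ⟨n, rfl⟩ : ∃ n, m = a + (n + 1) := ⟨m - a - 1, by omega⟩
    rw [main_formula b hb a n τ η hη0 hη1 φ hφc hanti θ hθ ha1 ha2]
    congr 2
    · refine iterInt_congr (show n = a + (n + 1) - a - 1 by omega) _ _ ?_ _ _ (fun t _ => ?_)
      · intro i; rfl
      congr 1
      · exact (Equiv.prod_comp (finCongr (by omega)) (fun i => b (τ + 1 + t i))).symm
      · congr 1; ext j
        have e1 : a + (n + 1) - a - 1 = n := by omega
        have e2 : a + (n + 1) - 1 = a + n := by omega
        simp only [e1, e2]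
        rfl
    · refine iterInt_congr (show n + 1 = a + (n + 1) - a by omega) _ _ ?_ _ _ (fun t _ => ?_)
      · intro i; rfl
      congr 1
      · exact (Equiv.prod_comp (finCongr (by omega)) (fun i => b (τ + 1 + t i))).symm
      · congr 1; ext j
        have e1 : a + (n + 1) - a = n + 1 := by omega
        simp only [e1]
        rfl
  · intro h
    subst h
    rw [main_formula b hb a 0 τ η hη0 hη1 φ hφc hanti θ hθ ha1 ha2]
    have h1 : (-1 : ℝ) ^ (a * (a + (0 + 1))) = 1 := by
      rw [zero_add]; exact (Nat.even_mul_succ_self a).neg_one_pow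
    have h2 : (-1 : ℝ) ^ ((a + 1) * (a + (0 + 1))) = (-1) ^ (a + 1) := by
      rw [zero_add, pow_mul]
      rcases Nat.even_or_odd (a + 1) with h | h
      · rw [h.neg_one_pow]; simp
      · rw [h.neg_one_pow, h.neg_one_pow]
    rw [h1, h2, one_mul]
    simp only [iterInt]
    congr 1
    · simp
    · congr 1
      refine intervalIntegral.integral_congr (fun s _ => ?_)
      simp only [Fin.prod_univ_succ, Finset.univ_eq_empty, Finset.prod_empty, mul_one, Fin.cons_zero]
      congr 2; ext j
      by_cases h : (j : ℕ) = 0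
      · simp [h]
      · rw [if_neg h, dif_neg (by omega)]
  · intro h
    subst h
    unfold Psi
    rw [fold_first b τ η φ _ (List.nodup_finRange a) θ (fun k _ => ha1 k k.isLt)]
    simp
end
end

section
/- Let τ ∈ ℝ and η > 0, and assume β(t) ≠ 0 for almost every t ∈ [τ, τ+η]. Then the solution operator U(τ+η,τ) : C([−1,0],ℝ) → C([−1,0],ℝ) of (∗), mapping φ to x_{τ+η} where x is the unique solution of (∗) on [τ−1, τ+η] with x_τ = φ, is one-to-one. Consequently, for every integer m ≥ 1 the m-fold exterior power W(τ+η, τ) : X^{∧m} → X^{∧m} is one-to-one. -/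
open MeasureTheory

noncomputable section

/-- `U` is the solution operator `U(τ+η, τ)` of the delay equation, on `C([-1,0],ℝ)`. -/
def IsSolutionOperator (a c : ℝ → ℝ) (τ η : ℝ) (U : C(I01, ℝ) →L[ℝ] C(I01, ℝ)) : Prop :=
  ∀ (φ : C(I01, ℝ)) (x : ℝ → ℝ), IsSolution a c τ (τ + η) x →
    (∀ θ : I01, x (τ + (θ : ℝ)) = φ θ) →
    ∀ θ : I01, U φ θ = x (τ + η + (θ : ℝ))

lemma locInt_ii {f : ℝ → ℝ} (hf : LocallyIntegrable f volume) (a b : ℝ) :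
    IntervalIntegrable f volume a b :=
  intervalIntegrable_iff.mpr <|
      (hf.integrableOn_isCompact isCompact_uIcc).mono_set Set.uIoc_subset_uIcc

lemma locInt_mul {f g : ℝ → ℝ} (hf : LocallyIntegrable f volume) (hg : Continuous g) :
    LocallyIntegrable (fun s => f s * g s) volume := by
  rw [← locallyIntegrableOn_univ] at hf ⊢
  exact hf.mul_continuousOn hg.continuousOn isOpen_univ.isLocallyClosed

lemma ac_exp {F : ℝ → ℝ} {a b : ℝ} (hF : AbsolutelyContinuousOnInterval F a b) :
    AbsolutelyContinuousOnInterval (fun t => Real.exp (F t)) a b := by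
  obtain ⟨C, hC⟩ := hF.exists_bound
  have hlip : ∃ K : NNReal, LipschitzOnWith K Real.exp (Set.Icc (-C) C) := 
    (Real.contDiff_exp (n := 1)).contDiffOn.exists_lipschitzOnWith (by decide)
      (convex_Icc _ _) isCompact_Icc
  obtain ⟨K, hK⟩ := hlip
  rw [absolutelyContinuousOnInterval_iff] at hF ⊢
  intro ε hε
  obtain ⟨δ, hδ, h⟩ := hF (ε / (K + 1)) (by positivity)
  refine ⟨δ, hδ, fun E hE hEδ => ?_⟩
  have h1 := h E hE hEδ
  have hle : ∑ i ∈ Finset.range E.1, dist (Real.exp (F (E.2 i).1)) (Real.exp (F (E.2 i).2))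
      ≤ ∑ i ∈ Finset.range E.1, (K + 1) * dist (F (E.2 i).1) (F (E.2 i).2) := by
    apply Finset.sum_le_sum
    intro i hi
    have hm := hE.1 i hi
    have := hK.dist_le_mul (F (E.2 i).1) (abs_le.mp (hC _ hm.1)) (F (E.2 i).2)
      (abs_le.mp (hC _ hm.2))
    refine this.trans ?_
    gcongr
    simp
  rw [← Finset.mul_sum] at hle
  rw [lt_div_iff₀ (by positivity)] at h1
  linarith

lemma varconst {a f : ℝ → ℝ} (ha : LocallyIntegrable a volume) (hf : LocallyIntegrable f volume)
    (τ c t : ℝ) (y : ℝ → ℝ)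
    (hy : y = fun t => Real.exp (-∫ s in τ..t, a s) *
      (c - ∫ s in τ..t, f s * Real.exp (∫ r in τ..s, a r))) :
    Continuous y ∧ y t = c - ∫ s in τ..t, (a s * y s + f s) := by
  have haI : ∀ u v, IntervalIntegrable a volume u v := fun u v =>
    locInt_ii ha u v
  have hA : Continuous (fun t => ∫ s in τ..t, a s) := intervalIntegral.continuous_primitive haI τ
  have hfe : LocallyIntegrable (fun s => f s * Real.exp (∫ r in τ..s, a r)) volume :=
    locInt_mul hf (Real.continuous_exp.comp hA)
  have hG : Continuous (fun t => ∫ s in τ..t, f s * Real.exp (∫ r in τ..s, a r)) :=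
    intervalIntegral.continuous_primitive (fun u v => (locInt_ii hfe _ _)) τ
  refine ⟨by rw [hy]; fun_prop, ?_⟩
  have hac : AbsolutelyContinuousOnInterval y τ t := by
    rw [hy]
    apply AbsolutelyContinuousOnInterval.mul
    · apply ac_exp
      exact ((haI τ t).absolutelyContinuousOnInterval_intervalIntegral Set.left_mem_uIcc).neg
    · apply AbsolutelyContinuousOnInterval.sub
      · exact (LipschitzWith.const c).lipschitzOnWith.absolutelyContinuousOnInterval
      · exact (locInt_ii hfe _ _).absolutelyContinuousOnInterval_intervalIntegral
          Set.left_mem_uIcc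
  have hint := hac.integral_deriv_eq_sub
  have hyτ : y τ = c := by simp [hy]
  have : ∫ s in τ..t, (a s * y s + f s) = - ∫ s in τ..t, deriv y s := by
    rw [← intervalIntegral.integral_neg]
    apply intervalIntegral.integral_congr_ae
    filter_upwards [(_root_.LocallyIntegrable.ae_hasDerivAt_integral ha), (_root_.LocallyIntegrable.ae_hasDerivAt_integral hfe)] with s h1 h2 _
    have h3 := ((h1 τ).neg.exp).mul ((h2 τ).const_sub c)
    have h4 := (h3.congr_of_eventuallyEq (Filter.Eventually.of_forall (congrFun hy))).deriv
    rw [h4, congrFun hy s]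
    have : Real.exp (-∫ s in τ..s, a s) * Real.exp (∫ s in τ..s, a s) = 1 := by
      rw [← Real.exp_add]; simp
    simp only [Pi.neg_apply]
    linear_combination (-f s) * this
  rw [this, hint, hyτ]; ring

def stepFun (a b : ℝ → ℝ) (τ : ℝ) (x : ℝ → ℝ) : ℝ → ℝ := fun t =>
  if t ≤ τ then x t else Real.exp (-∫ s in τ..t, a s) *
      (x τ - ∫ s in τ..t, (b s * x (s - 1)) * Real.exp (∫ r in τ..s, a r))

lemma stepFun_spec {a b : ℝ → ℝ} (ha : LocallyIntegrable a volume) (hb : LocallyIntegrable b volume)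
    (τ : ℝ) {x : ℝ → ℝ} (hx : Continuous x) :
    Continuous (stepFun a b τ x) ∧ ∀ t, τ ≤ t → stepFun a b τ x t =
      x τ - ∫ s in τ..t, (a s * stepFun a b τ x s + b s * x (s - 1)) := by
  have hf : LocallyIntegrable (fun s => b s * x (s - 1)) volume := locInt_mul hb (by fun_prop)
  have key := fun t => varconst ha hf τ (x τ) t _ rfl
  refine ⟨?_, ?_⟩
  · unfold stepFun
    apply Continuous.if_le hx (key 0).1 continuous_id continuous_const
    intro t ht
    simp only [id] at ht
    subst ht
    simp
  · intro t ht
    have h := (key t).2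
    have e : ∀ s, τ ≤ s → stepFun a b τ x s = Real.exp (-∫ s in τ..s, a s) *
      (x τ - ∫ s in τ..s, (b s * x (s - 1)) * Real.exp (∫ r in τ..s, a r)) := by
      intro s hs
      unfold stepFun
      split_ifs with h'
      · have : s = τ := le_antisymm h' hs
        subst this; simp
      · rfl
    rw [e t ht, h]
    congr 1
    apply intervalIntegral.integral_congr
    intro s hs
    rw [Set.uIcc_of_le ht] at hs
    simp only
    rw [e s hs.1]

lemma exists_sol {a b : ℝ → ℝ} (ha : LocallyIntegrable a volume) (hb : LocallyIntegrable b volume)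
    (τ η : ℝ) (φ : C(I01, ℝ)) :
    ∃ x : ℝ → ℝ, Continuous x ∧ IsSolution a b τ (τ + η) x ∧ ∀ θ : I01, x (τ + (θ : ℝ)) = φ θ := by
  let x0 : ℝ → ℝ := fun t => φ (Set.projIcc (-1) 0 (by norm_num) (t - τ))
  have hx0 : Continuous x0 := by fun_prop
  let X : ℕ → ℝ → ℝ := fun n => (stepFun a b τ)^[n] x0
  have hXs : ∀ n, X (n+1) = stepFun a b τ (X n) := fun n => Function.iterate_succ_apply' _ _ _
  have hXc : ∀ n, Continuous (X n) := by
    intro n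
    induction n with
    | zero => exact hx0
    | succ n ih => rw [hXs]; exact (stepFun_spec ha hb τ ih).1
  have hX0 : ∀ n, ∀ t ≤ τ, X n t = x0 t := by
    intro n
    induction n with
    | zero => intro t _; rfl
    | succ n ih => intro t ht; rw [hXs]; simp only [stepFun, if_pos ht]; exact ih t ht
  have hXX : ∀ n : ℕ, ∀ t ≤ τ + n, X (n+1) t = X n t := by
    intro n
    induction n with
    | zero => intro t ht; rw [hX0 _ t (by simpa using ht), hX0 _ t (by simpa using ht)]
    | succ n ih =>
      intro t ht
      by_cases h : t ≤ τ
      · rw [hX0 _ t h, hX0 _ t h]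
      rw [hXs (n+1)]
      conv_rhs => rw [hXs n]
      simp only [stepFun, if_neg h]
      rw [hX0 _ τ le_rfl, hX0 _ τ le_rfl]
      congr 2
      apply intervalIntegral.integral_congr
      intro s hs
      rw [Set.uIcc_of_le (not_le.mp h).le] at hs
      simp only
      rw [ih (s - 1) (by push_cast at ht; linarith [hs.2])]
  obtain ⟨N, hN⟩ := exists_nat_ge η
  refine ⟨X (N+1), hXc _, ⟨(hXc _).continuousOn, ?_⟩, ?_⟩
  · intro t ht
    have := (stepFun_spec ha hb τ (hXc N)).2 t ht.1
    rw [← hXs] at this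
    rw [this, hX0 _ τ le_rfl, hX0 _ τ le_rfl]
    congr 1
    apply intervalIntegral.integral_congr
    intro s hs
    rw [Set.uIcc_of_le ht.1] at hs
    simp only
    rw [hXX N (s - 1) (by linarith [hs.2, ht.2])]
  · intro θ
    rw [hX0 _ _ (by linarith [θ.2.2])]
    simp [x0]

lemma back_zero {a b : ℝ → ℝ} (ha : LocallyIntegrable a volume) (hb : LocallyIntegrable b volume)
    {τ T s0 : ℝ} (hbne : ∀ᵐ t ∂(volume.restrict (Set.Icc τ T)), b t ≠ 0)
    {x : ℝ → ℝ} (hx : Continuous x) (hsol : IsSolution a b τ T x) (hs0 : τ ≤ s0) (hsT : s0 < T)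
    (hz : ∀ t ∈ Set.Icc s0 T, x t = 0) : ∀ t ∈ Set.Icc (s0 - 1) (T - 1), x t = 0 := by
  have hg : LocallyIntegrable (fun s => a s * x s + b s * x (s - 1)) volume :=
    (locInt_mul ha hx).add (locInt_mul hb (by fun_prop))
  rw [ae_restrict_iff' measurableSet_Icc] at hbne
  have hae : ∀ᵐ s ∂volume, s ∈ Set.Ioo s0 T → x (s - 1) = 0 := by
    filter_upwards [(_root_.LocallyIntegrable.ae_hasDerivAt_integral hg), hbne] with s h1 h2 hs
    have hconst : HasDerivAt (fun t => ∫ r in τ..t, (a r * x r + b r * x (r - 1))) 0 s := by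
      apply (hasDerivAt_const s (x τ)).congr_of_eventuallyEq
      filter_upwards [Ioo_mem_nhds hs.1 hs.2] with t ht
      have e1 := hsol.2 t ⟨hs0.trans ht.1.le, ht.2.le⟩
      rw [hz t ⟨ht.1.le, ht.2.le⟩] at e1
      linarith
    have h3 := (h1 τ).unique hconst
    simp only [hz s ⟨hs.1.le, hs.2.le⟩, mul_zero, zero_add] at h3
    exact (mul_eq_zero.mp h3).resolve_left (h2 ⟨hs0.trans hs.1.le, hs.2.le⟩)
  have hEq : Set.EqOn (fun s => x (s - 1)) (fun _ => 0) (Set.Icc s0 T) := by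
    have : (fun s => x (s - 1)) =ᵐ[volume.restrict (Set.Icc s0 T)] (fun _ => (0:ℝ)) := by
      rw [← restrict_Ioo_eq_restrict_Icc]
      rw [Filter.EventuallyEq, ae_restrict_iff' measurableSet_Ioo]
      exact hae
    exact Measure.eqOn_Icc_of_ae_eq volume hsT.ne this (by fun_prop) (by fun_prop)
  intro t ht
  have := hEq (x := t + 1) ⟨by linarith [ht.1], by linarith [ht.2]⟩
  simpa using this

lemma sol_zero {a b : ℝ → ℝ} (ha : LocallyIntegrable a volume) (hb : LocallyIntegrable b volume)
    {τ η : ℝ} (hη : 0 < η) (hbne : ∀ᵐ t ∂(volume.restrict (Set.Icc τ (τ + η))), b t ≠ 0)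
    {x : ℝ → ℝ} (hx : Continuous x) (hsol : IsSolution a b τ (τ + η) x)
    (hz : ∀ t ∈ Set.Icc (τ + η - 1) (τ + η), x t = 0) : ∀ t ∈ Set.Icc (τ - 1) τ, x t = 0 := by
  have key : ∀ n : ℕ, ∀ t, τ + η - 1 - n ≤ t → τ - 1 ≤ t → t ≤ τ + η → x t = 0 := by
    intro n
    induction n with
    | zero => intro t h1 _ h3; exact hz t ⟨by simpa using h1, h3⟩
    | succ n ih =>
      intro t h1 h2 h3
      push_cast at h1
      by_cases h : τ + η - 1 - n ≤ t
      · exact ih t h h2 h3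
      have hn : (0:ℝ) ≤ n := n.cast_nonneg
      refine back_zero ha hb hbne hx hsol (s0 := max τ (τ + η - 1 - n)) (le_max_left _ _)
        (max_lt (by linarith) (by linarith)) ?_ t ⟨?_, by linarith⟩
      · intro s hs
        exact ih s ((le_max_right _ _).trans hs.1) (by linarith [(le_max_left _ _).trans hs.1]) hs.2
      · rw [sub_le_iff_le_add]
        exact max_le (by linarith) (by linarith)
  obtain ⟨N, hN⟩ := exists_nat_ge η
  intro t ht
  exact key N t (by linarith [ht.1]) ht.1 (by linarith [ht.2])

lemma U_inj {a b : ℝ → ℝ} (ha : LocallyIntegrable a volume) (hb : LocallyIntegrable b volume)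
    {τ η : ℝ} (hη : 0 < η) (hbne : ∀ᵐ t ∂(volume.restrict (Set.Icc τ (τ + η))), b t ≠ 0)
    (U : C(I01, ℝ) →L[ℝ] C(I01, ℝ)) (hU : IsSolutionOperator a b τ η U) :
    Function.Injective (⇑U) := by
  rw [injective_iff_map_eq_zero]
  intro φ hφ
  obtain ⟨x, hx, hsol, hin⟩ := exists_sol ha hb τ η φ
  have h1 := hU φ x hsol hin
  ext θ
  rw [← hin θ]
  refine sol_zero ha hb hη hbne hx hsol ?_ _ ⟨by linarith [θ.2.1], by linarith [θ.2.2]⟩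
  intro t ht
  have := h1 ⟨t - (τ + η), by linarith [ht.1], by linarith [ht.2]⟩
  rw [hφ] at this
  simpa using this.symm

/-- Apply `U` in the `i`-th variable. -/
def applyAtFun {m : ℕ} (U : C(I01, ℝ) →L[ℝ] C(I01, ℝ)) (i : Fin m) (Φ : C(Cube m, ℝ)) :
    C(Cube m, ℝ) :=
  let slice : C(Cube m, C(I01, ℝ)) :=
    ContinuousMap.curry ⟨fun p : Cube m × I01 => Φ (Function.update p.1 i p.2), by fun_prop⟩
  ⟨fun θ => U (slice θ) (θ i), by fun_prop⟩

def sliceAt {m : ℕ} (i : Fin m) (Φ : C(Cube m, ℝ)) (θ : Cube m) : C(I01, ℝ) :=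
  ⟨fun s => Φ (Function.update θ i s), by fun_prop⟩

lemma applyAtFun_apply {m : ℕ} (U : C(I01, ℝ) →L[ℝ] C(I01, ℝ)) (i : Fin m) (Φ : C(Cube m, ℝ))
    (θ : Cube m) : applyAtFun U i Φ θ = U (sliceAt i Φ θ) (θ i) := rfl

def applyAt {m : ℕ} (U : C(I01, ℝ) →L[ℝ] C(I01, ℝ)) (i : Fin m) :
    C(Cube m, ℝ) →L[ℝ] C(Cube m, ℝ) :=
  LinearMap.mkContinuous
    { toFun := applyAtFun U i
      map_add' := by
        intro Φ Ψ
        ext θ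
        have : sliceAt i (Φ + Ψ) θ = sliceAt i Φ θ + sliceAt i Ψ θ := rfl
        simp [applyAtFun_apply, this]
      map_smul' := by
        intro c Φ
        ext θ
        have : sliceAt i (c • Φ) θ = c • sliceAt i Φ θ := rfl
        simp [applyAtFun_apply, this] } ‖U‖ (by
    intro Φ
    rw [ContinuousMap.norm_le _ (by positivity)]
    intro θ
    change ‖U (sliceAt i Φ θ) (θ i)‖ ≤ _
    refine (ContinuousMap.norm_coe_le_norm _ _).trans ((U.le_opNorm _).trans ?_)
    gcongr
    rw [ContinuousMap.norm_le _ (by positivity)]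
    intro s
    exact Φ.norm_coe_le_norm _)

lemma applyAt_apply {m : ℕ} (U : C(I01, ℝ) →L[ℝ] C(I01, ℝ)) (i : Fin m) (Φ : C(Cube m, ℝ))
    (θ : Cube m) : applyAt U i Φ θ = U (sliceAt i Φ θ) (θ i) := rfl

lemma applyAt_inj {m : ℕ} (U : C(I01, ℝ) →L[ℝ] C(I01, ℝ)) (hU : Function.Injective U) (i : Fin m) :
    Function.Injective (applyAt U i) := by
  rw [injective_iff_map_eq_zero] at hU ⊢
  intro Φ hΦ
  ext θ
  have : sliceAt i Φ θ = 0 := by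
    apply hU
    ext s
    have h := applyAt_apply U i Φ (Function.update θ i s)
    have e : sliceAt i Φ (Function.update θ i s) = sliceAt i Φ θ := by
      ext r; simp [sliceAt]
    rw [hΦ, e] at h
    simpa using h.symm
  have h2 := DFunLike.congr_fun this (θ i)
  simpa [sliceAt] using h2

def prodFun {m : ℕ} (φ : Fin m → C(I01, ℝ)) : C(Cube m, ℝ) :=
  ⟨fun θ => ∏ j, φ j (θ j), by fun_prop⟩

lemma applyAt_prod {m : ℕ} (U : C(I01, ℝ) →L[ℝ] C(I01, ℝ)) (i : Fin m) (φ : Fin m → C(I01, ℝ)) :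
    applyAt U i (prodFun φ) = prodFun (Function.update φ i (U (φ i))) := by
  ext θ
  have : sliceAt i (prodFun φ) θ = (∏ j ∈ Finset.univ.erase i, φ j (θ j)) • φ i := by
    ext s
    simp only [sliceAt, prodFun, ContinuousMap.coe_mk, ContinuousMap.smul_apply, smul_eq_mul]
    rw [← Finset.prod_erase_mul _ _ (Finset.mem_univ i)]
    congr 1
    · apply Finset.prod_congr rfl
      intro j hj
      rw [Function.update_of_ne (Finset.ne_of_mem_erase hj)]
    · simp
  rw [applyAt_apply, this]
  simp only [map_smul, ContinuousMap.smul_apply, smul_eq_mul, prodFun, ContinuousMap.coe_mk]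
  rw [← Finset.prod_erase_mul Finset.univ _ (Finset.mem_univ i)]
  congr 1
  · apply Finset.prod_congr rfl
    intro j hj
    rw [Function.update_of_ne (Finset.ne_of_mem_erase hj)]
  · simp

def applyList {m : ℕ} (U : C(I01, ℝ) →L[ℝ] C(I01, ℝ)) : List (Fin m) →
    (C(Cube m, ℝ) →L[ℝ] C(Cube m, ℝ))
  | [] => ContinuousLinearMap.id ℝ _
  | i :: l => (applyAt U i).comp (applyList U l)

lemma applyList_inj {m : ℕ} (U : C(I01, ℝ) →L[ℝ] C(I01, ℝ)) (hU : Function.Injective U)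
    (l : List (Fin m)) : Function.Injective (applyList U l) := by
  induction l with
  | nil => exact Function.injective_id
  | cons i l ih => exact (applyAt_inj U hU i).comp ih

lemma applyList_prod {m : ℕ} (U : C(I01, ℝ) →L[ℝ] C(I01, ℝ)) (φ : Fin m → C(I01, ℝ))
    (l : List (Fin m)) (hl : l.Nodup) :
    applyList U l (prodFun φ) = prodFun (fun j => if j ∈ l then U (φ j) else φ j) := by
  induction l with
  | nil => simp [applyList]
  | cons i l ih =>
    rw [List.nodup_cons] at hl
    simp only [applyList, ContinuousLinearMap.comp_apply]
    rw [ih hl.2, applyAt_prod]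
    congr 1
    funext j
    by_cases h : j = i
    · subst h; simp [hl.1]
    · simp [h]

def tens (m : ℕ) (U : C(I01, ℝ) →L[ℝ] C(I01, ℝ)) : C(Cube m, ℝ) →L[ℝ] C(Cube m, ℝ) :=
  applyList U (List.finRange m)

lemma tens_prod {m : ℕ} (U : C(I01, ℝ) →L[ℝ] C(I01, ℝ)) (φ : Fin m → C(I01, ℝ)) :
    tens m U (prodFun φ) = prodFun (fun j => U (φ j)) := by
  rw [tens, applyList_prod _ _ _ (List.nodup_finRange m)]
  simp

def permMap {m : ℕ} (σ : Equiv.Perm (Fin m)) : C(Cube m, Cube m) :=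
  ⟨fun θ => θ ∘ σ, by fun_prop⟩

def permCLM {m : ℕ} (σ : Equiv.Perm (Fin m)) : C(Cube m, ℝ) →L[ℝ] C(Cube m, ℝ) where
  toFun Φ := Φ.comp (permMap σ)
  map_add' _ _ := rfl
  map_smul' _ _ := rfl
  cont := ContinuousMap.continuous_precomp _

lemma permCLM_apply {m : ℕ} (σ : Equiv.Perm (Fin m)) (Φ : C(Cube m, ℝ)) (θ : Cube m) :
    permCLM σ Φ θ = Φ (θ ∘ σ) := rfl

def altC (m : ℕ) : C(Cube m, ℝ) →L[ℝ] C(Cube m, ℝ) :=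
  ∑ σ : Equiv.Perm (Fin m), ((Equiv.Perm.sign σ : ℤ) : ℝ) •
    permCLM σ

lemma altC_apply {m : ℕ} (Φ : C(Cube m, ℝ)) (θ : Cube m) :
    altC m Φ θ = ∑ σ : Equiv.Perm (Fin m), ((Equiv.Perm.sign σ : ℤ) : ℝ) * Φ (θ ∘ σ) := by
  simp [altC, permCLM_apply]

lemma altC_mem {m : ℕ} (Φ : C(Cube m, ℝ)) : altC m Φ ∈ Xwedge m := by
  intro π θ
  rw [altC_apply, altC_apply, Finset.mul_sum]
  rw [← Equiv.sum_comp (Equiv.mulLeft π)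
    (fun σ => ((Equiv.Perm.sign π : ℤ) : ℝ) * (((Equiv.Perm.sign σ : ℤ) : ℝ) * Φ (θ ∘ σ)))]
  apply Finset.sum_congr rfl
  intro σ _
  have : (θ ∘ π) ∘ σ = θ ∘ (π * σ : Equiv.Perm (Fin m)) := rfl
  rw [this]
  simp only [Equiv.coe_mulLeft, Equiv.Perm.sign_mul]
  rcases Int.units_eq_one_or (Equiv.Perm.sign π) with h | h <;> simp [h]

def altX (m : ℕ) : C(Cube m, ℝ) →L[ℝ] Xwedge m := (altC m).codRestrict (Xwedge m) altC_mem

lemma altC_of_mem {m : ℕ} (Φ : Xwedge m) : altC m (Φ : C(Cube m, ℝ)) = (m.factorial : ℝ) • (Φ : C(Cube m, ℝ)) := by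
  ext θ
  rw [altC_apply]
  have : ∀ σ : Equiv.Perm (Fin m), ((Equiv.Perm.sign σ : ℤ) : ℝ) * (Φ : C(Cube m, ℝ)) (θ ∘ σ) =
      (Φ : C(Cube m, ℝ)) θ := by
    intro σ
    rw [Φ.2 σ θ, ← mul_assoc]
    rcases Int.units_eq_one_or (Equiv.Perm.sign σ) with h | h <;> simp [h]
  simp [this, Fintype.card_perm]

lemma altC_prod {m : ℕ} (φ : Fin m → C(I01, ℝ)) (θ : Cube m) :
    altC m (prodFun φ) θ = (Matrix.of fun i j => φ i (θ j)).det := by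
  rw [altC_apply, ← Matrix.det_transpose, Matrix.det_apply']
  simp [prodFun]

lemma altC_prod' {m : ℕ} (φ : Fin m → C(I01, ℝ)) :
    altC m (prodFun φ) = ∑ σ : Equiv.Perm (Fin m), ((Equiv.Perm.sign σ : ℤ) : ℝ) •
      prodFun (φ ∘ σ) := by
  ext θ
  rw [altC_prod, Matrix.det_apply']
  simp [prodFun]

lemma tens_alt_prod {m : ℕ} (U : C(I01, ℝ) →L[ℝ] C(I01, ℝ)) (φ : Fin m → C(I01, ℝ)) :
    tens m U (altC m (prodFun φ)) = altC m (prodFun (fun j => U (φ j))) := by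
  rw [altC_prod', altC_prod', map_sum]
  apply Finset.sum_congr rfl
  intro σ _
  rw [map_smul, tens_prod]
  rfl

lemma prod_dense (m : ℕ) :
    Dense (Submodule.span ℝ (Set.range (prodFun (m := m))) : Set C(Cube m, ℝ)) := by
  let S : Submonoid C(Cube m, ℝ) :=
    { carrier := Set.range prodFun
      one_mem' := ⟨fun _ => 1, by ext; simp [prodFun]⟩
      mul_mem' := by
        rintro _ _ ⟨φ, rfl⟩ ⟨ψ, rfl⟩
        exact ⟨fun j => φ j * ψ j, by ext; simp [prodFun, Finset.prod_mul_distrib]⟩ }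
  let A : Subalgebra ℝ C(Cube m, ℝ) := Algebra.adjoin ℝ (S : Set C(Cube m, ℝ))
  have hA : A.SeparatesPoints := by
    intro θ θ' hne
    obtain ⟨i, hi⟩ := Function.ne_iff.mp hne
    let φ : Fin m → C(I01, ℝ) := fun j => if j = i then ⟨fun s => (s : ℝ), by fun_prop⟩ else 1
    have hφ : ∀ θ, prodFun φ θ = (θ i : ℝ) := by
      intro θ
      simp only [prodFun, ContinuousMap.coe_mk]
      rw [Finset.prod_eq_single i]
      · simp [φ]
      · intro j _ hj; simp [φ, hj]
      · simp
    refine ⟨prodFun φ, ⟨prodFun φ, Algebra.subset_adjoin ⟨φ, rfl⟩, rfl⟩, ?_⟩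
    rw [hφ, hφ]
    exact fun h => hi (Subtype.ext h)
  have h := ContinuousMap.subalgebra_topologicalClosure_eq_top_of_separatesPoints A hA
  have e : (A : Set C(Cube m, ℝ)) = Submodule.span ℝ (Set.range (prodFun (m := m))) := by
    have := Algebra.adjoin_eq_span ℝ (S : Set C(Cube m, ℝ))
    rw [Submonoid.closure_eq] at this
    exact congrArg (fun B : Submodule ℝ C(Cube m, ℝ) => (B : Set C(Cube m, ℝ))) this
  rw [← e, dense_iff_closure_eq, ← Subalgebra.topologicalClosure_coe, h]
  rfl

lemma wedge_inj {a b : ℝ → ℝ} (ha : LocallyIntegrable a volume) (hb : LocallyIntegrable b volume)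
    {τ η : ℝ} (U : C(I01, ℝ) →L[ℝ] C(I01, ℝ)) (hU : IsSolutionOperator a b τ η U)
    (hinj : Function.Injective U) (m : ℕ) (W : Xwedge m →L[ℝ] Xwedge m)
    (hW : IsWedgePower a b m τ (τ + η) W) : Function.Injective W := by
  have key : (Xwedge m).subtypeL.comp (W.comp (altX m)) = (tens m U).comp (altC m) := by
    apply ContinuousLinearMap.ext_on (prod_dense m)
    rintro _ ⟨φ, rfl⟩
    choose x _ hsol hin using fun i => exists_sol ha hb τ η (φ i)
    have := hW x hsol (altX m (prodFun φ)) (altX m (prodFun fun j => U (φ j))) ?_ ?_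
    · simp only [ContinuousLinearMap.comp_apply]
      rw [this, tens_alt_prod]
      rfl
    · intro θ
      refine (altC_prod φ θ).trans ?_
      simp only [hin]
    · intro θ
      refine (altC_prod _ θ).trans ?_
      congr 2
      funext i j
      exact hU (φ i) (x i) (hsol i) (hin i) (θ j)
  rw [injective_iff_map_eq_zero]
  intro Φ hΦ
  have hf : (m.factorial : ℝ) ≠ 0 := by positivity
  have e1 : altX m (Φ : C(Cube m, ℝ)) = (m.factorial : ℝ) • Φ := Subtype.ext (altC_of_mem Φ)
  have h := DFunLike.congr_fun key (Φ : C(Cube m, ℝ))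
  simp only [ContinuousLinearMap.comp_apply, e1, map_smul, hΦ, smul_zero, map_zero] at h
  have h2 := (injective_iff_map_eq_zero _).mp (applyList_inj U hinj (List.finRange m)) _ h.symm
  rw [altC_of_mem] at h2
  exact Subtype.ext ((smul_eq_zero.mp h2).resolve_left hf)

theorem statement3 (α β : ℝ → ℝ)
    (hα : LocallyIntegrable α volume) (hβ : LocallyIntegrable β volume)
    (τ η : ℝ) (hη : 0 < η)
    (hβne : ∀ᵐ t ∂(volume.restrict (Set.Icc τ (τ + η))), β t ≠ 0)
    (U : C(I01, ℝ) →L[ℝ] C(I01, ℝ))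
    (hU : IsSolutionOperator α β τ η U) :
    Function.Injective (⇑U) ∧
      ∀ m : ℕ, 1 ≤ m → ∀ W : Xwedge m →L[ℝ] Xwedge m,
        IsWedgePower α β m τ (τ + η) W → Function.Injective (⇑W) := by
  have hinj := U_inj hα hβ hη hβne U hU
  exact ⟨hinj, fun m _ W hW => wedge_inj hα hβ U hU hinj m W hW⟩
end
end

section
/- Let Y be a real Banach space and K ⊆ Y a cone which is reproducing and normal. Let A and B be bounded linear operators on Y with 0 ≤ A ≤ B, that is, A maps K into K and B − A maps K into K. Then the spectral radii satisfy r(A) ≤ r(B), i.e., lim_{n→∞} ‖A^n‖^{1/n} ≤ lim_{n→∞} ‖B^n‖^{1/n}. -/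
open Filter

theorem aux_tendsto {Y : Type*} [NormedAddCommGroup Y] [NormedSpace ℝ Y] (A : Y →L[ℝ] Y) :
    ∃ r : ℝ, Tendsto (fun n : ℕ => ‖A ^ n‖ ^ ((n : ℝ)⁻¹)) atTop (nhds r) := by
  have key : ∀ ε : ℝ, 0 < ε → ∃ l : ℝ,
      Tendsto (fun n : ℕ => max (‖A ^ n‖ ^ ((n : ℝ)⁻¹)) ε) atTop (nhds l) := by
    intro ε hε
    have hpos : ∀ n : ℕ, 0 < max ‖A ^ n‖ (ε ^ n) := fun n => lt_max_of_lt_right (pow_pos hε n)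
    have hsub : Subadditive (fun n : ℕ => Real.log (max ‖A ^ n‖ (ε ^ n))) := by
      intro m n
      rw [← Real.log_mul (hpos m).ne' (hpos n).ne']
      apply Real.log_le_log (hpos _)
      apply max_le
      · rw [pow_add]
        exact (norm_mul_le _ _).trans (mul_le_mul (le_max_left _ _) (le_max_left _ _)
          (norm_nonneg _) (hpos m).le)
      · rw [pow_add]
        exact mul_le_mul (le_max_right _ _) (le_max_right _ _) (pow_pos hε n).le (hpos m).le
    have hb : BddBelow (Set.range fun n : ℕ => Real.log (max ‖A ^ n‖ (ε ^ n)) / n) := by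
      refine ⟨min 0 (Real.log ε), ?_⟩
      rintro _ ⟨n, rfl⟩
      rcases Nat.eq_zero_or_pos n with rfl | hn
      · simp
      · have hn' : (0 : ℝ) < n := by exact_mod_cast hn
        refine (min_le_right _ _).trans ?_
        rw [le_div_iff₀ hn', mul_comm, ← Real.log_pow]
        exact Real.log_le_log (pow_pos hε n) (le_max_right _ _)
    have h := hsub.tendsto_lim hb
    refine ⟨Real.exp hsub.lim, ?_⟩
    refine ((Real.continuous_exp.tendsto _).comp h).congr' ?_
    filter_upwards [eventually_gt_atTop 0] with n hn
    have hn' : (0 : ℝ) < n := by exact_mod_cast hn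
    have h1 : (max ‖A ^ n‖ (ε ^ n)) ^ ((n : ℝ)⁻¹) = max (‖A ^ n‖ ^ ((n : ℝ)⁻¹)) ε := by
      have h2 : (ε ^ n) ^ ((n : ℝ)⁻¹) = ε := Real.pow_rpow_inv_natCast hε.le hn.ne'
      have hi : (0 : ℝ) ≤ (n : ℝ)⁻¹ := by positivity
      rcases le_total ‖A ^ n‖ (ε ^ n) with h | h
      · have h3 := Real.rpow_le_rpow (norm_nonneg _) h hi
        rw [h2] at h3
        rw [max_eq_right h, max_eq_right h3, h2]
      · have h3 := Real.rpow_le_rpow (pow_pos hε n).le h hi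
        rw [h2] at h3
        rw [max_eq_left h, max_eq_left h3]
    rw [← h1, Real.rpow_def_of_pos (hpos n)]
    simp [div_eq_mul_inv]
  apply cauchySeq_tendsto_of_complete
  rw [Metric.cauchySeq_iff]
  intro ε hε
  obtain ⟨l, hl⟩ := key (ε / 2) (half_pos hε)
  obtain ⟨N, hN⟩ := Metric.cauchySeq_iff.1 hl.cauchySeq (ε / 2) (half_pos hε)
  refine ⟨N, fun m hm n hn => ?_⟩
  have h := hN m hm n hn
  have h0 : ∀ n : ℕ, 0 ≤ ‖A ^ n‖ ^ ((n : ℝ)⁻¹) := fun n => Real.rpow_nonneg (norm_nonneg _) _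
  have hm0 := h0 m
  have hn0 := h0 n
  rw [Real.dist_eq, abs_lt] at h ⊢
  constructor <;> rcases max_cases (‖A ^ m‖ ^ ((m : ℝ)⁻¹)) (ε / 2) with h1 | h1 <;>
    rcases max_cases (‖A ^ n‖ ^ ((n : ℝ)⁻¹)) (ε / 2) with h2 | h2 <;> linarith [h.1, h.2, h1.1, h1.2, h2.1, h2.2]

/-- If `K` is a reproducing normal cone in a real Banach space `Y` and
`0 ≤ A ≤ B` (with respect to `K`), then the spectral radii
`r(A) = lim ‖Aⁿ‖^{1/n}` and `r(B) = lim ‖Bⁿ‖^{1/n}` satisfy `r(A) ≤ r(B)`. -/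
theorem statement8 (Y : Type*) [NormedAddCommGroup Y] [NormedSpace ℝ Y] [CompleteSpace Y]
    (K : Set Y) (hKclosed : IsClosed K) (hKconvex : Convex ℝ K)
    (hKsmul : ∀ u ∈ K, ∀ σ : ℝ, 0 ≤ σ → σ • u ∈ K)
    (hKpointed : ∀ u ∈ K, -u ∈ K → u = 0)
    (hKrepro : ∀ y : Y, ∃ u ∈ K, ∃ v ∈ K, y = u - v)
    (hKnormal : ∃ c : ℝ, 0 < c ∧ ∀ u v : Y, u ∈ K → v - u ∈ K → ‖u‖ ≤ c * ‖v‖)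
    (A B : Y →L[ℝ] Y) (hA : ∀ u ∈ K, A u ∈ K) (hBA : ∀ u ∈ K, (B - A) u ∈ K) :
    ∃ rA rB : ℝ,
      Tendsto (fun n : ℕ => ‖A ^ n‖ ^ ((n : ℝ)⁻¹)) atTop (nhds rA) ∧
      Tendsto (fun n : ℕ => ‖B ^ n‖ ^ ((n : ℝ)⁻¹)) atTop (nhds rB) ∧
      rA ≤ rB := by
  obtain ⟨rA, hrA⟩ := aux_tendsto A
  obtain ⟨rB, hrB⟩ := aux_tendsto B
  refine ⟨rA, rB, hrA, hrB, ?_⟩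
  obtain ⟨c, hc, hnorm⟩ := hKnormal
  have hadd : ∀ u ∈ K, ∀ v ∈ K, u + v ∈ K := by
    intro u hu v hv
    have h := hKconvex (hKsmul u hu 2 (by norm_num)) (hKsmul v hv 2 (by norm_num))
      (by norm_num : (0 : ℝ) ≤ 1 / 2) (by norm_num : (0 : ℝ) ≤ 1 / 2) (by norm_num)
    simpa [smul_smul] using h
  have hB : ∀ u ∈ K, B u ∈ K := by
    intro u hu
    have h := hadd _ (hA u hu) _ (hBA u hu)
    simpa using h
  have hpow : ∀ n : ℕ, ∀ u ∈ K, (A ^ n) u ∈ K ∧ (B ^ n) u - (A ^ n) u ∈ K := by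
    intro n
    induction n with
    | zero =>
      intro u hu
      have h0 := hKsmul u hu 0 le_rfl
      rw [zero_smul] at h0
      simpa using ⟨hu, h0⟩
    | succ n ih =>
      intro u hu
      obtain ⟨h1, h2⟩ := ih u hu
      rw [pow_succ', pow_succ']
      refine ⟨hA _ h1, ?_⟩
      have h := hadd _ (hB _ h2) _ (hBA _ h1)
      have e : (B * B ^ n) u - (A * A ^ n) u =
          B ((B ^ n) u - (A ^ n) u) + (B - A) ((A ^ n) u) := by
        simp
      rw [e]
      exact h
  have hpt : ∀ y : Y, ∃ C : ℝ, 0 ≤ C ∧ ∀ n : ℕ, ‖(A ^ n) y‖ ≤ ‖B ^ n‖ * C := by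
    intro y
    obtain ⟨u, hu, v, hv, rfl⟩ := hKrepro y
    refine ⟨c * (‖u‖ + ‖v‖), by positivity, fun n => ?_⟩
    have hone : ∀ w ∈ K, ‖(A ^ n) w‖ ≤ c * (‖B ^ n‖ * ‖w‖) := fun w hw =>
      (hnorm _ _ (hpow n w hw).1 (hpow n w hw).2).trans
        (mul_le_mul_of_nonneg_left ((B ^ n).le_opNorm w) hc.le)
    rw [map_sub]
    have h3 := norm_sub_le ((A ^ n) u) ((A ^ n) v)
    linarith [hone u hu, hone v hv]
  obtain ⟨C, hC⟩ := banach_steinhaus (g := fun n : ℕ => ‖B ^ n‖⁻¹ • A ^ n) (by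
    intro y
    obtain ⟨C, hC0, hC⟩ := hpt y
    refine ⟨C, fun n => ?_⟩
    simp only [ContinuousLinearMap.smul_apply, norm_smul, norm_inv, norm_norm]
    rcases (norm_nonneg (B ^ n)).eq_or_lt with h | h
    · rw [← h]; simpa using hC0
    · rw [inv_mul_le_iff₀ h]; exact hC n)
  have hle : ∀ n : ℕ, ‖A ^ n‖ ≤ max C 1 * ‖B ^ n‖ := by
    intro n
    rcases (norm_nonneg (B ^ n)).eq_or_lt with h | h
    · have hz : A ^ n = 0 := by
        ext y
        obtain ⟨D, -, hD⟩ := hpt y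
        have := hD n
        rw [← h, zero_mul] at this
        simpa using this
      rw [hz, ← h]; simp
    · have h1 := hC n
      rw [norm_smul, norm_inv, norm_norm, inv_mul_le_iff₀ h] at h1
      nlinarith [le_max_left C 1]
  have hD : (0 : ℝ) < max C 1 := lt_max_of_lt_right one_pos
  have hlim : Tendsto (fun n : ℕ => (max C 1) ^ ((n : ℝ)⁻¹) * ‖B ^ n‖ ^ ((n : ℝ)⁻¹))
      atTop (nhds (1 * rB)) := by
    refine Tendsto.mul ?_ hrB
    have h := (Real.continuous_const_rpow hD.ne').tendsto 0
    rw [Real.rpow_zero] at h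
    exact h.comp tendsto_inv_atTop_nhds_zero_nat
  rw [one_mul] at hlim
  refine le_of_tendsto_of_tendsto' hrA hlim fun n => ?_
  rw [← Real.mul_rpow hD.le (norm_nonneg _)]
  exact Real.rpow_le_rpow (norm_nonneg _) (hle n) (by positivity)
end

section
/- Assume α, β : ℝ → ℝ are locally integrable and γ-periodic with (−1)^m·β(t) ≥ (−1)^m·β_0 > 0 for almost every t, for some integer m and constant β_0. For κ ∈ [0,1] consider the homotoped equation (hom_κ): x'(t) = −κ·α(t)·x(t) − (κ·β(t) + (1−κ)·β_0)·x(t−1). Let κ_i → κ_0 in [0,1], for each i ≥ 1 let x^i be a solution of (hom_{κ_i}) on all of ℝ, and suppose x^i → x^0 uniformly on compact intervals, where x^0 : ℝ → ℝ does not vanish identically. Let V^± denote V^− if m is even and V^+ if m is odd, and suppose there is an integer J with V^±(x^0_t) = J for all t ∈ ℝ, where x_t ∈ C([−1,0],ℝ) denotes θ ↦ x(t+θ). Then for every bounded interval I ⊆ ℝ there exists i_0 such that V^±(x^i_t) = J for all t ∈ I and all i ≥ i_0. -/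
open MeasureTheory Filter

noncomputable section

/-- A solution on all of `ℝ`. -/
def IsGlobalSolution (a c : ℝ → ℝ) (x : ℝ → ℝ) : Prop :=
  ∀ τ T : ℝ, τ ≤ T → IsSolution a c τ T x

/-- There exist `-1 < θ₀ < θ₁ < ⋯ < θ_k < 0` with `φ(θ_{i-1}) φ(θ_i) < 0`. -/
def SignChangeWitness (φ : I01 → ℝ) (k : ℕ) : Prop :=
  ∃ θ : Fin (k + 1) → I01, (StrictMono fun i => (θ i : ℝ)) ∧
    (-1 : ℝ) < (θ 0 : ℝ) ∧ ((θ (Fin.last k) : ℝ) < 0) ∧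
    ∀ i : Fin k, φ (θ i.castSucc) * φ (θ i.succ) < 0

/-- The number of sign changes `sc(φ) ∈ {0,1,…,∞}`. -/
def sc (φ : I01 → ℝ) : ℕ∞ :=
  sSup {n : ℕ∞ | ∃ k : ℕ, 1 ≤ k ∧ SignChangeWitness φ k ∧ n = (k : ℕ∞)}

open Classical in
/-- `Vpm 1 = V⁻` (values in odd numbers) and `Vpm 0 = V⁺` (values in even numbers):
`Vpm p φ = sc φ` if `sc φ` is infinite or has parity `p`, and `sc φ + 1` otherwise. -/
def Vpm (par : ℕ) (φ : I01 → ℝ) : ℕ∞ :=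
  if ∃ n : ℕ, sc φ = (n : ℕ∞) ∧ n % 2 ≠ par then sc φ + 1 else sc φ


/-- `n` alternating points in `[u, v]`, the first with sign `s`. -/
def WW (f : ℝ → ℝ) (v : ℝ) : ℕ → ℝ → ℝ → Prop
  | 0, _, _ => True
  | n + 1, s, u => ∃ p, u ≤ p ∧ p ≤ v ∧ 0 < s * f p ∧ WW f v n (-s) p

theorem WW.mono_u {f : ℝ → ℝ} {v : ℝ} {n : ℕ} {s u u' : ℝ} (h : WW f v n s u) (hu : u' ≤ u) :
    WW f v n s u' := by
  cases n with
  | zero => trivial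
  | succ n =>
    obtain ⟨p, h1, h2, h3, h4⟩ := h
    exact ⟨p, hu.trans h1, h2, h3, h4⟩

theorem WW.mono_v {f : ℝ → ℝ} {v v' : ℝ} {n : ℕ} {s u : ℝ} (h : WW f v n s u) (hv : v ≤ v') :
    WW f v' n s u := by
  induction n generalizing s u with
  | zero => trivial
  | succ n ih =>
    obtain ⟨p, h1, h2, h3, h4⟩ := h
    exact ⟨p, h1, h2.trans hv, h3, ih h4⟩

theorem WW.pred {f : ℝ → ℝ} {v : ℝ} {n : ℕ} {s u : ℝ} (h : WW f v (n + 1) s u) :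
    WW f v n s u := by
  induction n generalizing s u with
  | zero => trivial
  | succ n ih =>
    obtain ⟨p, h1, h2, h3, h4⟩ := h
    exact ⟨p, h1, h2, h3, ih h4⟩

theorem WW.le_n {f : ℝ → ℝ} {v : ℝ} {n k : ℕ} {s u : ℝ} (h : WW f v n s u) (hk : k ≤ n) :
    WW f v k s u := by
  induction n, hk using Nat.le_induction with
  | base => exact h
  | succ n _ ih => exact ih h.pred

theorem WW.split {f : ℝ → ℝ} {b c : ℝ} {n : ℕ} {s a : ℝ} (h : WW f c n s a) :
    ∃ n1 n2, n = n1 + n2 ∧ WW f b n1 s a ∧ WW f c n2 ((-1) ^ n1 * s) b := by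
  induction n generalizing s a with
  | zero => exact ⟨0, 0, rfl, trivial, trivial⟩
  | succ n ih =>
    obtain ⟨p, h1, h2, h3, h4⟩ := h
    by_cases hp : p ≤ b
    · obtain ⟨n1, n2, e, g1, g2⟩ := ih h4
      refine ⟨n1 + 1, n2, by omega, ⟨p, h1, hp, h3, g1⟩, ?_⟩
      convert g2 using 1
      ring
    · refine ⟨0, n + 1, by omega, trivial, ?_⟩
      rw [pow_zero, one_mul]
      exact ⟨p, (not_le.1 hp).le, h2, h3, h4⟩

theorem WW.append {f : ℝ → ℝ} {b c : ℝ} {n1 n2 : ℕ} {s a : ℝ} (h1 : WW f b n1 s a)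
    (h2 : WW f c n2 ((-1) ^ n1 * s) b) (hab : a ≤ b) (hbc : b ≤ c) : WW f c (n1 + n2) s a := by
  induction n1 generalizing s a with
  | zero => simpa using h2.mono_u hab
  | succ n ih =>
    obtain ⟨p, g1, g2, g3, g4⟩ := h1
    rw [show n + 1 + n2 = (n + n2) + 1 by omega]
    refine ⟨p, g1, g2.trans hbc, g3, ih g4 ?_ g2⟩
    convert h2 using 1
    ring

structure Good (σ : ℝ) (f : ℝ → ℝ) : Prop where
  cont : Continuous f
  weak : ∀ s p q, p ≤ q → s * f p < s * f q → ∃ r ∈ Set.Icc p q, 0 < -σ * s * f (r - 1)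
  strict : ∀ s p q, p < q → (∀ r ∈ Set.Icc p q, 0 < s * f (r - 1)) →
    -σ * s * f p < -σ * s * f q

theorem WW.pull {σ : ℝ} {f : ℝ → ℝ} (hf : Good σ f) {v : ℝ} {n : ℕ} {s u : ℝ}
    (h : WW f v n s u) (hu : s * f u ≤ 0) : WW f (v - 1) n (-σ * s) (u - 1) := by
  induction n generalizing s u with
  | zero => trivial
  | succ n ih =>
    obtain ⟨p, h1, h2, h3, h4⟩ := h
    obtain ⟨r, hr, hr2⟩ := hf.weak s u p h1 (hu.trans_lt h3)
    refine ⟨r - 1, by linarith [hr.1], by linarith [hr.2], hr2, ?_⟩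
    have := ih h4 (by linarith)
    rw [show -(-σ * s) = -σ * -s by ring]
    exact this.mono_u (by linarith [hr.2])

theorem WW.lift {σ : ℝ} {f : ℝ → ℝ} (hf : Good σ f) {v : ℝ} {n : ℕ} {s u : ℝ}
    (h : WW f v (n + 1) s u) (hu : s * f u ≤ 0) (hv : f v = 0) :
    WW f (v - 1) (n + 2) (-σ * s) (u - 1) := by
  induction n generalizing s u with
  | zero =>
    obtain ⟨p, h1, h2, h3, h4⟩ := h
    obtain ⟨r, hr, hr2⟩ := hf.weak s u p h1 (hu.trans_lt h3)
    obtain ⟨r', hr', hr2'⟩ := hf.weak (-s) p v h2 (by rw [hv]; linarith)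
    refine ⟨r - 1, by linarith [hr.1], by linarith [hr.2], hr2, r' - 1, by linarith [hr.2, hr'.1],
      by linarith [hr'.2], ?_, trivial⟩
    rw [show -(-σ * s) = -σ * -s by ring]
    exact hr2'
  | succ n ih =>
    obtain ⟨p, h1, h2, h3, h4⟩ := h
    obtain ⟨r, hr, hr2⟩ := hf.weak s u p h1 (hu.trans_lt h3)
    refine ⟨r - 1, by linarith [hr.1], by linarith [hr.2], hr2, ?_⟩
    have := ih h4 (by linarith)
    rw [show -(-σ * s) = -σ * -s by ring]
    exact this.mono_u (by linarith [hr.2])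

theorem mono_step {σ : ℝ} {f : ℝ → ℝ} (hf : Good σ f) {n : ℕ} (hn : σ * (-1) ^ n = -1)
    {t t' : ℝ} (h1 : t ≤ t') (h2 : t' ≤ t + 1) {s : ℝ} (h : WW f t' n s (t' - 1)) :
    ∃ s', WW f t n s' (t - 1) := by
  obtain ⟨n1, n2, e, g1, g2⟩ := h.split (b := t)
  rcases n2 with _ | m
  · simp only [add_zero] at e
    subst e
    exact ⟨s, g1.mono_u (by linarith)⟩
  by_cases hs : (-1) ^ n1 * s * f t ≤ 0
  · have g3 := g2.pull hf hs
    refine ⟨-σ * ((-1) ^ n1 * s), ?_⟩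
    rw [e, add_comm]
    refine g3.append ?_ (by linarith) (by linarith)
    convert g1 using 1
    rw [show (-1 : ℝ) ^ (m + 1) * (-σ * ((-1) ^ n1 * s)) = - (σ * (-1) ^ (n1 + (m + 1))) * s by ring,
      ← e, hn]
    ring
  · push Not at hs
    obtain ⟨p, k1, k2, k3, k4⟩ := g2
    have g3 := (k4.pull hf (by linarith)).mono_u (u' := t - 1) (by linarith)
    have g4 : WW f t (n1 + 1) s (t' - 1) :=
      g1.append ⟨t, le_rfl, le_rfl, hs, trivial⟩ (by linarith) le_rfl
    refine ⟨-σ * -((-1) ^ n1 * s), ?_⟩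
    rw [e, show n1 + (m + 1) = m + (n1 + 1) by omega]
    refine g3.append ?_ (by linarith) (by linarith)
    convert g4 using 1
    rw [show (-1 : ℝ) ^ m * (-σ * -((-1) ^ n1 * s)) = - (σ * (-1) ^ (n1 + (m + 1))) * s by ring,
      ← e, hn]
    ring

theorem mono_all {σ : ℝ} {f : ℝ → ℝ} (hf : Good σ f) {n : ℕ} (hn : σ * (-1) ^ n = -1)
    {t t' : ℝ} (h1 : t ≤ t') (h : ∃ s, WW f t' n s (t' - 1)) :
    ∃ s', WW f t n s' (t - 1) := by
  obtain ⟨N, hN⟩ := exists_nat_ge (t' - t)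
  induction N generalizing t' with
  | zero =>
    obtain ⟨s, h⟩ := h
    exact mono_step hf hn h1 (by simp at hN; linarith) h
  | succ N ih =>
    obtain ⟨s, h⟩ := h
    push_cast at hN
    by_cases hc : t' ≤ t + 1
    · exact mono_step hf hn h1 hc h
    · exact ih (t' := t' - 1) (by linarith) (mono_step hf hn (by linarith) (by linarith) h)
        (by linarith)

theorem WW.eventually_v {f : ℝ → ℝ} {v : ℝ} {n : ℕ} {s u : ℝ} (h : WW f v n s u)
    (hv : f v = 0) : ∃ v' < v, ∀ w, v' ≤ w → WW f w n s u := by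
  induction n generalizing s u with
  | zero => exact ⟨v - 1, by linarith, fun _ _ => trivial⟩
  | succ n ih =>
    obtain ⟨p, h1, h2, h3, h4⟩ := h
    obtain ⟨v', g1, g2⟩ := ih h4
    have : p < v := lt_of_le_of_ne h2 (by rintro rfl; simp [hv] at h3)
    exact ⟨max v' p, max_lt g1 this, fun w hw => ⟨p, h1, (le_max_right _ _).trans hw, h3,
      g2 w ((le_max_left _ _).trans hw)⟩⟩

/-- sign neighbourhoods -/
theorem Good.nbhd {σ : ℝ} {f : ℝ → ℝ} (hf : Good σ f) {s z : ℝ} (h : 0 < s * f z) :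
    ∃ ε > 0, ∀ t, |t - z| ≤ ε → 0 < s * f t := by
  have hc : Continuous fun t => s * f t := continuous_const.mul hf.cont
  have := (hc.tendsto z).eventually (lt_mem_nhds h)
  obtain ⟨ε, h1, h2⟩ := Metric.eventually_nhds_iff.1 this
  refine ⟨ε / 2, by linarith, fun t ht => h2 ?_⟩
  rw [Real.dist_eq]
  linarith

/-- strict monotonicity near `z` if `s * f (z-1) > 0`. -/
theorem Good.mono_near {σ : ℝ} {f : ℝ → ℝ} (hf : Good σ f) {s a b : ℝ}
    (h : ∀ r ∈ Set.Icc a b, 0 < s * f (r - 1)) {p q : ℝ} (ha : a ≤ p) (hpq : p < q) (hb : q ≤ b) :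
    -σ * s * f p < -σ * s * f q :=
  hf.strict s p q hpq fun r hr => h r ⟨ha.trans hr.1, hr.2.trans hb⟩

theorem zero_fwd {σ : ℝ} {f : ℝ → ℝ} (hf : Good σ f) {a b : ℝ} (h : ∀ t ∈ Set.Icc a b, f t = 0)
    (hab : a + 1 ≤ b) : ∀ t ∈ Set.Icc a (b + 1), f t = 0 := by
  intro t ht
  by_cases htb : t ≤ b
  · exact h t ⟨ht.1, htb⟩
  push Not at htb
  have hb : f b = 0 := h b ⟨by linarith, le_rfl⟩
  by_contra hne
  have key : ∀ s : ℝ, ¬ (0 < s * f t) := by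
    intro s hs
    obtain ⟨r, hr, hr2⟩ := hf.weak s b t htb.le (by rw [hb]; linarith)
    rw [h (r - 1) ⟨by linarith [hr.1], by linarith [hr.2, ht.2]⟩] at hr2
    simp at hr2
  exact key (f t) (mul_self_pos.2 hne)

theorem zero_bwd {σ : ℝ} {f : ℝ → ℝ} (hf : Good σ f) {a b : ℝ}
    (h : ∀ t ∈ Set.Icc a b, f t = 0)
    (hab : a < b) : ∀ t ∈ Set.Icc (a - 1) (b - 1), f t = 0 := by
  intro t ht
  by_contra hne
  obtain ⟨ε, he, h2⟩ := hf.nbhd (s := f t) (z := t) (mul_self_pos.2 hne)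
  obtain ⟨p, q, hpq, h3, h4, h5⟩ : ∃ p q, p < q ∧ a ≤ p ∧ q ≤ b ∧
      ∀ r ∈ Set.Icc p q, |r - 1 - t| ≤ ε := by
    refine ⟨max a (t + 1 - ε), min b (t + 1 + ε), ?_, le_max_left _ _, min_le_left _ _, ?_⟩
    · simp only [max_lt_iff, lt_min_iff]
      have := ht.1
      have := ht.2
      exact ⟨⟨hab, by linarith⟩, by linarith, by linarith⟩
    · intro r hr
      have h6 := (le_max_right _ _).trans hr.1
      have h7 := hr.2.trans (min_le_right _ _)
      rw [abs_le]
      constructor <;> linarith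
  have := hf.strict (f t) p q hpq fun r hr => h2 _ (h5 r hr)
  rw [h p ⟨h3, by linarith⟩, h q ⟨by linarith, h4⟩] at this
  simp at this

theorem nonzero_seg {σ : ℝ} {f : ℝ → ℝ} (hf : Good σ f) (hne : ∃ t, f t ≠ 0)
    (z : ℝ) : ∃ s, WW f z 1 s (z - 1) := by
  by_contra hcon
  have h0 : ∀ t ∈ Set.Icc (z - 1) z, f t = 0 := by
    intro t ht
    by_contra h
    exact hcon ⟨f t, t, ht.1, ht.2, mul_self_pos.2 h, trivial⟩
  have hf1 : ∀ n : ℕ, ∀ t ∈ Set.Icc (z - 1) (z + n), f t = 0 := by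
    intro n
    induction n with
    | zero => simpa using h0
    | succ n ih =>
      have := zero_fwd hf ih (by linarith [Nat.cast_nonneg (α := ℝ) n])
      simpa [add_assoc] using this
  have hf2 : ∀ n : ℕ, ∀ t ∈ Set.Icc (z - 1 - n) (z - n), f t = 0 := by
    intro n
    induction n with
    | zero => simpa using h0
    | succ n ih =>
      have := zero_bwd hf ih (by linarith)
      simpa [sub_sub, add_assoc] using this
  obtain ⟨t, ht⟩ := hne
  apply ht
  by_cases hz : z - 1 ≤ t
  · obtain ⟨n, hn⟩ := exists_nat_ge (t - z)
    exact hf1 n t ⟨hz, by linarith⟩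
  · have h1 : 0 ≤ z - t := by linarith
    have := Nat.floor_le h1
    have := Nat.lt_floor_add_one (z - t)
    exact hf2 ⌊z - t⌋₊ t ⟨by linarith, by linarith⟩

theorem no_double {σ : ℝ} (hσ : σ ≠ 0) {f : ℝ → ℝ} (hf : Good σ f) (hne : ∃ t, f t ≠ 0)
    {J : ℕ} (hJ : σ * (-1) ^ J = -1) (hup : ∀ t s, ¬ WW f t (J + 2) s (t - 1))
    (hlow : ∀ t, 2 ≤ J → ∃ s, WW f t J s (t - 1)) {z : ℝ} (hz : f z = 0) (hz1 : f (z - 1) = 0) :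
    False := by
  have c1 : ∀ s, ¬ WW f z (J + 1) s (z - 1) := by
    intro s h
    exact hup _ _ (h.lift hf (by simp [hz1]) hz)
  have hJ1 : 1 ≤ J := by
    rcases J with _ | J
    · obtain ⟨s, hs⟩ := nonzero_seg hf hne z
      exact absurd hs (c1 s)
    · omega
  obtain ⟨s, hs⟩ : ∃ s, WW f z J s (z - 1) := by
    by_cases h2 : 2 ≤ J
    · exact hlow z h2
    · obtain rfl : J = 1 := by omega
      exact nonzero_seg hf hne z
  obtain ⟨j, rfl⟩ : ∃ j, J = j + 1 := ⟨J - 1, by omega⟩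
  have h1 := hs.lift hf (by simp [hz1]) hz
  by_cases hz2 : f (z - 1 - 1) = 0
  · exact hup _ _ (h1.lift hf (by simp [hz2]) hz1)
  obtain ⟨ε, he, hn⟩ := hf.nbhd (s := f (z - 1 - 1)) (z := z - 1 - 1) (mul_self_pos.2 hz2)
  have hmono : ∀ p q, z - 1 - ε ≤ p → p < q → q ≤ z - 1 + ε →
      -σ * f (z - 1 - 1) * f p < -σ * f (z - 1 - 1) * f q := by
    intro p q g1 g2 g3
    refine hf.mono_near (a := z - 1 - ε) (b := z - 1 + ε) ?_ g1 g2 g3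
    intro r hr
    apply hn
    rw [abs_le]
    constructor <;> linarith [hr.1, hr.2]
  set d := -σ * f (z - 1 - 1) with hd
  have hd0 : d ≠ 0 := by simp [hd, hσ, hz2]
  have hsne : s ≠ 0 := by
    rintro rfl
    obtain ⟨p, _, _, h, _⟩ := hs
    simp at h
  rcases lt_or_gt_of_ne (mul_ne_zero hd0 hsne) with hds | hds
  · -- extra point to the right of z - 1
    obtain ⟨p, k1, k2, k3, k4⟩ := hs
    have hp : z - 1 < p := lt_of_le_of_ne k1 (by rintro rfl; simp [hz1] at k3)
    set w := min p (z - 1 + ε) with hw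
    have hw1 : z - 1 < w := lt_min hp (by linarith)
    have := hmono (z - 1) w (by linarith) hw1 (min_le_right _ _)
    rw [hz1, mul_zero] at this
    refine c1 (-s) ⟨w, hw1.le, (min_le_left _ _).trans k2, ?_, p, min_le_left _ _, k2, ?_, ?_⟩
    · by_contra hc
      nlinarith [mul_pos (neg_pos.2 hds) this, mul_self_pos.2 hd0]
    · simpa using k3
    · simpa using k4
  · obtain ⟨v', hv', hv2⟩ := h1.eventually_v hz1
    set w := max v' (z - 1 - ε) with hw
    have hw1 : w < z - 1 := max_lt hv' (by linarith)
    have hw2 : WW f (z-1) (j + 2) (-σ * s) (z - 1 - 1) := h1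
    have := hmono w (z - 1) (le_max_right _ _) hw1 (by linarith)
    rw [hz1, mul_zero] at this
    have hwl : z - 1 - 1 ≤ w := by
      obtain ⟨p, k1, k2, k3, k4⟩ := hv2 w (le_max_left _ _)
      exact k1.trans k2
    refine hup _ _ ((hv2 w (le_max_left _ _)).append (n2 := 1) ⟨w, le_rfl, hw1.le, ?_, trivial⟩
      hwl hw1.le)
    rw [show (-1 : ℝ) ^ (j + 2) * (-σ * s) = (σ * (-1) ^ (j + 1)) * s by ring, hJ]
    by_contra hc
    nlinarith [mul_pos hds (neg_pos.2 this), mul_self_pos.2 hd0]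

theorem sgn_trans {s d x : ℝ} (h1 : 0 < s * d) (h2 : 0 < d * x) : 0 < s * x := by
  have hd : d ≠ 0 := by rintro rfl; simp at h1
  have h := mul_pos h1 h2
  by_contra hc
  push Not at hc
  nlinarith [mul_self_pos.2 hd]

theorem sgn_trans' {s d x : ℝ} (h1 : 0 < s * x) (h2 : 0 < d * x) : 0 < s * d :=
  sgn_trans h1 (by linarith [mul_comm d x])

theorem WW.const {g f : ℝ → ℝ} {u v d s : ℝ} {n : ℕ} (h : WW g v n s u)
    (hg : ∀ t, u ≤ t → t ≤ v → 0 < d * g t) (hf : 0 < d * f u) (huv : u ≤ v) :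
    WW f v n s u := by
  rcases n with _ | _ | n
  · trivial
  · obtain ⟨p, h1, h2, h3, -⟩ := h
    exact ⟨u, le_rfl, huv, sgn_trans (sgn_trans' h3 (hg p h1 h2)) hf, trivial⟩
  · exfalso
    obtain ⟨p, h1, h2, h3, q, h5, h6, h7, -⟩ := h
    have k1 := sgn_trans' h3 (hg p h1 h2)
    have k2 := sgn_trans' h7 (hg q (h1.trans h5) h6)
    linarith

theorem WW.monotone {g f : ℝ → ℝ} {u v d s : ℝ} {n : ℕ} (h : WW g v n s u)
    (hg : ∀ p q, u ≤ p → p ≤ q → q ≤ v → d * g p ≤ d * g q) (hu : d * f u < 0)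
    (hv : 0 < d * f v) (huv : u ≤ v) :
    WW f v n s u := by
  have hd : d ≠ 0 := by rintro rfl; simp at hv
  have pos : 0 < s * d → 0 < s * f v := fun h => sgn_trans h hv
  have neg : 0 < s * -d → 0 < s * f u := fun h => sgn_trans h (by linarith)
  have neg2 : 0 < s * -d → 0 < -s * f v := fun h => sgn_trans (by linarith : 0 < -s * d) hv
  rcases n with _ | _ | n
  · trivial
  · obtain ⟨p, h1, h2, h3, -⟩ := h
    have hs : s ≠ 0 := by rintro rfl; simp at h3
    rcases lt_or_gt_of_ne (mul_ne_zero hs hd) with h | h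
    · exact ⟨u, le_rfl, huv, neg (by linarith), trivial⟩
    · exact ⟨v, huv, le_rfl, pos h, trivial⟩
  · obtain ⟨p, h1, h2, h3, q, h5, h6, h7, h8⟩ := h
    have hs : s ≠ 0 := by rintro rfl; simp at h3
    have hpq := hg p q h1 h5 h6
    have hsd : 0 < s * -d := by
      rcases lt_or_gt_of_ne (mul_ne_zero hs hd) with h | h
      · linarith
      · have k1 : 0 < d * g p := sgn_trans (by linarith [mul_comm s d]) h3
        have k2 : 0 < (-d) * g q := sgn_trans (by linarith [mul_comm s d] : 0 < (-d) * (-s)) h7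
        linarith
    rcases n with _ | n
    · exact ⟨u, le_rfl, huv, neg hsd, v, huv, le_rfl, neg2 hsd, trivial⟩
    · exfalso
      obtain ⟨r, m1, m2, m3, -⟩ := h8
      have hqr := hg q r (h1.trans h5) m1 m2
      have k1 : 0 < d * g q := sgn_trans (by linarith [mul_comm s d] : 0 < d * (-s)) h7
      have k2 : 0 < (-d) * g r := sgn_trans (by linarith [mul_comm s d] : 0 < (-d) * (- -s)) m3
      linarith

def QQ (F : ℕ → ℝ → ℝ) (f : ℝ → ℝ) (a b : ℝ) : Prop :=
  ∀ᶠ i in atTop, ∀ n s, WW (F i) b n s a → WW f b n s a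

theorem QQ.trans {F : ℕ → ℝ → ℝ} {f : ℝ → ℝ} {a b c : ℝ} (h1 : QQ F f a b) (h2 : QQ F f b c)
    (hab : a ≤ b) (hbc : b ≤ c) : QQ F f a c := by
  filter_upwards [h1, h2] with i k1 k2 n s h
  obtain ⟨n1, n2, rfl, g1, g2⟩ := h.split (b := b)
  exact (k1 _ _ g1).append (k2 _ _ g2) hab hbc

theorem local_QQ {σ : ℝ} {F : ℕ → ℝ → ℝ} {f : ℝ → ℝ} (hf : Good σ f)
    (hF : ∀ i, 1 ≤ i → Good σ (F i))
    (hCL : ∀ s z, 0 < s * f z → ∃ ε > 0, ∀ᶠ i in atTop, ∀ t, |t - z| ≤ ε → 0 < s * F i t)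
    (hsimple : ∀ z, f z = 0 → f (z - 1) ≠ 0) (z : ℝ) :
    ∃ ε > 0, ∀ u v, z - ε ≤ u → u ≤ v → v ≤ z + ε → f u ≠ 0 → f v ≠ 0 → QQ F f u v := by
  by_cases hz : f z = 0
  · have hz1 := mul_self_pos.2 (hsimple z hz)
    obtain ⟨ε₁, he₁, h1⟩ := hf.nbhd hz1
    obtain ⟨ε₂, he₂, h2⟩ := hCL _ _ hz1
    refine ⟨min ε₁ ε₂, lt_min he₁ he₂, fun u v hu huv hv hfu hfv => ?_⟩
    have m1 := min_le_left ε₁ ε₂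
    have m2 := min_le_right ε₁ ε₂
    set e := f (z - 1) with hedef
    have hmono : ∀ p q, u ≤ p → p ≤ q → q ≤ v → -σ * e * f p ≤ -σ * e * f q := by
      intro p q k1 k2 k3
      rcases k2.eq_or_lt with rfl | k2
      · exact le_rfl
      refine (hf.mono_near (a := u) (b := v) ?_ k1 k2 k3).le
      intro r hr
      apply h1
      rw [abs_le]
      constructor <;> linarith [hr.1, hr.2]
    have hmonoF : ∀ᶠ i in atTop, ∀ p q, u ≤ p → p ≤ q → q ≤ v →
        -σ * e * F i p ≤ -σ * e * F i q := by
      filter_upwards [h2, eventually_ge_atTop 1] with i hi hi1 p q k1 k2 k3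
      rcases k2.eq_or_lt with rfl | k2
      · exact le_rfl
      refine ((hF i hi1).mono_near (a := u) (b := v) ?_ k1 k2 k3).le
      intro r hr
      apply hi
      rw [abs_le]
      constructor <;> linarith [hr.1, hr.2]
    set d := -σ * e with hd
    have hd0 : d ≠ 0 := by
      intro h0
      have := hf.mono_near (s := e) (a := z) (b := z + ε₁) (p := z) (q := z + ε₁) (by
        intro r hr
        apply h1
        rw [abs_le]
        constructor <;> linarith [hr.1, hr.2]) le_rfl (by linarith) le_rfl
      rw [← hd, h0] at this
      simp at this
    have pt : ∀ s t, 0 < s * f t → ∀ᶠ i in atTop, 0 < s * F i t := by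
      intro s t h
      obtain ⟨ε, he, h'⟩ := hCL s t h
      filter_upwards [h'] with i hi
      exact hi t (by simpa using he.le)
    rcases lt_or_gt_of_ne (mul_ne_zero hd0 hfu) with hdu | hdu
    · rcases lt_or_gt_of_ne (mul_ne_zero hd0 hfv) with hdv | hdv
      · filter_upwards [hmonoF, pt (-d) v (by linarith)] with i k1 k2 n s h
        refine h.const (d := -d) (fun t t1 t2 => ?_) (by linarith) huv
        have := k1 t v t1 t2 le_rfl
        linarith
      · filter_upwards [hmonoF] with i k1 n s h
        exact h.monotone k1 hdu hdv huv
    · filter_upwards [hmonoF, pt d u hdu] with i k1 k2 n s h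
      refine h.const (d := d) (fun t t1 t2 => ?_) hdu huv
      have := k1 u t le_rfl t1 t2
      linarith
  · have hz1 := mul_self_pos.2 hz
    obtain ⟨ε₁, he₁, h1⟩ := hf.nbhd hz1
    obtain ⟨ε₂, he₂, h2⟩ := hCL _ _ hz1
    refine ⟨min ε₁ ε₂, lt_min he₁ he₂, fun u v hu huv hv hfu hfv => ?_⟩
    have m1 := min_le_left ε₁ ε₂
    have m2 := min_le_right ε₁ ε₂
    filter_upwards [h2] with i hi n s h
    refine h.const (d := f z) (fun t t1 t2 => hi t ?_) (h1 u ?_) huv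
    · rw [abs_le]
      constructor <;> linarith
    · rw [abs_le]
      constructor <;> linarith

theorem dense_nz {σ : ℝ} {f : ℝ → ℝ} (hf : Good σ f)
    (hsimple : ∀ z, f z = 0 → f (z - 1) ≠ 0) (z δ : ℝ) (hδ : 0 < δ) :
    ∃ u, z - δ < u ∧ u ≤ z ∧ f u ≠ 0 := by
  by_cases hz : f z = 0
  · have hz1 := mul_self_pos.2 (hsimple z hz)
    obtain ⟨ε, he, h1⟩ := hf.nbhd hz1
    have m1 := min_le_left (δ / 2) ε
    have m2 := min_le_right (δ / 2) ε
    have m3 : 0 < min (δ / 2) ε := lt_min (by linarith) he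
    refine ⟨z - min (δ / 2) ε, by linarith, by linarith, fun h => ?_⟩
    have := hf.strict (f (z - 1)) (z - min (δ / 2) ε) z (by linarith) (by
      intro r hr
      apply h1
      rw [abs_le]
      constructor <;> linarith [hr.1, hr.2])
    rw [h, hz] at this
    simp at this
  · exact ⟨z, by linarith, le_rfl, hz⟩

theorem global_QQ {σ : ℝ} {F : ℕ → ℝ → ℝ} {f : ℝ → ℝ} (hf : Good σ f)
    (hF : ∀ i, 1 ≤ i → Good σ (F i))
    (hCL : ∀ s z, 0 < s * f z → ∃ ε > 0, ∀ᶠ i in atTop, ∀ t, |t - z| ≤ ε → 0 < s * F i t)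
    (hsimple : ∀ z, f z = 0 → f (z - 1) ≠ 0) {a b : ℝ} (hab : a ≤ b)
    (ha : f a ≠ 0) (hb : f b ≠ 0) : QQ F f a b := by
  choose ε he hloc using local_QQ hf hF hCL hsimple
  obtain ⟨t, ht0, htm, ⟨M, hM⟩, hcov⟩ := exists_monotone_Icc_subset_open_cover_Icc hab
    (c := fun z : ℝ => {t : Set.Icc a b | |(t : ℝ) - z| < ε z})
    (fun z => by
      apply isOpen_lt <;> fun_prop)
    (fun t _ => Set.mem_iUnion.2 ⟨t, by simpa using he t⟩)
  have key : ∀ n, ∀ v, a ≤ v → v ≤ t n → f v ≠ 0 → QQ F f a v := by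
    intro n
    induction n with
    | zero =>
      intro v h1 h2 h3
      rw [ht0] at h2
      obtain rfl : a = v := le_antisymm h1 h2
      exact hloc a a a (by linarith [he a]) le_rfl (by linarith [he a]) ha ha
    | succ n ih =>
      intro v h1 h2 h3
      by_cases hv : v ≤ t n
      · exact ih v h1 hv h3
      push Not at hv
      obtain ⟨z, hz⟩ := hcov n
      have z1 : |((t n : Set.Icc a b) : ℝ) - z| < ε z := hz ⟨le_rfl, htm (Nat.le_succ n)⟩
      have z2 : |v - z| < ε z :=
        hz (a := ⟨v, h1, h2.trans (t (n+1)).2.2⟩) ⟨hv.le, h2⟩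
      rw [abs_lt] at z1 z2
      obtain ⟨u, u1, u2, u3, u4⟩ : ∃ u, a ≤ u ∧ u ≤ t n ∧ z - ε z ≤ u ∧ f u ≠ 0 := by
        rcases (t n).2.1.eq_or_lt with h | h
        · exact ⟨a, le_rfl, h.le, by rw [h]; linarith, ha⟩
        · obtain ⟨u, k1, k2, k3⟩ := dense_nz hf hsimple (t n)
            (min ((t n : ℝ) - a) ((t n : ℝ) - (z - ε z))) (lt_min (by linarith) (by linarith))
          have m1 := min_le_left ((t n : ℝ) - a) ((t n : ℝ) - (z - ε z))
          have m2 := min_le_right ((t n : ℝ) - a) ((t n : ℝ) - (z - ε z))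
          exact ⟨u, by linarith, k2, by linarith, k3⟩
      exact (ih u u1 u2 u4).trans
        (hloc z u v u3 (by linarith) (by linarith) u4 h3) u1 (by linarith)
  exact key M b hab (by rw [hM M le_rfl]) hb

theorem WW.limit {F : ℕ → ℝ → ℝ} {f : ℝ → ℝ}
    (pt : ∀ s t, 0 < s * f t → ∀ᶠ i in atTop, 0 < s * F i t) {v : ℝ} {n : ℕ} {s u : ℝ}
    (h : WW f v n s u) : ∀ᶠ i in atTop, WW (F i) v n s u := by
  induction n generalizing s u with
  | zero => exact Eventually.of_forall fun _ => trivial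
  | succ n ih =>
    obtain ⟨p, h1, h2, h3, h4⟩ := h
    filter_upwards [ih h4, pt s p h3] with i k1 k2
    exact ⟨p, h1, h2, k2, k1⟩

theorem abstract_main {σ : ℝ} (hσ : σ ≠ 0) {F : ℕ → ℝ → ℝ} {f : ℝ → ℝ} (hf : Good σ f)
    (hF : ∀ i, 1 ≤ i → Good σ (F i))
    (hCL : ∀ s z, 0 < s * f z → ∃ ε > 0, ∀ᶠ i in atTop, ∀ t, |t - z| ≤ ε → 0 < s * F i t)
    (hne : ∃ t, f t ≠ 0)
    {J : ℕ} (hJ : σ * (-1) ^ J = -1) (hup : ∀ t s, ¬ WW f t (J + 2) s (t - 1))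
    (hlow : ∀ t, 2 ≤ J → ∃ s, WW f t J s (t - 1)) (a b : ℝ) :
    ∃ i₀ : ℕ, ∀ i, i₀ ≤ i → ∀ t ∈ Set.Icc a b,
      (∀ s, ¬ WW (F i) t (J + 2) s (t - 1)) ∧ (2 ≤ J → ∃ s, WW (F i) t J s (t - 1)) := by
  have hsimple : ∀ z, f z = 0 → f (z - 1) ≠ 0 := fun z h1 h2 =>
    no_double hσ hf hne hJ hup hlow h1 h2
  have pt : ∀ s t, 0 < s * f t → ∀ᶠ i in atTop, 0 < s * F i t := by
    intro s t h
    obtain ⟨ε, he, h'⟩ := hCL s t h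
    filter_upwards [h'] with i hi
    exact hi t (by simpa using he.le)
  obtain ⟨τ, hτa, hτ, hτ1⟩ : ∃ τ ≤ a, f τ ≠ 0 ∧ f (τ - 1) ≠ 0 := by
    obtain ⟨w, w1, w2, w3⟩ := dense_nz hf hsimple a 1 one_pos
    obtain ⟨ε, he, h1⟩ := hf.nbhd (mul_self_pos.2 w3)
    obtain ⟨y, y1, y2, y3⟩ := dense_nz hf hsimple (w - 1) ε he
    refine ⟨y + 1, by linarith, ?_, by simpa using y3⟩
    have := h1 (y + 1) (by rw [abs_le]; constructor <;> linarith)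
    intro h0
    rw [h0] at this
    simp at this
  have hQ := global_QQ hf hF hCL hsimple (by linarith : τ - 1 ≤ τ) hτ1 hτ
  have hL : ∀ᶠ i in atTop, 2 ≤ J → ∃ s, WW (F i) b J s (b - 1) := by
    by_cases h2 : 2 ≤ J
    · obtain ⟨s, hs⟩ := hlow b h2
      filter_upwards [hs.limit pt] with i hi _
      exact ⟨s, hi⟩
    · exact Eventually.of_forall fun i h => absurd h h2
  obtain ⟨i₀, h⟩ := eventually_atTop.1 (hQ.and (hL.and (eventually_ge_atTop 1)))
  refine ⟨i₀, fun i hi t ht => ?_⟩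
  obtain ⟨k1, k2, k3⟩ := h i hi
  refine ⟨fun s hs => ?_, fun h2 => mono_all (hF i k3) hJ ht.2 (k2 h2)⟩
  obtain ⟨s', hs'⟩ := mono_all (hF i k3) (n := J + 2) (by rw [pow_add, ← mul_assoc, hJ]; norm_num)
    (hτa.trans ht.1) ⟨s, hs⟩
  exact hup _ _ (k1 _ _ hs')

open Topology in
theorem WW.scale {f : ℝ → ℝ} (hf : Continuous f) (c : ℝ) {v : ℝ} {n : ℕ} {s u : ℝ}
    (h : WW f v n s u) : ∀ᶠ l in 𝓝 (1 : ℝ), WW f (c + l * (v - c)) n s (c + l * (u - c)) := by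
  induction n generalizing s u with
  | zero => exact Eventually.of_forall fun _ => trivial
  | succ n ih =>
    obtain ⟨p, h1, h2, h3, h4⟩ := h
    have hc : Continuous fun l : ℝ => s * f (c + l * (p - c)) := by fun_prop
    have e1 : ∀ᶠ l in 𝓝 (1 : ℝ), 0 < s * f (c + l * (p - c)) :=
      (hc.tendsto 1).eventually (lt_mem_nhds (by simpa using h3))
    filter_upwards [ih h4, e1, lt_mem_nhds (zero_lt_one)] with l k1 k2 k3
    refine ⟨c + l * (p - c), ?_, ?_, k2, k1⟩
    · nlinarith
    · nlinarith

theorem WW.interior {f : ℝ → ℝ} (hf : Continuous f) {t : ℝ} {n : ℕ} {s : ℝ}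
    (h : WW f t n s (t - 1)) : ∃ u v, t - 1 < u ∧ v < t ∧ WW f v n s u := by
  have h1 := h.scale hf (t - 1 / 2)
  obtain ⟨ε, he, h2⟩ := Metric.eventually_nhds_iff.1 h1
  have := @h2 (1 - min (ε / 2) (1 / 2)) (by
    rw [Real.dist_eq, abs_lt]
    have m1 := min_le_left (ε / 2) (1 / 2 : ℝ)
    have m3 : 0 < min (ε / 2) (1 / 2 : ℝ) := lt_min (by linarith) (by norm_num)
    constructor <;> linarith)
  have m3 : 0 < min (ε / 2) (1 / 2 : ℝ) := lt_min (by linarith) (by norm_num)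
  exact ⟨_, _, by linarith, by linarith, this⟩

theorem WW.extract {f : ℝ → ℝ} {v : ℝ} {k : ℕ} {s u : ℝ} (h : WW f v (k + 1) s u) :
    ∃ p : ℕ → ℝ, u ≤ p 0 ∧ p k ≤ v ∧ 0 < s * f (p 0) ∧
      ∀ n < k, p n < p (n + 1) ∧ f (p n) * f (p (n + 1)) < 0 := by
  induction k generalizing s u with
  | zero =>
    obtain ⟨p, h1, h2, h3, -⟩ := h
    exact ⟨fun _ => p, h1, h2, h3, by simp⟩
  | succ k ih =>
    obtain ⟨p, h1, h2, h3, h4⟩ := h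
    obtain ⟨q, g1, g2, g3, g4⟩ := ih h4
    refine ⟨fun n => Nat.casesOn n p q, h1, g2, h3, ?_⟩
    have hneg : f p * f (q 0) < 0 := by
      have := sgn_trans (by linarith [mul_comm s (f p)] : 0 < f p * s)
        (by linarith : 0 < s * -f (q 0))
      linarith
    rintro (_ | n) hn
    · refine ⟨lt_of_le_of_ne g1 ?_, hneg⟩
      intro e
      replace e : p = q 0 := e
      rw [← e] at hneg
      nlinarith [mul_self_nonneg (f p)]
    · exact g4 n (by omega)

theorem WW.build {f : ℝ → ℝ} {v : ℝ} {k : ℕ} {s : ℝ} (p : ℕ → ℝ) (h1 : p k ≤ v)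
    (h2 : ∀ n < k, p n < p (n + 1) ∧ f (p n) * f (p (n + 1)) < 0) (h3 : 0 < s * f (p 0)) :
    WW f v (k + 1) s (p 0) := by
  induction k generalizing s p with
  | zero => exact ⟨p 0, le_rfl, h1, h3, trivial⟩
  | succ k ih =>
    have h5 := h2 0 (by omega)
    have h4 := ih (fun n => p (n + 1)) h1 (fun n hn => h2 (n + 1) (by omega)) (s := -s) (by
      have := sgn_trans h3 (by linarith [h5.2] : 0 < f (p 0) * -f (p (0 + 1)))
      linarith)
    have hle : p 0 ≤ v := by
      obtain ⟨r, r1, r2, -⟩ := h4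
      exact h5.1.le.trans (r1.trans r2)
    exact ⟨p 0, le_rfl, hle, h3, h4.mono_u h5.1.le⟩

theorem scw_iff {f : ℝ → ℝ} (hf : Continuous f) (t : ℝ) {k : ℕ} (hk : 1 ≤ k) :
    SignChangeWitness (fun θ : I01 => f (t + (θ : ℝ))) k ↔ ∃ s, WW f t (k + 1) s (t - 1) := by
  constructor
  · rintro ⟨θ, h1, h2, h3, h4⟩
    set p : ℕ → ℝ := fun n => t + (θ ⟨min n k, by omega⟩ : ℝ) with hp
    have h5 : ∀ n < k, p n < p (n + 1) ∧ f (p n) * f (p (n + 1)) < 0 := by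
      intro n hn
      have e1 : (⟨min n k, by omega⟩ : Fin (k + 1)) = Fin.castSucc ⟨n, hn⟩ := by
        ext; simp; omega
      have e2 : (⟨min (n + 1) k, by omega⟩ : Fin (k + 1)) = Fin.succ ⟨n, hn⟩ := by
        ext; simp; omega
      simp only [hp, e1, e2]
      refine ⟨?_, h4 _⟩
      have := h1 (Fin.castSucc_lt_succ (i := ⟨n, hn⟩))
      simp only at this
      linarith
    have h0 : f (p 0) ≠ 0 := by
      intro h
      have := (h5 0 (by omega)).2
      rw [h] at this
      simp at this
    refine ⟨f (p 0), (WW.build p ?_ h5 (mul_self_pos.2 h0)).mono_u ?_⟩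
    · have := (θ ⟨min k k, by omega⟩).2.2
      simp only [hp]
      linarith
    · have := (θ ⟨min 0 k, by omega⟩).2.1
      simp only [hp]
      linarith
  · rintro ⟨s, h⟩
    obtain ⟨u, v, hu, hv, h'⟩ := h.interior hf
    obtain ⟨p, g1, g2, g3, g4⟩ := h'.extract
    have hm : ∀ m ≤ k, ∀ n ≤ m, p n ≤ p m := by
      intro m
      induction m with
      | zero => intro _ n hn; obtain rfl : n = 0 := by omega
                exact le_rfl
      | succ m ih =>
        intro hm n hn
        rcases hn.eq_or_lt with rfl | hn
        · exact le_rfl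
        · exact (ih (by omega) n (by omega)).trans (g4 m (by omega)).1.le
    have mem : ∀ i : Fin (k + 1), p i - t ∈ I01 := by
      intro i
      have k1 := hm i (by omega) 0 (by omega)
      have k2 := hm k le_rfl i (by omega)
      exact ⟨by linarith, by linarith⟩
    refine ⟨fun i => ⟨p i - t, mem i⟩, ?_, ?_, ?_, ?_⟩
    · rw [Fin.strictMono_iff_lt_succ]
      intro i
      have := (g4 i i.2).1
      simpa using this
    · simp only [Fin.val_zero]
      linarith
    · simp only [Fin.val_last]
      linarith
    · intro i
      simpa using (g4 i i.2).2

theorem sc_ge {φ : I01 → ℝ} (hd : ∀ k, 1 ≤ k → SignChangeWitness φ (k + 1) → SignChangeWitness φ k)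
    {k : ℕ} (hk : 1 ≤ k) : (k : ℕ∞) ≤ sc φ ↔ SignChangeWitness φ k := by
  constructor
  · intro h
    by_contra hc
    have hall : ∀ j, k ≤ j → ¬ SignChangeWitness φ j := by
      intro j hj
      induction j, hj using Nat.le_induction with
      | base => exact hc
      | succ j hj ih => exact fun h => ih (hd j (hk.trans hj) h)
    have : sc φ ≤ ((k - 1 : ℕ) : ℕ∞) := by
      apply sSup_le
      rintro _ ⟨j, _, h2, rfl⟩
      have : j < k := by
        by_contra hh
        exact hall j (by omega) h2
      exact_mod_cast (by omega : j ≤ k - 1)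
    have h3 := h.trans this
    have h4 : k ≤ k - 1 := by exact_mod_cast h3
    omega
  · intro h
    exact le_sSup ⟨k, hk, h, rfl⟩

theorem Vpm_iff {φ : I01 → ℝ}
    (hd : ∀ k, 1 ≤ k → SignChangeWitness φ (k + 1) → SignChangeWitness φ k)
    {par J : ℕ} (hpar : par < 2) : Vpm par φ = (J : ℕ∞) ↔
      J % 2 = par ∧ ¬ SignChangeWitness φ (J + 1) ∧ (2 ≤ J → SignChangeWitness φ (J - 1)) := by
  rw [← sc_ge hd (by omega : 1 ≤ J + 1)]
  have e : (2 ≤ J → SignChangeWitness φ (J - 1)) ↔ (2 ≤ J → ((J - 1 : ℕ) : ℕ∞) ≤ sc φ) :=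
    forall_congr' fun h => (sc_ge hd (by omega)).symm
  rw [e]
  unfold Vpm
  generalize sc φ = c
  induction c using ENat.recTopCoe with
  | top => simp
  | coe n =>
    have e1 : (∃ n' : ℕ, (n : ℕ∞) = (n' : ℕ∞) ∧ n' % 2 ≠ par) ↔ n % 2 ≠ par := by
      constructor
      · rintro ⟨n', h, h'⟩
        rw [Nat.cast_inj] at h
        exact h ▸ h'
      · intro h; exact ⟨n, rfl, h⟩
    simp only [e1]
    split_ifs with h
    · rw [show (n : ℕ∞) + 1 = ((n + 1 : ℕ) : ℕ∞) by push_cast; rfl]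
      simp only [Nat.cast_inj, Nat.cast_le]
      omega
    · simp only [Nat.cast_inj, Nat.cast_le]
      omega

theorem Vpm_iff' {f : ℝ → ℝ} (hf : Continuous f) (t : ℝ) {par J : ℕ} (hpar : par < 2) :
    Vpm par (fun θ : I01 => f (t + (θ : ℝ))) = (J : ℕ∞) ↔
      J % 2 = par ∧ (∀ s, ¬ WW f t (J + 2) s (t - 1)) ∧ (2 ≤ J → ∃ s, WW f t J s (t - 1)) := by
  rw [Vpm_iff _ hpar, scw_iff hf t (by omega), not_exists]
  · have : (2 ≤ J → SignChangeWitness (fun θ : I01 => f (t + (θ : ℝ))) (J - 1)) ↔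
        (2 ≤ J → ∃ s, WW f t J s (t - 1)) := by
      refine forall_congr' fun h => ?_
      rw [scw_iff hf t (by omega), show J - 1 + 1 = J by omega]
    rw [this]
  · intro k hk
    rw [scw_iff hf t (by omega), scw_iff hf t hk]
    rintro ⟨s, hs⟩
    exact ⟨s, hs.pred⟩

theorem WW.congr {f g : ℝ → ℝ} (hfg : ∀ t s, 0 < s * f t → 0 < s * g t) {v : ℝ} {n : ℕ} {s u : ℝ}
    (h : WW f v n s u) : WW g v n s u := by
  induction n generalizing s u with
  | zero => trivial
  | succ n ih =>
    obtain ⟨p, h1, h2, h3, h4⟩ := h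
    exact ⟨p, h1, h2, hfg _ _ h3, ih h4⟩

theorem exp_lip {C u v : ℝ} (hu : |u| ≤ C) (hv : |v| ≤ C) :
    |Real.exp u - Real.exp v| ≤ Real.exp C * |u - v| := by
  wlog h : v ≤ u generalizing u v
  · rw [abs_sub_comm, abs_sub_comm u]
    exact this hv hu (by linarith)
  rw [abs_of_nonneg (sub_nonneg.2 (Real.exp_le_exp.2 h)), abs_of_nonneg (sub_nonneg.2 h)]
  have h1 := Real.add_one_le_exp (v - u)
  have h2 : Real.exp v = Real.exp u * Real.exp (v - u) := by rw [← Real.exp_add]; ring_nf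
  have h3 : Real.exp u ≤ Real.exp C := Real.exp_le_exp.2 ((le_abs_self u).trans hu)
  have h4 := Real.exp_pos u
  rw [h2]
  nlinarith

theorem exp_ac_s10 {B : ℝ → ℝ} {p q : ℝ} (h : AbsolutelyContinuousOnInterval B p q) :
    AbsolutelyContinuousOnInterval (fun t => Real.exp (B t)) p q := by
  obtain ⟨C, hC⟩ := h.exists_bound
  rw [absolutelyContinuousOnInterval_iff] at h ⊢
  intro ε hε
  obtain ⟨δ, hδ, h1⟩ := h (ε / Real.exp C) (by positivity)
  refine ⟨δ, hδ, fun E hE hlen => ?_⟩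
  have h2 := h1 E hE hlen
  rw [lt_div_iff₀ (Real.exp_pos C), Finset.sum_mul] at h2
  refine lt_of_le_of_lt (Finset.sum_le_sum fun i hi => ?_) h2
  rw [Real.dist_eq, Real.dist_eq, mul_comm]
  exact exp_lip (hC _ (hE.1 i hi).1) (hC _ (hE.1 i hi).2)

theorem sol_cont {a c x : ℝ → ℝ} (hx : IsGlobalSolution a c x) : Continuous x := by
  rw [continuous_iff_continuousAt]
  intro t
  have := (hx (t - 1) (t + 1) (by linarith)).1
  exact this.continuousAt (Icc_mem_nhds (by linarith) (by linarith))

theorem sol_ident {a c x : ℝ → ℝ} (ha : ∀ p q, IntervalIntegrable a volume p q)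
    (hc : ∀ p q, IntervalIntegrable c volume p q) (hx : IsGlobalSolution a c x) {p q : ℝ}
    (hpq : p ≤ q) :
    Real.exp (∫ s in (0:ℝ)..q, a s) * x q - Real.exp (∫ s in (0:ℝ)..p, a s) * x p =
      ∫ r in p..q, Real.exp (∫ s in (0:ℝ)..r, a s) * (-(c r * x (r - 1))) := by
  have hxc := sol_cont hx
  set g : ℝ → ℝ := fun s => a s * x s + c s * x (s - 1) with hg
  have hgi : IntervalIntegrable g volume p q :=
    ((ha p q).mul_continuousOn hxc.continuousOn).add
      ((hc p q).mul_continuousOn (by fun_prop : Continuous fun s => x (s - 1)).continuousOn)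
  have hB := (ha p q).absolutelyContinuousOnInterval_intervalIntegral (c := p) Set.left_mem_uIcc
  have hG := hgi.absolutelyContinuousOnInterval_intervalIntegral (c := p) Set.left_mem_uIcc
  have hE := exp_ac_s10 hB
  have hX : AbsolutelyContinuousOnInterval (fun t => x p - ∫ s in p..t, g s) p q := by
    have hcst : AbsolutelyContinuousOnInterval (fun _ : ℝ => x p) p q :=
      (LipschitzWith.const (x p)).lipschitzOnWith.absolutelyContinuousOnInterval
    exact hcst.fun_sub hG
  have hXx : ∀ t ∈ Set.Icc p q, x p - ∫ s in p..t, g s = x t := fun t ht =>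
    ((hx p q hpq).2 t ht).symm
  have key := hE.integral_deriv_mul_eq_sub hX
  have hsplit : ∀ t, Real.exp (∫ s in (0:ℝ)..t, a s) =
      Real.exp (∫ s in (0:ℝ)..p, a s) * Real.exp (∫ s in p..t, a s) := by
    intro t
    rw [← Real.exp_add, intervalIntegral.integral_add_adjacent_intervals (ha _ _) (ha _ _)]
  have e1 : ∫ r in p..q, Real.exp (∫ s in (0:ℝ)..r, a s) * (-(c r * x (r - 1))) =
      Real.exp (∫ s in (0:ℝ)..p, a s) *
        ∫ r in p..q, Real.exp (∫ s in p..r, a s) * (-(c r * x (r - 1))) := by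
    rw [← intervalIntegral.integral_const_mul]
    congr 1
    ext r
    rw [hsplit r]
    ring
  have e2 : ∫ r in p..q, Real.exp (∫ s in p..r, a s) * (-(c r * x (r - 1))) =
      Real.exp (∫ s in p..q, a s) * x q - x p := by
    have k1 := hXx q ⟨hpq, le_rfl⟩
    have k2 := hXx p ⟨le_rfl, hpq⟩
    rw [k1, k2, intervalIntegral.integral_same, Real.exp_zero, one_mul] at key
    rw [← key]
    apply intervalIntegral.integral_congr_ae
    filter_upwards [(ha p q).ae_hasDerivAt_integral, hgi.ae_hasDerivAt_integral] with r h1 h2 hr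
    have hr' := Set.uIoc_subset_uIcc hr
    have d1 := (h1 hr' p Set.left_mem_uIcc).exp.deriv
    have d2 := ((h2 hr' p Set.left_mem_uIcc).const_sub (x p)).deriv
    rw [Set.uIcc_of_le hpq] at hr'
    rw [d1, d2, hXx r hr', hg]
    ring
  rw [e1, e2, hsplit q]
  ring

theorem good_of_ident {c x E : ℝ → ℝ} {σ δ : ℝ} (hσ : σ * σ = 1) (hδ : 0 < δ)
    (hc : ∀ p q, IntervalIntegrable c volume p q) (hcs : ∀ᵐ t ∂volume, δ ≤ σ * c t)
    (hx : Continuous x) (hE : Continuous E) (hEp : ∀ t, 0 < E t)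
    (hid : ∀ p q, p ≤ q → E q * x q - E p * x p = ∫ r in p..q, E r * (-(c r * x (r - 1)))) :
    Good σ (fun t => E t * x t) := by
  have key : ∀ w p q, p ≤ q → (∀ r ∈ Set.Icc p q, 0 ≤ w * x (r - 1)) →
      ∫ r in p..q, δ * (E r * (w * x (r - 1))) ≤ -σ * w * (E q * x q - E p * x p) := by
    intro w p q hpq hw
    rw [hid p q hpq, ← intervalIntegral.integral_const_mul]
    have hcont : Continuous fun r => x (r - 1) := by fun_prop
    apply intervalIntegral.integral_mono_ae_restrict hpq
    · apply Continuous.intervalIntegrable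
      fun_prop
    · exact ((((hc p q).mul_continuousOn hcont.continuousOn).neg).continuousOn_mul
        hE.continuousOn).const_mul _
    · have h1 := ae_restrict_of_ae (s := Set.Icc p q) hcs
      filter_upwards [h1, ae_restrict_mem measurableSet_Icc] with r h2 h3
      have h4 := mul_nonneg (hEp r).le (hw r h3)
      have h5 : -σ * w * (E r * -(c r * x (r - 1))) = (σ * c r) * (E r * (w * x (r - 1))) := by
        ring
      simp only [h5]
      exact mul_le_mul_of_nonneg_right h2 h4
  refine ⟨hE.mul hx, ?_, ?_⟩
  · intro s p q hpq hlt
    by_contra hcon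
    push Not at hcon
    have hw : ∀ r ∈ Set.Icc p q, 0 ≤ σ * s * x (r - 1) := by
      intro r hr
      have h1 := hcon r hr
      by_contra h2
      push Not at h2
      have := mul_pos (hEp (r - 1)) (neg_pos.2 h2)
      nlinarith
    have h1 := key (σ * s) p q hpq hw
    have h2 : 0 ≤ ∫ r in p..q, δ * (E r * (σ * s * x (r - 1))) :=
      intervalIntegral.integral_nonneg hpq fun r hr =>
        mul_nonneg hδ.le (mul_nonneg (hEp r).le (hw r hr))
    have h3 : -σ * (σ * s) * (E q * x q - E p * x p) =
        -(σ * σ) * (s * (E q * x q) - s * (E p * x p)) := by ring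
    rw [h3, hσ] at h1
    linarith
  · intro s p q hpq hr
    have hw : ∀ r ∈ Set.Icc p q, 0 < s * x (r - 1) := by
      intro r hr'
      have h1 := hr r hr'
      by_contra h2
      push Not at h2
      have := mul_nonneg (hEp (r - 1)).le (neg_nonneg.2 h2)
      nlinarith
    have h1 := key s p q hpq.le fun r hr => (hw r hr).le
    have h2 : 0 < ∫ r in p..q, δ * (E r * (s * x (r - 1))) := by
      apply intervalIntegral.intervalIntegral_pos_of_pos_on _ _ hpq
      · apply Continuous.intervalIntegrable
        fun_prop
      · intro r hr'
        exact mul_pos hδ (mul_pos (hEp r) (hw r ⟨hr'.1.le, hr'.2.le⟩))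
    linarith

theorem good_of_sol {a c x : ℝ → ℝ} {σ δ : ℝ} (hσ : σ * σ = 1) (hδ : 0 < δ)
    (ha : ∀ p q, IntervalIntegrable a volume p q)
    (hc : ∀ p q, IntervalIntegrable c volume p q) (hcs : ∀ᵐ t ∂volume, δ ≤ σ * c t)
    (hx : IsGlobalSolution a c x) :
    Good σ (fun t => Real.exp (∫ s in (0:ℝ)..t, a s) * x t) := by
  have hA : Continuous fun t => ∫ s in (0:ℝ)..t, a s :=
    intervalIntegral.continuous_primitive ha 0
  exact good_of_ident hσ hδ hc hcs (sol_cont hx) hA.rexp (fun t => Real.exp_pos _)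
    (fun p q hpq => sol_ident ha hc hx hpq)

theorem sol_limit {α β : ℝ → ℝ} (hα : ∀ p q, IntervalIntegrable α volume p q)
    (hβ : ∀ p q, IntervalIntegrable β volume p q) {β₀ : ℝ}
    {κ : ℕ → ℝ} {κ₀ : ℝ} (hκ : ∀ i, κ i ∈ Set.Icc (0 : ℝ) 1)
    (hκlim : Tendsto κ atTop (nhds κ₀))
    {x : ℕ → ℝ → ℝ} {x₀ : ℝ → ℝ}
    (hsol : ∀ i : ℕ, 1 ≤ i →
      IsGlobalSolution (fun t => κ i * α t)
        (fun t => κ i * β t + (1 - κ i) * β₀) (x i))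
    (hconv : ∀ a b : ℝ, TendstoUniformlyOn x x₀ atTop (Set.Icc a b)) :
    IsGlobalSolution (fun t => κ₀ * α t) (fun t => κ₀ * β t + (1 - κ₀) * β₀) x₀ := by
  intro τ T hτT
  have hx0 : ContinuousOn x₀ (Set.Icc (τ - 1) T) := by
    refine (hconv (τ - 1) T).continuousOn ?_
    apply Eventually.frequently
    filter_upwards [eventually_ge_atTop 1] with i hi
    exact (sol_cont (hsol i hi)).continuousOn
  refine ⟨hx0, fun t ht => ?_⟩
  have pt : ∀ s, Tendsto (fun i => x i s) atTop (nhds (x₀ s)) := fun s =>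
    (hconv s s).tendsto_at ⟨le_rfl, le_rfl⟩
  obtain ⟨C, hC⟩ := isCompact_Icc.exists_bound_of_continuousOn hx0
  have hM : ∀ᶠ i in atTop, ∀ s ∈ Set.Icc (τ - 1) T, |x i s| ≤ C + 1 := by
    filter_upwards [Metric.tendstoUniformlyOn_iff.1 (hconv (τ - 1) T) 1 one_pos] with i hi s hs
    have h1 := hi s hs
    have h2 := hC s hs
    rw [Real.dist_eq, abs_sub_comm] at h1
    rw [Real.norm_eq_abs] at h2
    have := abs_sub_abs_le_abs_sub (x i s) (x₀ s)
    linarith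
  have hlim : Tendsto (fun i => ∫ s in τ..t, (κ i * α s * x i s +
      (κ i * β s + (1 - κ i) * β₀) * x i (s - 1))) atTop
      (nhds (∫ s in τ..t, (κ₀ * α s * x₀ s + (κ₀ * β s + (1 - κ₀) * β₀) * x₀ (s - 1)))) := by
    apply intervalIntegral.tendsto_integral_filter_of_dominated_convergence
      (fun s => |α s| * (C + 1) + (|β s| + |β₀|) * (C + 1))
    · filter_upwards [eventually_ge_atTop 1] with i hi
      have hc := sol_cont (hsol i hi)
      have hc1 : Continuous fun s => x i (s - 1) := by fun_prop
      have : IntervalIntegrable (fun s => κ i * α s * x i s +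
          (κ i * β s + (1 - κ i) * β₀) * x i (s - 1)) volume τ t :=
        (((hα τ t).const_mul _).mul_continuousOn hc.continuousOn).add
          ((((hβ τ t).const_mul _).add intervalIntegrable_const).mul_continuousOn
            hc1.continuousOn)
      exact this.aestronglyMeasurable_restrict_uIoc
    · filter_upwards [hM] with i hi
      refine Eventually.of_forall fun s hs => ?_
      rw [Set.uIoc_of_le ht.1] at hs
      have b1 := hi s ⟨by linarith [hs.1], hs.2.trans ht.2⟩
      have b2 := hi (s - 1) ⟨by linarith [hs.1], by linarith [hs.2, ht.2]⟩
      have k0 := (hκ i).1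
      have k1 := (hκ i).2
      rw [Real.norm_eq_abs]
      refine (abs_add_le _ _).trans (add_le_add ?_ ?_)
      · rw [abs_mul, abs_mul, abs_of_nonneg k0]
        refine mul_le_mul ?_ b1 (abs_nonneg _) (abs_nonneg _)
        nlinarith [abs_nonneg (α s)]
      · rw [abs_mul]
        refine mul_le_mul ?_ b2 (abs_nonneg _) (by positivity)
        refine (abs_add_le _ _).trans (add_le_add ?_ ?_)
        · rw [abs_mul, abs_of_nonneg k0]
          nlinarith [abs_nonneg (β s)]
        · rw [abs_mul, abs_of_nonneg (by linarith)]
          nlinarith [abs_nonneg β₀]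
    · exact (((hα τ t).abs).mul_const _).add
        ((((hβ τ t).abs).add intervalIntegrable_const).mul_const _)
    · refine Eventually.of_forall fun s _ => ?_
      exact ((hκlim.mul_const _).mul (pt s)).add
        (((hκlim.mul_const _).add ((hκlim.const_sub 1).mul_const _)).mul (pt (s - 1)))
  refine tendsto_nhds_unique (pt t) (Tendsto.congr' ?_ ((pt τ).sub hlim))
  filter_upwards [eventually_ge_atTop 1] with i hi
  exact ((hsol i hi τ T hτT).2 t ht).symm

theorem sgn_mul_pos {e x s : ℝ} (he : 0 < e) : 0 < s * (e * x) ↔ 0 < s * x := by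
  rw [show s * (e * x) = e * (s * x) by ring]
  exact mul_pos_iff_of_pos_left he

theorem CL_of_conv {x : ℕ → ℝ → ℝ} {x₀ : ℝ → ℝ} (hx : Continuous x₀)
    (hconv : ∀ a b : ℝ, TendstoUniformlyOn x x₀ atTop (Set.Icc a b)) (s z : ℝ)
    (h : 0 < s * x₀ z) :
    ∃ ε > 0, ∀ᶠ i in atTop, ∀ t, |t - z| ≤ ε → 0 < s * x i t := by
  have hc : Continuous fun t => s * x₀ t := by fun_prop
  have h1 := (hc.tendsto z).eventually (lt_mem_nhds (half_lt_self h))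
  obtain ⟨ε, he, h2⟩ := Metric.eventually_nhds_iff.1 h1
  have hs : s ≠ 0 := by rintro rfl; simp at h
  have hs' : 0 < |s| := abs_pos.2 hs
  refine ⟨ε / 2, by linarith, ?_⟩
  filter_upwards [Metric.tendstoUniformlyOn_iff.1 (hconv (z - ε) (z + ε))
    (s * x₀ z / 2 / |s|) (by positivity)] with i hi t ht
  have h3 := h2 (y := t) (by rw [Real.dist_eq]; linarith)
  rw [abs_le] at ht
  have h4 := hi t ⟨by linarith, by linarith⟩
  rw [Real.dist_eq, lt_div_iff₀ hs', ← abs_mul] at h4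
  have h5 := (le_abs_self _).trans_lt h4
  nlinarith

theorem statement10 (α β : ℝ → ℝ)
    (hα : LocallyIntegrable α volume) (hβ : LocallyIntegrable β volume)
    (γ : ℝ) (hγ : 0 < γ)
    (hαper : ∀ᵐ t ∂volume, α (t + γ) = α t) (hβper : ∀ᵐ t ∂volume, β (t + γ) = β t)
    (m : ℤ) (β₀ : ℝ) (hβ₀ : 0 < (-1 : ℝ) ^ m * β₀)
    (hsign : ∀ᵐ t ∂volume, (-1 : ℝ) ^ m * β₀ ≤ (-1 : ℝ) ^ m * β t)
    (κ : ℕ → ℝ) (κ₀ : ℝ) (hκ : ∀ i, κ i ∈ Set.Icc (0 : ℝ) 1)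
    (hκ₀ : κ₀ ∈ Set.Icc (0 : ℝ) 1) (hκlim : Tendsto κ atTop (nhds κ₀))
    (x : ℕ → ℝ → ℝ) (x₀ : ℝ → ℝ)
    (hsol : ∀ i : ℕ, 1 ≤ i →
      IsGlobalSolution (fun t => κ i * α t)
        (fun t => κ i * β t + (1 - κ i) * β₀) (x i))
    (hconv : ∀ a b : ℝ, TendstoUniformlyOn x x₀ atTop (Set.Icc a b))
    (hx₀ : ∃ t : ℝ, x₀ t ≠ 0)
    (J : ℕ)
    (hJ : ∀ t : ℝ,
      Vpm (if m % 2 = 0 then 1 else 0) (fun θ : I01 => x₀ (t + (θ : ℝ))) = (J : ℕ∞)) :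
    ∀ a b : ℝ, ∃ i₀ : ℕ, ∀ i : ℕ, i₀ ≤ i → ∀ t ∈ Set.Icc a b,
      Vpm (if m % 2 = 0 then 1 else 0) (fun θ : I01 => x i (t + (θ : ℝ))) = (J : ℕ∞) := by
  have hαi : ∀ p q, IntervalIntegrable α volume p q := fun p q =>
    (hα.integrableOn_isCompact isCompact_uIcc).intervalIntegrable
  have hβi : ∀ p q, IntervalIntegrable β volume p q := fun p q =>
    (hβ.integrableOn_isCompact isCompact_uIcc).intervalIntegrable
  set σ : ℝ := (-1 : ℝ) ^ m with hσdef
  set par : ℕ := if m % 2 = 0 then 1 else 0 with hpar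
  have hpar2 : par < 2 := by
    rw [hpar]; split_ifs <;> norm_num
  have hσpar : ∀ j : ℕ, j % 2 = par → σ * (-1) ^ j = -1 := by
    intro j hj
    by_cases hm : m % 2 = 0
    · have h1 : σ = 1 := (Int.even_iff.2 hm).neg_one_zpow
      have h2 : Odd j := Nat.odd_iff.2 (by rw [hj, hpar, if_pos hm])
      rw [h1, h2.neg_one_pow]; norm_num
    · have h1 : σ = -1 := (Int.odd_iff.2 (by omega)).neg_one_zpow
      have h2 : Even j := Nat.even_iff.2 (by rw [hj, hpar, if_neg hm])
      rw [h1, h2.neg_one_pow]; norm_num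
  have hσσ : σ * σ = 1 := by
    rcases Int.even_or_odd m with h | h
    · rw [hσdef, h.neg_one_zpow]; norm_num
    · rw [hσdef, h.neg_one_zpow]; norm_num
  have hσ0 : σ ≠ 0 := by rintro h; rw [h] at hσσ; simp at hσσ
  have hai : ∀ k : ℝ, ∀ p q, IntervalIntegrable (fun t => k * α t) volume p q :=
    fun k p q => (hαi p q).const_mul _
  have hci : ∀ k : ℝ, ∀ p q, IntervalIntegrable (fun t => k * β t + (1 - k) * β₀) volume p q :=
    fun k p q => ((hβi p q).const_mul _).add intervalIntegrable_const
  have hcs : ∀ k ∈ Set.Icc (0 : ℝ) 1,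
      ∀ᵐ t ∂volume, σ * β₀ ≤ σ * (k * β t + (1 - k) * β₀) := by
    intro k hk
    filter_upwards [hsign] with t ht
    have := mul_le_mul_of_nonneg_left ht hk.1
    linarith
  have hsol0 := sol_limit hαi hβi hκ hκlim hsol hconv
  have hx0c := sol_cont hsol0
  set f : ℝ → ℝ := fun t => Real.exp (∫ s in (0:ℝ)..t, κ₀ * α s) * x₀ t with hf
  set F : ℕ → ℝ → ℝ := fun i t => Real.exp (∫ s in (0:ℝ)..t, κ i * α s) * x i t with hF
  have hfx : ∀ t s, 0 < s * f t ↔ 0 < s * x₀ t := fun t s => sgn_mul_pos (Real.exp_pos _)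
  have hFx : ∀ i t s, 0 < s * F i t ↔ 0 < s * x i t := fun i t s => sgn_mul_pos (Real.exp_pos _)
  have hJ' := fun t => (Vpm_iff' hx0c t hpar2).1 (hJ t)
  have hJpar := (hJ' 0).1
  intro a b
  obtain ⟨i₀, hi₀⟩ := abstract_main (σ := σ) hσ0 (F := F) (f := f) (J := J)
    (good_of_sol hσσ hβ₀ (hai _) (hci _) (hcs _ hκ₀) hsol0)
    (fun i hi => good_of_sol hσσ hβ₀ (hai _) (hci _) (hcs _ (hκ i)) (hsol i hi))
    (by
      intro s z h
      simp only [hFx]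
      exact CL_of_conv hx0c hconv s z ((hfx z s).1 h))
    (by
      obtain ⟨t, ht⟩ := hx₀
      exact ⟨t, mul_ne_zero (Real.exp_pos _).ne' ht⟩)
    (hσpar J hJpar)
    (fun t s h => (hJ' t).2.1 s (h.congr fun t s => (hfx t s).1))
    (fun t h2 => by
      obtain ⟨s, hs⟩ := (hJ' t).2.2 h2
      exact ⟨s, hs.congr fun t s => (hfx t s).2⟩) a b
  refine ⟨max i₀ 1, fun i hi t ht => ?_⟩
  obtain ⟨g1, g2⟩ := hi₀ i ((le_max_left _ _).trans hi) t ht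
  rw [Vpm_iff' (sol_cont (hsol i ((le_max_right _ _).trans hi))) t hpar2]
  refine ⟨hJpar, fun s h => g1 s (h.congr fun t s => (hFx i t s).2), fun h2 => ?_⟩
  obtain ⟨s, hs⟩ := g2 h2
  exact ⟨s, hs.congr fun t s => (hFx i t s).1⟩
end
end
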